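/- Let W be a vector space over ℂ and let S be any 𝒮-local subset of ℰ(W). Then the nonlocal vertex algebra ⟨S⟩ generated by S is a weak quantum vertex algebra, and W is a faithful ⟨S⟩-module with Y_W(α(x), x₀) = α(x₀) for α(x) ∈ ⟨S⟩. -/

import Mathlib

noncomputable section

open Classical

namespace NVA

/-! ### The space ℰ(W) = Hom(W, W((x))), coefficient-indexed by modes:
`a w n` is the mode `a_n` applied to `w`, where `a(x)w = ∑ (a_n w) x^{-n-1}`.
Lower truncation of `a(x)w` in powers of `x` means `a_n w = 0` for `n` large. -/

variable (W : Type*) [AddCommGroup W] [Module ℂ W]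

/-- `ℰ(W) = Hom(W, W((x)))` as a submodule of `Hom(W, W[[x^{±1}]])`. -/
def EWsub : Submodule ℂ (W →ₗ[ℂ] (ℤ → W)) where
  carrier := {a | ∀ w : W, ∃ N : ℤ, ∀ n : ℤ, N ≤ n → a w n = 0}
  add_mem' := by
    intro a b ha hb w
    obtain ⟨N, hN⟩ := ha w
    obtain ⟨M, hM⟩ := hb w
    refine ⟨max N M, fun n hn => ?_⟩
    simp only [LinearMap.add_apply, Pi.add_apply,
      hN n (le_trans (le_max_left _ _) hn), hM n (le_trans (le_max_right _ _) hn), add_zero]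
  zero_mem' := by intro w; exact ⟨0, fun n _ => rfl⟩
  smul_mem' := by
    intro c a ha w
    obtain ⟨N, hN⟩ := ha w
    exact ⟨N, fun n hn => by
      simp only [LinearMap.smul_apply, Pi.smul_apply, hN n hn, smul_zero]⟩

/-- The type `ℰ(W)`. -/
abbrev EW := ↥(EWsub W)

variable {W}

/-- The mode function of an element of `ℰ(W)`. -/
def mf (a : EW W) : W → ℤ → W := fun w n => (a : W →ₗ[ℂ] (ℤ → W)) w n

/-- The identity operator `1_W`, as an element of `ℰ(W)`. -/
def oneE : EW W :=
  ⟨{ toFun := fun w n => if n = -1 then w else 0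
     map_add' := by
       intro w w'; funext n; by_cases h : n = -1 <;> simp [h]
     map_smul' := by
       intro c w; funext n; by_cases h : n = -1 <;> simp [h] },
   fun w => ⟨0, fun n hn => if_neg (by omega)⟩⟩

/-- The generalized binomial coefficient `C(m, j)` for `m ∈ ℤ`, as a complex number. -/
def binom (m : ℤ) (j : ℕ) : ℂ :=
  (∏ i ∈ Finset.range j, ((m : ℂ) - (i : ℂ))) / (j.factorial : ℂ)

/-- The coefficient of `x₁^m x₂^t` in `a(x₁) b(x₂) w`. -/
def Fab (a b : EW W) (w : W) (m t : ℤ) : W := mf a (mf b w (-t - 1)) (-m - 1)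

/-- Multiplication of a two-variable family by a polynomial `p(x₁,x₂)`. -/
def mulPoly (p : MvPolynomial (Fin 2) ℂ) (F : ℤ → ℤ → W) : ℤ → ℤ → W :=
  fun m t => ∑ d ∈ p.support, MvPolynomial.coeff d p • F (m - d 0) (t - d 1)

/-- A two-variable family lies in `W((x₁,x₂))` (jointly lower truncated). -/
def IsLaurent2 (F : ℤ → ℤ → W) : Prop :=
  ∃ N : ℤ, ∀ m t : ℤ, (m < N ∨ t < N) → F m t = 0

/-- Quasi compatibility of an ordered pair `(a(x), b(x))` in `ℰ(W)`:
`p(x₁,x₂) a(x₁) b(x₂) ∈ Hom(W, W((x₁,x₂)))` for some nonzero polynomial `p`. -/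
def QCPair (a b : EW W) : Prop :=
  ∃ p : MvPolynomial (Fin 2) ℂ, p ≠ 0 ∧ ∀ w, IsLaurent2 (mulPoly p (Fab a b w))

/-! ### Sequences -/

/-- The coefficient of `x₁^{k 1} ⋯ x_r^{k r}` in `ψ₁(x₁) ⋯ ψ_r(x_r) w`. -/
def seqCoeff : {r : ℕ} → (Fin r → EW W) → W → (Fin r → ℤ) → W
  | 0, _, w, _ => w
  | _ + 1, ψ, w, k => mf (ψ 0) (seqCoeff (Fin.tail ψ) w (Fin.tail k)) (-(k 0) - 1)

/-- The polynomial `∏_{1 ≤ i < j ≤ r} p(x_i, x_j)`. -/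
def pairPoly (p : MvPolynomial (Fin 2) ℂ) (r : ℕ) : MvPolynomial (Fin r) ℂ :=
  ∏ ij ∈ Finset.univ.filter (fun ij : Fin r × Fin r => ij.1 < ij.2),
    MvPolynomial.rename ![ij.1, ij.2] p

/-- Multiplication of an `r`-variable family by a polynomial in `r` variables. -/
def mulPolyN {r : ℕ} (P : MvPolynomial (Fin r) ℂ) (F : (Fin r → ℤ) → W) :
    (Fin r → ℤ) → W :=
  fun k => ∑ d ∈ P.support, MvPolynomial.coeff d P • F (fun i => k i - d i)

/-- An `r`-variable family lies in `W((x₁,…,x_r))`. -/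
def IsLaurentN {r : ℕ} (F : (Fin r → ℤ) → W) : Prop :=
  ∃ N : ℤ, ∀ k : Fin r → ℤ, (∃ i, k i < N) → F k = 0

/-- Quasi compatibility of an ordered sequence in `ℰ(W)`. -/
def QCSeq {r : ℕ} (ψ : Fin r → EW W) : Prop :=
  ∃ p : MvPolynomial (Fin 2) ℂ, p ≠ 0 ∧
    ∀ w, IsLaurentN (mulPolyN (pairPoly p r) (seqCoeff ψ w))

/-- Quasi compatibility of a subset of `ℰ(W)`. -/
def QCSet (S : Set (EW W)) : Prop :=
  ∀ (r : ℕ) (ψ : Fin r → EW W), (∀ i, ψ i ∈ S) → QCSeq ψ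

/-! ### The vertex operation `Y_ℰ^{(α)}` -/

/-- `ℂ((x))`. -/
abbrev LC : Type := LaurentSeries ℂ

/-- An iterated Laurent series field, e.g. `ℂ((x))((x₀))` (outer variable the second one). -/
abbrev K2 : Type := HahnSeries ℤ LC

/-- The outer variable of `K2`. -/
def xOuter : K2 := HahnSeries.single 1 1

/-- The inner variable of `K2`. -/
def xInner : K2 := HahnSeries.single 0 (HahnSeries.single 1 1)

/-- `α` times the inner variable of `K2`. -/
def xInnerC (c : ℂ) : K2 := HahnSeries.single 0 (HahnSeries.single 1 c)

/-- The polynomial `p(x₀ + α x, x)` as an element of `ℂ((x))((x₀))`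
(outer variable `x₀`). -/
def qK (p : MvPolynomial (Fin 2) ℂ) (α : ℂ) : K2 :=
  MvPolynomial.aeval ![xOuter + xInnerC α, xInner] p

/-- The expansion `ι_{x,x₀} (p(x₀ + α x, x)^{-1}) ∈ ℂ((x))((x₀))`. -/
def qInv (p : MvPolynomial (Fin 2) ℂ) (α : ℂ) : K2 := (qK p α)⁻¹

/-- The coefficient of `x₀^j x^t` in `(p(x₁,x) a(x₁) b(x) w)|_{x₁ = αx + x₀}`,
expanding via `(αx+x₀)^m = ∑_{j≥0} C(m,j) α^{m-j} x^{m-j} x₀^j`. -/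
def substYE (α : ℂ) (p : MvPolynomial (Fin 2) ℂ) (a b : EW W) (w : W)
    (j : ℕ) (t : ℤ) : W :=
  ∑ᶠ m : ℤ, (binom m j * α ^ (m - (j : ℤ))) • mulPoly p (Fab a b w) m (t - m + j)

/-- The coefficient of `x₀^J x^T` in
`ι_{x,x₀}(p(x₀+αx,x)^{-1}) ⬝ (p(x₁,x)a(x₁)b(x)w)|_{x₁ = αx+x₀}`. -/
def fullYE (α : ℂ) (p : MvPolynomial (Fin 2) ℂ) (a b : EW W) (w : W)
    (J T : ℤ) : W :=
  ∑ᶠ s : ℤ × ℤ, (((qInv p α).coeff s.1).coeff s.2) •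
    (if 0 ≤ J - s.1 then substYE α p a b w (J - s.1).toNat (T - s.2) else 0)

/-- The raw mode family of `Y_ℰ^{(α)}(a(x), x₀) b(x)`; `rawYE α a b n w m` is the mode
`m` of the element `a(x)_{(α,n)} b(x)` applied to `w`.  (Defined using a choice of
polynomial from quasi compatibility; by the general theory the value does not depend
on the choice.) -/
def rawYE (α : ℂ) (a b : EW W) (n : ℤ) (w : W) (m : ℤ) : W :=
  if h : QCPair a b then fullYE α h.choose a b w (-n - 1) (-m - 1) else 0

/-- `a(x)_{(α,n)} b(x)`, as an element of `ℰ(W)` whenever the raw family is realized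
by one (which is the case for any quasi compatible pair). -/
def YEa (α : ℂˣ) (a b : EW W) (n : ℤ) : EW W :=
  if h : ∃ c : EW W, ∀ w m, mf c w m = rawYE (α : ℂ) a b n w m then h.choose else 0

/-- `a(x)_n b(x) = a(x)_{(1,n)} b(x)`. -/
def YE (a b : EW W) (n : ℤ) : EW W := YEa 1 a b n

end NVA

namespace NVA

variable {W : Type*} [AddCommGroup W] [Module ℂ W]

/-- Submodules of `ℰ(W)` are `ℂ`-vector spaces (registered explicitly to assist
instance resolution). -/
noncomputable instance (V : Submodule ℂ (EW W)) : AddCommGroup ↥V :=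
  @Submodule.addCommGroup ℂ (EW W) _ inferInstance inferInstance V

noncomputable instance (V : Submodule ℂ (EW W)) : Module ℂ ↥V :=
  @Submodule.module ℂ (EW W) _ inferInstance inferInstance V

/-! ### Derivative and scaling operators on ℰ(W) -/

/-- `D = d/dx` on `ℰ(W)`: `(Da)_m = -m • a_{m-1}`. -/
def Dop (a : EW W) : EW W :=
  ⟨{ toFun := fun w m => (-m : ℂ) • mf a w (m - 1)
     map_add' := by intro w w'; funext m; simp [mf, map_add]
     map_smul' := by
       intro c w; funext m
       simp only [mf, map_smul, Pi.smul_apply, RingHom.id_apply]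
       exact smul_comm _ _ _ },
   by
     intro w
     obtain ⟨N, hN⟩ := a.2 w
     exact ⟨N + 1, fun m hm => by
       have : (a : W →ₗ[ℂ] (ℤ → W)) w (m - 1) = 0 := hN _ (by omega)
       simp [mf, this]⟩⟩

/-- `R_α : a(x) ↦ a(αx)`, on modes `(R_α a)_m = α^{-m-1} a_m`. -/
def RaE (α : ℂˣ) (a : EW W) : EW W :=
  ⟨{ toFun := fun w m => ((α : ℂ) ^ (-m - 1 : ℤ)) • mf a w m
     map_add' := by intro w w'; funext m; simp [mf, map_add]
     map_smul' := by
       intro c w; funext m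
       simp only [mf, map_smul, Pi.smul_apply, RingHom.id_apply]
       exact smul_comm _ _ _ },
   by
     intro w
     obtain ⟨N, hN⟩ := a.2 w
     exact ⟨N, fun m hm => by simp [mf, hN m hm]⟩⟩

/-! ### Nonlocal vertex algebras, modules and quasi modules -/

/-- The coefficient of `x₀^a x₂^b` in `Y₁(u, x₀+x₂) (Y₂(v,x₂) w)`, where
`(x₀+x₂)^m` is expanded in nonnegative powers of `x₂`. -/
def prodCE {V : Type*} (Yo Yi : V → W → ℤ → W) (u v : V) (w : W) (a b : ℤ) : W :=
  ∑ᶠ m : ℤ, if a ≤ m then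
    binom m (m - a).toNat • Yo u (Yi v w (-(b - (m - a)) - 1)) (-m - 1) else 0

/-- The coefficient of `x₀^a x₂^b` in `Y₂(Y₁(u,x₀)v, x₂) w`. -/
def assocCE {V : Type*} (Y1 : V → V → ℤ → V) (Y2 : V → W → ℤ → W)
    (u v : V) (w : W) (a b : ℤ) : W :=
  Y2 (Y1 u v (-a - 1)) w (-b - 1)

/-- Multiplication of a two-variable family (in `x₀, x₂`) by `f(x₀+x₂, x₂)` for a
polynomial `f`, expanding `(x₀+x₂)^d` in nonnegative powers of `x₂`. -/
def mulSubPoly (f : MvPolynomial (Fin 2) ℂ) (A : ℤ → ℤ → W) (a b : ℤ) : W :=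
  ∑ d ∈ f.support, ∑ i ∈ Finset.range (d 0 + 1),
    (MvPolynomial.coeff d f * ((d 0).choose i : ℂ)) •
      A (a - ((d 0 : ℤ) - i)) (b - i - (d 1 : ℤ))

/-- A nonlocal vertex algebra structure on a ℂ-vector space `V`:
a linear map `Y : V → ℰ(V) = Hom(V, V((x)))` and a vacuum vector `1` such that
`Y(1,x)v = v`, `Y(v,x)1 ∈ V[[x]]` with constant term `v`, and weak associativity
holds. -/
structure NLVA (V : Type*) [AddCommGroup V] [Module ℂ V] where
  Y : V →ₗ[ℂ] EW V
  one : V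
  vac : ∀ (v : V) (n : ℤ), mf (Y one) v n = if n = -1 then v else 0
  creation0 : ∀ (v : V) (n : ℤ), 0 ≤ n → mf (Y v) one n = 0
  creation1 : ∀ v : V, mf (Y v) one (-1) = v
  wassoc : ∀ u v w : V, ∃ l : ℕ, ∀ a b : ℤ,
    mulSubPoly (MvPolynomial.X 0 ^ l)
      (prodCE (fun x => mf (Y x)) (fun x => mf (Y x)) u v w) a b =
    mulSubPoly (MvPolynomial.X 0 ^ l)
      (assocCE (fun x y n => mf (Y x) y n) (fun x => mf (Y x)) u v w) a b

/-- The mode maps of a nonlocal vertex algebra: `Yf A u v n = u_n v`. -/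
def Yf {V : Type*} [AddCommGroup V] [Module ℂ V] (A : NLVA V) : V → V → ℤ → V :=
  fun u v n => mf (A.Y u) v n

/-- Mode maps of a linear map `V → ℰ(W)`. -/
def YWf {V : Type*} [AddCommGroup V] [Module ℂ V] (YW : V →ₗ[ℂ] EW W) :
    V → W → ℤ → W := fun v w n => mf (YW v) w n

/-- `(W, Y_W)` is a quasi module for the nonlocal vertex algebra `A` on `V`. -/
def IsQuasiModule {V : Type*} [AddCommGroup V] [Module ℂ V] (A : NLVA V)
    (YW : V →ₗ[ℂ] EW W) : Prop :=
  (∀ (w : W) (n : ℤ), mf (YW A.one) w n = if n = -1 then w else 0) ∧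
  ∀ (u v : V) (w : W), ∃ f : MvPolynomial (Fin 2) ℂ, f ≠ 0 ∧ ∀ a b : ℤ,
    mulSubPoly f (prodCE (YWf YW) (YWf YW) u v w) a b =
    mulSubPoly f (assocCE (Yf A) (YWf YW) u v w) a b

/-- `(W, Y_W)` is a module for the nonlocal vertex algebra `A` on `V`. -/
def IsModule {V : Type*} [AddCommGroup V] [Module ℂ V] (A : NLVA V)
    (YW : V →ₗ[ℂ] EW W) : Prop :=
  (∀ (w : W) (n : ℤ), mf (YW A.one) w n = if n = -1 then w else 0) ∧
  ∀ (u v : V) (w : W), ∃ l : ℕ, ∀ a b : ℤ,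
    mulSubPoly (MvPolynomial.X 0 ^ l) (prodCE (YWf YW) (YWf YW) u v w) a b =
    mulSubPoly (MvPolynomial.X 0 ^ l) (assocCE (Yf A) (YWf YW) u v w) a b

end NVA

namespace NVA

variable {W : Type*} [AddCommGroup W] [Module ℂ W]
variable {V : Type*} [AddCommGroup V] [Module ℂ V]

/-! ### Pseudo-locality -/

/-- A power series `∑ f n x^n` as a Laurent series. -/
def psN (f : ℕ → ℂ) : LC := HahnSeries.ofPowerSeries ℤ ℂ (PowerSeries.mk f)

/-- `ι_{x₂,x₁}` of a formal power series `F(x₁,x₂) ∈ ℂ[[x₁,x₂]]`, given by its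
coefficient function, as an element of `ℂ((x₂))((x₁))` (outer variable `x₁`). -/
def psEmbed (F : ℕ → ℕ → ℂ) : K2 :=
  HahnSeries.ofPowerSeries ℤ LC (PowerSeries.mk (fun m => psN (F m)))

/-- The coefficient function of a polynomial in two variables. -/
def polyCoeffFun (g : MvPolynomial (Fin 2) ℂ) : ℕ → ℕ → ℂ :=
  fun m t => MvPolynomial.coeff (Finsupp.single 0 m + Finsupp.single 1 t) g

/-- `ι_{x₂,x₁}` of a polynomial in two variables. -/
def polyEmbed (g : MvPolynomial (Fin 2) ℂ) : K2 := psEmbed (polyCoeffFun g)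

/-- The coefficient function of an element of `ℂ((x₂))((x₁))`:
`k2Fun x m t` is the coefficient of `x₁^m x₂^t`. -/
def k2Fun (x : K2) : ℤ → ℤ → ℂ := fun m t => (x.coeff m).coeff t

/-- Multiplication of a two-variable family by a scalar-valued two-variable series. -/
def smulFam (c : ℤ → ℤ → ℂ) (G : ℤ → ℤ → W) : ℤ → ℤ → W :=
  fun m t => ∑ᶠ s : ℤ × ℤ, c s.1 s.2 • G (m - s.1) (t - s.2)

/-- Multiplication of a two-variable family by a Laurent polynomial
`p ∈ ℂ[x₁^{±1}, x₂^{±1}]` (recorded by its finitely supported coefficients). -/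
def mulLPoly (p : (ℤ × ℤ) →₀ ℂ) (G : ℤ → ℤ → W) : ℤ → ℤ → W :=
  fun m t => ∑ d ∈ p.support, p d • G (m - d.1) (t - d.2)

/-- A subset `S ⊆ ℰ(W)` is pseudo-local. -/
def PseudoLocal (S : Set (EW W)) : Prop :=
  ∀ a ∈ S, ∀ b ∈ S, ∃ p : (ℤ × ℤ) →₀ ℂ, p ≠ 0 ∧
    ∃ (r : ℕ) (F : Fin r → (ℕ → ℕ → ℂ)) (g : Fin r → MvPolynomial (Fin 2) ℂ)
      (u v : Fin r → EW W),
      (∀ i, g i ≠ 0) ∧ (∀ i, u i ∈ S) ∧ (∀ i, v i ∈ S) ∧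
      ∀ (w : W) (m t : ℤ),
        mulLPoly p (Fab a b w) m t =
          ∑ i, smulFam (k2Fun (psEmbed (F i) * (polyEmbed (g i))⁻¹))
            (fun m' t' => Fab (u i) (v i) w t' m') m t

/-- The coefficient of `x₁^m x₂^t` in `ι_{x₂,x₁} f(x₂ - x₁)`, for `f(x) ∈ ℂ((x))`. -/
def expandSub (f : LC) : ℤ → ℤ → ℂ :=
  fun m t => if 0 ≤ m then
    ((-1 : ℂ) ^ m.toNat * binom (t + m) m.toNat) * f.coeff (t + m) else 0

/-- A subset `S ⊆ ℰ(W)` is `𝒮`-local. -/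
def SLocal (S : Set (EW W)) : Prop :=
  ∀ a ∈ S, ∀ b ∈ S, ∃ (k : ℕ) (r : ℕ) (f : Fin r → LC) (u v : Fin r → EW W),
    (∀ i, u i ∈ S) ∧ (∀ i, v i ∈ S) ∧
    ∀ (w : W) (m t : ℤ),
      mulPoly ((MvPolynomial.X 0 - MvPolynomial.X 1) ^ k) (Fab a b w) m t =
        ∑ i, mulPoly ((MvPolynomial.X 0 - MvPolynomial.X 1) ^ k)
          (smulFam (expandSub (f i)) (fun m' t' => Fab (u i) (v i) w t' m')) m t

/-- `U` is the nonlocal vertex algebra `⟨S⟩` generated by `S`: the smallest closed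
quasi compatible subspace of `ℰ(W)` containing `S ∪ {1_W}`. -/
def IsGenVA (S : Set (EW W)) (U : Submodule ℂ (EW W)) : Prop :=
  QCSet (U : Set (EW W)) ∧ (∀ a ∈ U, ∀ b ∈ U, ∀ n : ℤ, YE a b n ∈ U) ∧
  oneE ∈ U ∧ S ⊆ U ∧
  ∀ U' : Submodule ℂ (EW W),
    (QCSet (U' : Set (EW W)) ∧ (∀ a ∈ U', ∀ b ∈ U', ∀ n : ℤ, YE a b n ∈ U') ∧
      oneE ∈ U' ∧ S ⊆ (U' : Set (EW W))) → U ≤ U'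

/-! ### 𝒮-locality for maps and weak quantum vertex algebras -/

/-- The `𝒮`-locality identity
`(x₁-x₂)^k Y(u,x₁)Y(v,x₂) = ∑ᵢ (x₁-x₂)^k ι_{x₂,x₁}(fᵢ(x₂-x₁)) Y(vᵢ,x₂)Y(uᵢ,x₁)`
at the level of coefficient families, for mode maps `Ym`. -/
def sLocPair {V : Type*} (Ym : V → W → ℤ → W) (k : ℕ) (u v : V) {r : ℕ}
    (f : Fin r → LC) (vi ui : Fin r → V) : Prop :=
  ∀ (w : W) (m t : ℤ),
    mulPoly ((MvPolynomial.X 0 - MvPolynomial.X 1) ^ k)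
      (fun m' t' => Ym u (Ym v w (-t' - 1)) (-m' - 1)) m t =
    ∑ i, mulPoly ((MvPolynomial.X 0 - MvPolynomial.X 1) ^ k)
      (smulFam (expandSub (f i))
        (fun m' t' => Ym (vi i) (Ym (ui i) w (-m' - 1)) (-t' - 1))) m t

/-- A weak quantum vertex algebra: a nonlocal vertex algebra whose vertex operators
form an `𝒮`-local subspace of `ℰ(V)`. -/
def IsWeakQVA (A : NLVA V) : Prop :=
  ∀ u v : V, ∃ (k : ℕ) (r : ℕ) (f : Fin r → LC) (vi ui : Fin r → V),
    sLocPair (Yf A) k u v f vi ui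

end NVA

namespace NVA

/-! ### Row-finite operators and power series of operators on families -/

section RowFinite

variable {K K' K'' M M' M'' : Type*}
  [AddCommGroup M''] [Module ℂ M''] [AddCommGroup M'] [Module ℂ M'] [AddCommGroup M] [Module ℂ M]

/-- A linear map between spaces of families each of whose output coordinates depends on finitely
many input coordinates. -/
def RowFinite (T : (K → M) →ₗ[ℂ] (K' → M')) : Prop :=
  ∀ k', ∃ s : Finset K, ∀ F : K → M, (∀ x ∈ s, F x = 0) → T F k' = 0

lemma RowFinite.add {T S : (K → M) →ₗ[ℂ] (K' → M')} (hT : RowFinite T) (hS : RowFinite S) :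
    RowFinite (T + S) := by
  intro k'
  obtain ⟨s, hs⟩ := hT k'
  obtain ⟨t, ht⟩ := hS k'
  refine ⟨s ∪ t, fun F hF => ?_⟩
  simp [hs F fun x hx => hF x (Finset.mem_union_left _ hx),
    ht F fun x hx => hF x (Finset.mem_union_right _ hx)]

lemma RowFinite.neg {T : (K → M) →ₗ[ℂ] (K' → M')} (hT : RowFinite T) : RowFinite (-T) := by
  intro k'
  obtain ⟨s, hs⟩ := hT k'
  exact ⟨s, fun F hF => by simp [hs F hF]⟩

lemma RowFinite.sub {T S : (K → M) →ₗ[ℂ] (K' → M')} (hT : RowFinite T) (hS : RowFinite S) :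
    RowFinite (T - S) := by
  rw [sub_eq_add_neg]; exact hT.add hS.neg

lemma RowFinite.comp {T : (K → M) →ₗ[ℂ] (K' → M')} {S : (K' → M') →ₗ[ℂ] (K'' → M'')}
    (hS : RowFinite S) (hT : RowFinite T) : RowFinite (S ∘ₗ T) := by
  intro k
  obtain ⟨s, hs⟩ := hS k
  choose t ht using hT
  refine ⟨s.biUnion t, fun F hF => hs _ fun x hx => ht _ _ fun y hy => hF y ?_⟩
  exact Finset.mem_biUnion.2 ⟨x, hx, hy⟩

lemma RowFinite.pow {T : Module.End ℂ (K → M)} (hT : RowFinite T) (n : ℕ) :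
    RowFinite (T ^ n : Module.End ℂ (K → M)) := by
  induction n with
  | zero => exact fun k => ⟨{k}, fun F hF => hF k (by simp)⟩
  | succ n ih => rw [pow_succ]; exact ih.comp hT

/-- Pull back along `φ` on indices and apply linear maps pointwise. -/
def famMap (φ : K' → K) (A : K' → M →ₗ[ℂ] M') : (K → M) →ₗ[ℂ] (K' → M') where
  toFun F k := A k (F (φ k))
  map_add' _ _ := by ext; simp
  map_smul' _ _ := by ext; simp

@[simp] lemma famMap_apply (φ : K' → K) (A : K' → M →ₗ[ℂ] M') (F : K → M) (k : K') :
    famMap φ A F k = A k (F (φ k)) := rfl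

lemma rowFinite_famMap (φ : K' → K) (A : K' → M →ₗ[ℂ] M') : RowFinite (famMap φ A) :=
  fun k => ⟨{φ k}, fun F hF => by simp [hF (φ k) (by simp)]⟩

/-- Pull back along a map of index sets. -/
abbrev pull (φ : K' → K) : (K → M) →ₗ[ℂ] (K' → M) := famMap φ fun _ => LinearMap.id

/-- A family on which the operator `D` is pointwise nilpotent. -/
def NullFam (D : Module.End ℂ (K → M)) (F : K → M) : Prop :=
  ∀ k, ∃ N : ℕ, ∀ n, N ≤ n → (D ^ n) F k = 0

/-- The action `g(D) F` of a power series in an operator on a family. -/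
def psAct (D : Module.End ℂ (K → M)) (g : PowerSeries ℂ) (F : K → M) : K → M :=
  fun k => ∑ᶠ n : ℕ, PowerSeries.coeff n g • (D ^ n) F k

lemma finsum_nat_eq_sum_range {A : Type*} [AddCommMonoid A] (f : ℕ → A) (N : ℕ)
    (h : ∀ n, N ≤ n → f n = 0) : ∑ᶠ n, f n = ∑ n ∈ Finset.range N, f n := by
  refine finsum_eq_finsetSum_of_support_subset _ fun n hn => ?_
  by_contra hc
  exact hn (h n (by simpa using hc))

lemma psAct_eq_sum {D : Module.End ℂ (K → M)} (g : PowerSeries ℂ) {F : K → M} {k : K} {N : ℕ}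
    (h : ∀ n, N ≤ n → (D ^ n) F k = 0) :
    psAct D g F k = ∑ n ∈ Finset.range N, PowerSeries.coeff n g • (D ^ n) F k :=
  finsum_nat_eq_sum_range _ N fun n hn => by rw [h n hn, smul_zero]

lemma psAct_eq_zero {D : Module.End ℂ (K → M)} (g : PowerSeries ℂ) {F : K → M} {k : K}
    (h : ∀ n, (D ^ n) F k = 0) : psAct D g F k = 0 := by
  rw [psAct_eq_sum g (N := 0) fun n _ => h n]; simp

lemma exists_bound_finset {s : Finset K} {P : K → ℕ → Prop}
    (h : ∀ k, ∃ N : ℕ, ∀ n, N ≤ n → P k n) : ∃ N : ℕ, ∀ n, N ≤ n → ∀ k ∈ s, P k n := by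
  choose N hN using h
  exact ⟨s.sup N, fun n hn k hk => hN k n ((Finset.le_sup hk).trans hn)⟩

lemma NullFam.rowFinite {D : Module.End ℂ (K → M)} {F : K → M} (hF : NullFam D F)
    {T : (K → M) →ₗ[ℂ] (K' → M')} (hT : RowFinite T) (k' : K') :
    ∃ N : ℕ, ∀ n, N ≤ n → T ((D ^ n) F) k' = 0 := by
  obtain ⟨s, hs⟩ := hT k'
  obtain ⟨N, hN⟩ := exists_bound_finset (s := s) hF
  exact ⟨N, fun n hn => hs _ (hN n hn)⟩

lemma psAct_rowFinite_sum {D : Module.End ℂ (K → M)} {F : K → M} (hF : NullFam D F)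
    {T : (K → M) →ₗ[ℂ] (K' → M')} (hT : RowFinite T) (g : PowerSeries ℂ) (k' : K') :
    T (psAct D g F) k' = ∑ᶠ n : ℕ, PowerSeries.coeff n g • T ((D ^ n) F) k' := by
  obtain ⟨s, hs⟩ := hT k'
  obtain ⟨N, hN⟩ := exists_bound_finset (s := s) hF
  rw [finsum_nat_eq_sum_range _ N fun n hn => by rw [hs _ (hN n hn), smul_zero]]
  have h := hs (psAct D g F - ∑ n ∈ Finset.range N, PowerSeries.coeff n g • (D ^ n) F)
    fun x hx => by
      rw [Pi.sub_apply, psAct_eq_sum g fun n hn => hN n hn x hx]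
      simp [Finset.sum_apply]
  rw [map_sub, Pi.sub_apply, sub_eq_zero] at h
  simp [h, Finset.sum_apply]

lemma pow_intertwine {D : Module.End ℂ (K → M)} {D' : Module.End ℂ (K' → M')}
    {T : (K → M) →ₗ[ℂ] (K' → M')} (hc : ∀ F, T (D F) = D' (T F)) (n : ℕ) (F : K → M) :
    T ((D ^ n) F) = (D' ^ n) (T F) := by
  induction n generalizing F with
  | zero => simp
  | succ n ih => simp [pow_succ, ih, hc]

lemma NullFam.map {D : Module.End ℂ (K → M)} {D' : Module.End ℂ (K' → M')} {F : K → M}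
    (hF : NullFam D F) {T : (K → M) →ₗ[ℂ] (K' → M')} (hT : RowFinite T)
    (hc : ∀ F, T (D F) = D' (T F)) : NullFam D' (T F) := by
  intro k'
  obtain ⟨N, hN⟩ := hF.rowFinite hT k'
  exact ⟨N, fun n hn => by rw [← pow_intertwine hc, hN n hn]⟩

lemma psAct_map {D : Module.End ℂ (K → M)} {D' : Module.End ℂ (K' → M')} {F : K → M}
    (hF : NullFam D F) {T : (K → M) →ₗ[ℂ] (K' → M')} (hT : RowFinite T)
    (hc : ∀ F, T (D F) = D' (T F)) (g : PowerSeries ℂ) :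
    T (psAct D g F) = psAct D' g (T F) := by
  ext k'
  rw [psAct_rowFinite_sum hF hT]
  simp only [psAct, pow_intertwine hc]

lemma NullFam.add {D : Module.End ℂ (K → M)} {F G : K → M} (hF : NullFam D F)
    (hG : NullFam D G) : NullFam D (F + G) := by
  intro k
  obtain ⟨N, hN⟩ := hF k
  obtain ⟨N', hN'⟩ := hG k
  refine ⟨max N N', fun n hn => ?_⟩
  simp [hN n (le_trans (le_max_left _ _) hn), hN' n (le_trans (le_max_right _ _) hn)]

lemma NullFam.smul {D : Module.End ℂ (K → M)} {F : K → M} (hF : NullFam D F) (c : ℂ) :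
    NullFam D (c • F) := by
  intro k
  obtain ⟨N, hN⟩ := hF k
  exact ⟨N, fun n hn => by simp [hN n hn]⟩

lemma nullFam_zero {D : Module.End ℂ (K → M)} : NullFam D (0 : K → M) :=
  fun k => ⟨0, fun n _ => by simp⟩

lemma psAct_add {D : Module.End ℂ (K → M)} {F G : K → M} (hF : NullFam D F)
    (hG : NullFam D G) (g : PowerSeries ℂ) : psAct D g (F + G) = psAct D g F + psAct D g G := by
  ext k
  obtain ⟨N, hN⟩ := hF k
  obtain ⟨N', hN'⟩ := hG k
  have h1 : ∀ n, max N N' ≤ n → (D ^ n) F k = 0 := fun n hn => hN n (le_trans (le_max_left _ _) hn)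
  have h2 : ∀ n, max N N' ≤ n → (D ^ n) G k = 0 :=
    fun n hn => hN' n (le_trans (le_max_right _ _) hn)
  rw [Pi.add_apply, psAct_eq_sum g h1, psAct_eq_sum g h2,
    psAct_eq_sum g (N := max N N') fun n hn => by simp [h1 n hn, h2 n hn], ← Finset.sum_add_distrib]
  simp

lemma psAct_smul {D : Module.End ℂ (K → M)} {F : K → M} (hF : NullFam D F) (c : ℂ)
    (g : PowerSeries ℂ) : psAct D g (c • F) = c • psAct D g F := by
  ext k
  obtain ⟨N, hN⟩ := hF k
  rw [Pi.smul_apply, psAct_eq_sum g hN, psAct_eq_sum g (N := N) fun n hn => by simp [hN n hn],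
    Finset.smul_sum]
  simp [smul_comm c]

lemma psAct_zero (D : Module.End ℂ (K → M)) (g : PowerSeries ℂ) : psAct D g 0 = 0 := by
  ext k; exact psAct_eq_zero g fun n => by simp

lemma psAct_neg (D : Module.End ℂ (K → M)) (g : PowerSeries ℂ) (F : K → M) :
    psAct (-D) g F = psAct D (PowerSeries.rescale (-1) g) F := by
  ext k
  refine finsum_congr fun n => ?_
  rw [PowerSeries.coeff_rescale, ← neg_one_smul ℂ D, smul_pow, LinearMap.smul_apply, Pi.smul_apply,
    smul_smul, mul_comm]

lemma psAct_smul_left {D : Module.End ℂ (K → M)} {F : K → M} (hF : NullFam D F) (c : ℂ)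
    (g : PowerSeries ℂ) : psAct D (c • g) F = c • psAct D g F := by
  ext k
  obtain ⟨N, hN⟩ := hF k
  rw [Pi.smul_apply, psAct_eq_sum g hN, psAct_eq_sum _ hN, Finset.smul_sum]
  simp [mul_smul]

lemma NullFam.psAct {D : Module.End ℂ (K → M)} (hD : RowFinite D) {F : K → M}
    (hF : NullFam D F) (g : PowerSeries ℂ) : NullFam D (psAct D g F) := by
  intro k
  obtain ⟨N, hN⟩ := hF k
  refine ⟨N, fun n hn => ?_⟩
  rw [psAct_map hF (hD.pow n) (D' := D)]
  · refine psAct_eq_zero g fun m => ?_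
    rw [← Module.End.mul_apply, ← pow_add]
    exact hN _ (by omega)
  · intro F
    rw [← Module.End.mul_apply, ← Module.End.mul_apply, pow_mul_comm']

lemma psAct_mul {D : Module.End ℂ (K → M)} (hD : RowFinite D) {F : K → M}
    (hF : NullFam D F) (g h : PowerSeries ℂ) :
    psAct D (g * h) F = psAct D g (psAct D h F) := by
  ext k
  obtain ⟨N, hN⟩ := hF k
  have key : ∀ n, (D ^ n) (psAct D h F) k =
      ∑ m ∈ Finset.range N, PowerSeries.coeff m h • (D ^ (n + m)) F k := by
    intro n
    rw [psAct_map hF (hD.pow n) (D' := D)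
      (fun F => by rw [← Module.End.mul_apply, ← Module.End.mul_apply, pow_mul_comm'])]
    rw [psAct_eq_sum h (N := N)]
    · refine Finset.sum_congr rfl fun m _ => ?_
      rw [← Module.End.mul_apply, ← pow_add, add_comm]
    · intro m hm
      rw [← Module.End.mul_apply, ← pow_add]
      exact hN _ (by omega)
  rw [psAct_eq_sum _ hN, psAct_eq_sum (F := psAct D h F) g (N := N)]
  · simp only [key, PowerSeries.coeff_mul, Finset.sum_smul, Finset.smul_sum, smul_smul]
    rw [Finset.sum_sigma', ← Finset.sum_product']
    refine Finset.sum_bij_ne_zero (fun x _ _ => x.2) ?_ ?_ ?_ ?_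
    · rintro ⟨n, a, b⟩ hx -
      simp only [Finset.mem_sigma, Finset.mem_range] at hx
      have := Finset.HasAntidiagonal.mem_antidiagonal.1 hx.2
      simp only [Finset.mem_product, Finset.mem_range]; omega
    · rintro ⟨n, a, b⟩ hx - ⟨n', a', b'⟩ hx' - h
      simp only [Finset.mem_sigma, Finset.mem_range] at hx hx'
      simp only [Prod.mk.injEq] at h
      obtain ⟨rfl, rfl⟩ := h
      obtain rfl : n = n' := by
        rw [← Finset.HasAntidiagonal.mem_antidiagonal.1 hx.2,
          ← Finset.HasAntidiagonal.mem_antidiagonal.1 hx'.2]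
      rfl
    · rintro ⟨a, b⟩ hx hne
      refine ⟨⟨a + b, a, b⟩, ?_, ?_, rfl⟩
      · refine Finset.mem_sigma.2 ⟨Finset.mem_range.2 ?_,
        Finset.HasAntidiagonal.mem_antidiagonal.2 rfl⟩
        by_contra hc
        exact hne (by simp [hN (a + b) (by simpa using hc)])
      · exact hne
    · rintro ⟨n, a, b⟩ hx -
      rw [Finset.HasAntidiagonal.mem_antidiagonal.1 (Finset.mem_sigma.1 hx).2]
  · intro n hn
    rw [key]
    exact Finset.sum_eq_zero fun m _ => by rw [hN _ (by omega), smul_zero]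

lemma psAct_X_pow (D : Module.End ℂ (K → M)) (L : ℕ) (F : K → M) :
    psAct D (PowerSeries.X ^ L) F = (D ^ L) F := by
  ext k
  rw [psAct, finsum_eq_single _ L]
  · simp
  · intro n hn; simp [PowerSeries.coeff_X_pow, hn]

lemma psAct_one (D : Module.End ℂ (K → M)) (F : K → M) : psAct D 1 F = F := by
  simpa using psAct_X_pow D 0 F

/-- The span of all `g(D) F` with `F ∈ X` and `g` a power series. -/
def PS (D : Module.End ℂ (K → M)) (X : Set (K → M)) : Submodule ℂ (K → M) :=
  Submodule.span ℂ {F | ∃ g, ∃ G ∈ X, F = psAct D g G}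

lemma psAct_mem_PS {D : Module.End ℂ (K → M)} {X : Set (K → M)} (g : PowerSeries ℂ) {G : K → M}
    (hG : G ∈ X) : psAct D g G ∈ PS D X :=
  Submodule.subset_span ⟨g, G, hG, rfl⟩

lemma mem_PS {D : Module.End ℂ (K → M)} {X : Set (K → M)} {G : K → M}
    (hG : G ∈ X) : G ∈ PS D X := by
  simpa [psAct_one] using psAct_mem_PS (D := D) 1 hG

lemma PS_mono (D : Module.End ℂ (K → M)) {X Y : Set (K → M)} (h : X ⊆ Y) : PS D X ≤ PS D Y :=
  Submodule.span_mono fun _ ⟨g, G, hG, e⟩ => ⟨g, G, h hG, e⟩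

lemma PS_neg (D : Module.End ℂ (K → M)) (X : Set (K → M)) : PS (-D) X = PS D X := by
  apply le_antisymm <;> refine Submodule.span_le.2 ?_ <;> rintro _ ⟨g, G, hG, rfl⟩
  · rw [psAct_neg]; exact psAct_mem_PS _ hG
  · rw [show psAct D g G = psAct (- -D) g G by rw [neg_neg], psAct_neg]; exact psAct_mem_PS _ hG

lemma PS_induction {D : Module.End ℂ (K → M)} {X : Set (K → M)} {p : (K → M) → Prop}
    (h0 : p 0) (hadd : ∀ F G, p F → p G → p (F + G)) (hsmul : ∀ (c : ℂ) F, p F → p (c • F))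
    (hmem : ∀ g, ∀ G ∈ X, p (psAct D g G)) {F : K → M} (hF : F ∈ PS D X) : p F := by
  refine Submodule.span_induction ?_ h0 (fun F G _ _ => hadd F G) (fun c F _ => hsmul c F) hF
  rintro _ ⟨g, G, hG, rfl⟩
  exact hmem g G hG

lemma PS_map {D : Module.End ℂ (K → M)} {D' : Module.End ℂ (K' → M')} {X : Set (K → M)}
    {Y : Set (K' → M')} (hX : ∀ F ∈ X, NullFam D F)
    {T : (K → M) →ₗ[ℂ] (K' → M')} (hT : RowFinite T) (hc : ∀ F, T (D F) = D' (T F))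
    (hXY : ∀ F ∈ X, T F ∈ PS D' Y) (hY : ∀ F ∈ Y, NullFam D' F) (hD' : RowFinite D')
    {F : K → M} (hF : F ∈ PS D X) : T F ∈ PS D' Y := by
  have hps : ∀ g, ∀ F ∈ PS D' Y, NullFam D' F ∧ psAct D' g F ∈ PS D' Y := by
    intro g F hF
    refine PS_induction (p := fun F => NullFam D' F ∧ psAct D' g F ∈ PS D' Y) ?_ ?_ ?_ ?_ hF
    · exact ⟨nullFam_zero, by rw [psAct_zero]; exact zero_mem _⟩
    · rintro F G ⟨h1, h2⟩ ⟨h3, h4⟩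
      exact ⟨h1.add h3, by rw [psAct_add h1 h3]; exact add_mem h2 h4⟩
    · rintro c F ⟨h1, h2⟩
      exact ⟨h1.smul c, by rw [psAct_smul h1]; exact Submodule.smul_mem _ _ h2⟩
    · intro h G hG
      refine ⟨(hY G hG).psAct hD' h, ?_⟩
      rw [← psAct_mul hD' (hY G hG)]; exact psAct_mem_PS _ hG
  refine PS_induction (p := fun F => T F ∈ PS D' Y) (by simp) (fun F G h1 h2 => ?_)
    (fun c F h1 => ?_) (fun g G hG => ?_) hF
  · rw [map_add]; exact add_mem h1 h2
  · rw [map_smul]; exact Submodule.smul_mem _ _ h1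
  · rw [psAct_map (hX G hG) hT hc]
    exact (hps g _ (hXY G hG)).2

lemma PS_pow_mem {D : Module.End ℂ (K → M)} {X : Set (K → M)} (hX : ∀ F ∈ X, NullFam D F)
    (hD : RowFinite D) (n : ℕ) {F : K → M} (hF : F ∈ PS D X) : (D ^ n) F ∈ PS D X :=
  PS_map hX (hD.pow n) (fun F => by
    rw [← Module.End.mul_apply, ← Module.End.mul_apply, pow_mul_comm'])
    (fun F hF => by rw [← psAct_X_pow]; exact psAct_mem_PS _ hF) hX hD hF

end RowFinite

end NVA

namespace NVA

/-! ### Binomial coefficients with integer lower index -/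

/-- The binomial coefficient `C(m, e)`, zero for negative `e`. -/
def bz (m e : ℤ) : ℂ := if 0 ≤ e then binom m e.toNat else 0

lemma bz_of_neg (m : ℤ) {e : ℤ} (he : e < 0) : bz m e = 0 := if_neg (by omega)

lemma bz_natCast (m : ℤ) (j : ℕ) : bz m j = binom m j := by simp [bz]

lemma binom_zero_right (m : ℤ) : binom m 0 = 1 := by simp [binom]

lemma bz_zero_right (m : ℤ) : bz m 0 = 1 := by simp [bz, binom_zero_right]

lemma binom_succ_right (m : ℤ) (j : ℕ) : binom m (j + 1) * (j + 1) = binom m j * (m - j) := by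
  have h1 : ((j : ℂ) + 1) ≠ 0 := by exact_mod_cast Nat.succ_ne_zero j
  have h2 : (j.factorial : ℂ) ≠ 0 := by exact_mod_cast j.factorial_ne_zero
  simp only [binom, Finset.prod_range_succ, Nat.factorial_succ, Nat.cast_mul, Nat.cast_succ]
  field_simp

lemma binom_succ_succ_mul (m : ℤ) (j : ℕ) :
    binom (m + 1) (j + 1) * (j + 1) = binom m j * (m + 1) := by
  have h1 : ((j : ℂ) + 1) ≠ 0 := by exact_mod_cast Nat.succ_ne_zero j
  have h2 : (j.factorial : ℂ) ≠ 0 := by exact_mod_cast j.factorial_ne_zero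
  simp only [binom, Finset.prod_range_succ', Nat.factorial_succ, Nat.cast_mul, Nat.cast_succ]
  have : ∀ i : ℕ, (((m + 1 : ℤ) : ℂ) - ((i : ℂ) + 1)) = m - i := fun i => by push_cast; ring
  simp only [this]
  push_cast
  field_simp
  ring

lemma binom_succ_succ (m : ℤ) (j : ℕ) :
    binom (m + 1) (j + 1) = binom m (j + 1) + binom m j := by
  have h1 : ((j : ℂ) + 1) ≠ 0 := by exact_mod_cast Nat.succ_ne_zero j
  refine mul_right_cancel₀ h1 ?_
  rw [binom_succ_succ_mul, add_mul, binom_succ_right]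
  ring

lemma bz_succ (m e : ℤ) : bz (m + 1) e = bz m e + bz m (e - 1) := by
  rcases lt_trichotomy e 0 with h | rfl | h
  · rw [bz_of_neg _ h, bz_of_neg _ h, bz_of_neg _ (by omega), add_zero]
  · rw [bz_zero_right, bz_zero_right, bz_of_neg _ (by omega), add_zero]
  · obtain ⟨j, rfl⟩ : ∃ j : ℕ, e = j + 1 := ⟨(e - 1).toNat, by omega⟩
    have := binom_succ_succ m j
    rw [← bz_natCast, ← bz_natCast, ← bz_natCast] at this
    simpa using this

lemma bz_zero_left (e : ℤ) : bz 0 e = if e = 0 then 1 else 0 := by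
  rcases lt_trichotomy e 0 with h | rfl | h
  · rw [bz_of_neg _ h, if_neg (by omega)]
  · simp [bz_zero_right]
  · obtain ⟨j, rfl⟩ : ∃ j : ℕ, e = (j + 1 : ℕ) := ⟨(e - 1).toNat, by omega⟩
    rw [bz_natCast, if_neg (by omega)]
    simp [binom, Finset.prod_range_succ']

/-! ### Two-variable families and the substitution `x₁ = x₂ + x₀` -/

section Tau

variable {J J' M M' : Type*} [AddCommGroup M'] [Module ℂ M'] [AddCommGroup M] [Module ℂ M]

/-- Multiplication by the first variable. -/
def shP : Module.End ℂ (J × ℤ × ℤ → M) := pull fun k => (k.1, k.2.1 - 1, k.2.2)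

/-- Multiplication by the second variable. -/
def shQ : Module.End ℂ (J × ℤ × ℤ → M) := pull fun k => (k.1, k.2.1, k.2.2 - 1)

/-- Multiplication by the variable of a one-variable family. -/
def sh1 : Module.End ℂ (J × ℤ → M) := pull fun k => (k.1, k.2 - 1)

/-- Multiplication by the difference of the two variables. -/
def dd : Module.End ℂ (J × ℤ × ℤ → M) := shP - shQ

@[simp] lemma shP_apply (F : J × ℤ × ℤ → M) (k : J × ℤ × ℤ) :
    shP F k = F (k.1, k.2.1 - 1, k.2.2) := rfl

@[simp] lemma shQ_apply (F : J × ℤ × ℤ → M) (k : J × ℤ × ℤ) :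
    shQ F k = F (k.1, k.2.1, k.2.2 - 1) := rfl

@[simp] lemma sh1_apply (F : J × ℤ → M) (k : J × ℤ) : sh1 F k = F (k.1, k.2 - 1) := rfl

@[simp] lemma dd_apply (F : J × ℤ × ℤ → M) (k : J × ℤ × ℤ) :
    dd F k = F (k.1, k.2.1 - 1, k.2.2) - F (k.1, k.2.1, k.2.2 - 1) := rfl

lemma rowFinite_shP : RowFinite (shP : Module.End ℂ (J × ℤ × ℤ → M)) := rowFinite_famMap _ _

lemma rowFinite_shQ : RowFinite (shQ : Module.End ℂ (J × ℤ × ℤ → M)) := rowFinite_famMap _ _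

lemma rowFinite_sh1 : RowFinite (sh1 : Module.End ℂ (J × ℤ → M)) := rowFinite_famMap _ _

lemma rowFinite_dd : RowFinite (dd : Module.End ℂ (J × ℤ × ℤ → M)) :=
  rowFinite_shP.sub rowFinite_shQ

lemma dd_shQ (F : J × ℤ × ℤ → M) : dd (shQ F) = shQ (dd F) := rfl

lemma dd_shP (F : J × ℤ × ℤ → M) : dd (shP F) = shP (dd F) := rfl

/-- Families vanishing when one of the exponents is below the bound `N`. -/
def bdd (N : J → ℤ) : Submodule ℂ (J × ℤ × ℤ → M) where
  carrier := {F | ∀ j m t, m < N j ∨ t < N j → F (j, m, t) = 0}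
  add_mem' hF hG j m t h := by simp [hF j m t h, hG j m t h]
  zero_mem' _ _ _ _ := rfl
  smul_mem' c F hF j m t h := by simp [hF j m t h]

lemma bdd_anti {N N' : J → ℤ} (h : N' ≤ N) {F : J × ℤ × ℤ → M} (hF : F ∈ bdd N) :
    F ∈ bdd N' :=
  fun j m t hj => hF j m t (hj.imp (fun h1 => h1.trans_le (h j)) fun h1 => h1.trans_le (h j))

lemma shP_mem_bdd {N : J → ℤ} {F : J × ℤ × ℤ → M} (hF : F ∈ bdd N) : shP F ∈ bdd N :=
  fun j m t h => hF j (m - 1) t (h.imp (fun h => by omega) id)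

lemma shQ_mem_bdd {N : J → ℤ} {F : J × ℤ × ℤ → M} (hF : F ∈ bdd N) : shQ F ∈ bdd N :=
  fun j m t h => hF j m (t - 1) (h.imp id fun h => by omega)

lemma dd_mem_bdd {N : J → ℤ} {F : J × ℤ × ℤ → M} (hF : F ∈ bdd N) : dd F ∈ bdd N :=
  sub_mem (shP_mem_bdd hF) (shQ_mem_bdd hF)

lemma dd_pow_mem_bdd {N : J → ℤ} {F : J × ℤ × ℤ → M} (hF : F ∈ bdd N) (n : ℕ) :
    (dd ^ n) F ∈ bdd N := by
  induction n with
  | zero => simpa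
  | succ n ih => rw [pow_succ']; exact dd_mem_bdd ih

/-- The coefficient of `x₀^e` in `F(x₂ + x₀, x₂)`, in nonnegative powers of `x₀`. -/
def tau (e : ℤ) (F : J × ℤ × ℤ → M) : J × ℤ → M :=
  fun k => ∑ᶠ m : ℤ, bz m e • F (k.1, m, k.2 - m + e)

/-- The box-truncated version of `tau`, linear in the family. -/
def tauN (N : J → ℤ) (e : ℤ) : (J × ℤ × ℤ → M) →ₗ[ℂ] (J × ℤ → M) where
  toFun F k := ∑ m ∈ Finset.Icc (N k.1) (k.2 + e - N k.1), bz m e • F (k.1, m, k.2 - m + e)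
  map_add' F G := by ext; simp [Finset.sum_add_distrib]
  map_smul' c F := by ext; simp [Finset.smul_sum, smul_comm c]

lemma tauN_apply (N : J → ℤ) (e : ℤ) (F : J × ℤ × ℤ → M) (k : J × ℤ) :
    tauN N e F k = ∑ m ∈ Finset.Icc (N k.1) (k.2 + e - N k.1), bz m e • F (k.1, m, k.2 - m + e) :=
  rfl

lemma rowFinite_tauN (N : J → ℤ) (e : ℤ) :
    RowFinite (tauN N e : (J × ℤ × ℤ → M) →ₗ[ℂ] (J × ℤ → M)) := fun k =>
  ⟨(Finset.Icc (N k.1) (k.2 + e - N k.1)).image fun m => (k.1, m, k.2 - m + e), fun F hF => by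
    rw [tauN_apply]
    exact Finset.sum_eq_zero fun m hm => by rw [hF _ (Finset.mem_image_of_mem _ hm), smul_zero]⟩

lemma bdd_line_support {N : J → ℤ} {F : J × ℤ × ℤ → M} (hF : F ∈ bdd N) (c : ℤ → ℂ) (j : J)
    (s : ℤ) : (Function.support fun m => c m • F (j, m, s - m)) ⊆ Finset.Icc (N j) (s - N j) := by
  intro m hm
  by_contra hc
  refine hm ?_
  simp only [Finset.coe_Icc, Set.mem_Icc, not_and_or, not_le] at hc
  simp only [hF j m (s - m) (hc.imp id fun h => by omega), smul_zero]

lemma bdd_line_finite {N : J → ℤ} {F : J × ℤ × ℤ → M} (hF : F ∈ bdd N) (c : ℤ → ℂ) (j : J)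
    (s : ℤ) : (Function.support fun m => c m • F (j, m, s - m)).Finite :=
  (Finset.finite_toSet _).subset (bdd_line_support hF c j s)

lemma tau_eq_line (e : ℤ) (F : J × ℤ × ℤ → M) (k : J × ℤ) :
    tau e F k = ∑ᶠ m : ℤ, bz m e • F (k.1, m, k.2 + e - m) :=
  finsum_congr fun m => by rw [show k.2 - m + e = k.2 + e - m by ring]

lemma tau_eq_tauN {N : J → ℤ} {F : J × ℤ × ℤ → M} (hF : F ∈ bdd N) (e : ℤ) :
    tau e F = tauN N e F := by
  ext k
  rw [tau_eq_line, finsum_eq_finsetSum_of_support_subset _ (bdd_line_support hF _ _ _)]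
  refine Finset.sum_congr rfl fun m _ => ?_
  rw [show k.2 - m + e = k.2 + e - m by ring]

lemma tau_dd {N : J → ℤ} {F : J × ℤ × ℤ → M} (hF : F ∈ bdd N) (e : ℤ) :
    tau e (dd F) = tau (e - 1) F := by
  ext k
  have h1 : tau e (shP F) k = ∑ᶠ m : ℤ, bz (m + 1) e • F (k.1, m, k.2 + (e - 1) - m) := by
    rw [tau_eq_line, ← finsum_comp_equiv (Equiv.addRight (1 : ℤ))]
    refine finsum_congr fun m => ?_
    simp only [Equiv.coe_addRight, shP_apply]
    rw [add_sub_cancel_right, show k.2 + e - (m + 1) = k.2 + (e - 1) - m by ring]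
  have h2 : tau e (shQ F) k = ∑ᶠ m : ℤ, bz m e • F (k.1, m, k.2 + (e - 1) - m) := by
    rw [tau_eq_line]
    refine finsum_congr fun m => ?_
    simp only [shQ_apply]
    rw [show k.2 + e - m - 1 = k.2 + (e - 1) - m by ring]
  have h3 : tau e (dd F) k = tau e (shP F) k - tau e (shQ F) k := by
    rw [tau_eq_tauN (dd_mem_bdd hF), tau_eq_tauN (shP_mem_bdd hF), tau_eq_tauN (shQ_mem_bdd hF),
      dd, LinearMap.sub_apply, map_sub, Pi.sub_apply]
  rw [h3, h1, h2, tau_eq_line, ← finsum_sub_distrib (bdd_line_finite hF _ _ _)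
    (bdd_line_finite hF _ _ _)]
  refine finsum_congr fun m => ?_
  rw [← sub_smul, bz_succ, add_sub_cancel_left]

lemma tau_shQ (e : ℤ) (F : J × ℤ × ℤ → M) : tau e (shQ F) = sh1 (tau e F) := by
  ext k
  refine finsum_congr fun m => ?_
  simp only [shQ_apply]
  rw [show k.2 - m + e - 1 = k.2 - 1 - m + e by ring]

lemma tau_of_neg (F : J × ℤ × ℤ → M) {e : ℤ} (he : e < 0) : tau e F = 0 := by
  ext k
  simp [tau, bz_of_neg _ he]

lemma tau_dd_pow {N : J → ℤ} {F : J × ℤ × ℤ → M} (hF : F ∈ bdd N) (e : ℤ) (n : ℕ) :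
    tau (n + e) ((dd ^ n) F) = tau e F := by
  induction n with
  | zero => simp
  | succ n ih =>
    rw [pow_succ', Module.End.mul_apply, tau_dd (dd_pow_mem_bdd hF n), ← ih]
    congr 1
    push_cast; ring

lemma dd_pow_mem_of_le {N : J → ℤ} {F : J × ℤ × ℤ → M} {K K' : ℕ} (h : (dd ^ K) F ∈ bdd N)
    (hK : K ≤ K') : (dd ^ K') F ∈ bdd N := by
  obtain ⟨n, rfl⟩ := Nat.exists_eq_add_of_le' hK
  rw [pow_add]
  exact dd_pow_mem_bdd h n

lemma tau_indep {N N' : J → ℤ} {F : J × ℤ × ℤ → M} {K K' : ℕ} (h : (dd ^ K) F ∈ bdd N)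
    (h' : (dd ^ K') F ∈ bdd N') (e : ℤ) :
    tau (K + e) ((dd ^ K) F) = tau (K' + e) ((dd ^ K') F) := by
  wlog hK : K ≤ K' generalizing K K' N N'
  · exact (this h' h (by omega)).symm
  obtain ⟨n, rfl⟩ := Nat.exists_eq_add_of_le' hK
  rw [pow_add, Module.End.mul_apply, ← tau_dd_pow h (K + e) n]
  congr 1
  push_cast; ring

/-- Families that become jointly truncated after multiplication by a power of the difference of
the variables. -/
def dom : Submodule ℂ (J × ℤ × ℤ → M) where
  carrier := {F | ∃ (K : ℕ) (N : J → ℤ), (dd ^ K) F ∈ bdd N}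
  add_mem' := by
    rintro F G ⟨K, N, h⟩ ⟨K', N', h'⟩
    refine ⟨max K K', N ⊓ N', ?_⟩
    rw [map_add]
    exact add_mem (bdd_anti inf_le_left (dd_pow_mem_of_le h (le_max_left _ _)))
      (bdd_anti inf_le_right (dd_pow_mem_of_le h' (le_max_right _ _)))
  zero_mem' := ⟨0, 0, by simp⟩
  smul_mem' := by
    rintro c F ⟨K, N, h⟩
    exact ⟨K, N, by rw [map_smul]; exact Submodule.smul_mem _ _ h⟩

lemma tau_add_of_mem {N N' : J → ℤ} {F G : J × ℤ × ℤ → M} (hF : F ∈ bdd N) (hG : G ∈ bdd N')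
    (e : ℤ) : tau e (F + G) = tau e F + tau e G := by
  have h1 := bdd_anti (inf_le_left : N ⊓ N' ≤ N) hF
  have h2 := bdd_anti (inf_le_right : N ⊓ N' ≤ N') hG
  rw [tau_eq_tauN h1, tau_eq_tauN h2, tau_eq_tauN (add_mem h1 h2), map_add]

lemma tau_smul_of_mem {N : J → ℤ} {F : J × ℤ × ℤ → M} (hF : F ∈ bdd N)
    (c : ℂ) (e : ℤ) : tau e (c • F) = c • tau e F := by
  rw [tau_eq_tauN hF, tau_eq_tauN (Submodule.smul_mem _ c hF), map_smul]

lemma exists_rho (e : ℤ) : ∃ f : (J × ℤ × ℤ → M) →ₗ[ℂ] (J × ℤ → M),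
    ∀ (F : J × ℤ × ℤ → M) (K : ℕ) (N : J → ℤ), (dd ^ K) F ∈ bdd N →
      f F = tau (K + e) ((dd ^ K) F) := by
  let g : dom (J := J) (M := M) →ₗ[ℂ] (J × ℤ → M) :=
    { toFun := fun F => tau (F.2.choose + e) ((dd ^ F.2.choose) F.1)
      map_add' := by
        intro F G
        obtain ⟨NF, hF⟩ := F.2.choose_spec
        obtain ⟨NG, hG⟩ := G.2.choose_spec
        obtain ⟨NH, hH⟩ := (F + G).2.choose_spec
        have hF' := dd_pow_mem_of_le hF (le_max_left F.2.choose G.2.choose)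
        have hG' := dd_pow_mem_of_le hG (le_max_right F.2.choose G.2.choose)
        have hs := add_mem (bdd_anti (inf_le_left : NF ⊓ NG ≤ NF) hF')
          (bdd_anti (inf_le_right : NF ⊓ NG ≤ NG) hG')
        rw [← map_add] at hs
        rw [tau_indep hF hF', tau_indep hG hG', tau_indep hH hs, Submodule.coe_add, map_add,
          tau_add_of_mem hF' hG']
      map_smul' := by
        intro c F
        obtain ⟨NF, hF⟩ := F.2.choose_spec
        obtain ⟨NH, hH⟩ := (c • F).2.choose_spec
        have hs := Submodule.smul_mem _ c hF
        rw [← map_smul] at hs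
        rw [tau_indep hH hs, Submodule.coe_smul, map_smul, tau_smul_of_mem hF]
        rfl }
  obtain ⟨f, hf⟩ := LinearMap.exists_extend g
  refine ⟨f, fun F K N h => ?_⟩
  have hF : F ∈ dom := ⟨K, N, h⟩
  have := LinearMap.congr_fun hf ⟨F, hF⟩
  refine this.trans ?_
  obtain ⟨NF, hNF⟩ := hF.choose_spec
  exact tau_indep hNF h e

/-- The coefficient of `x₀^e` in `x₀^{-K} ((x₁ - x₂)^K F)|_{x₁ = x₂ + x₀}`. -/
def rho (e : ℤ) : (J × ℤ × ℤ → M) →ₗ[ℂ] (J × ℤ → M) := (exists_rho e).choose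

lemma rho_eq {F : J × ℤ × ℤ → M} {K : ℕ} {N : J → ℤ} (h : (dd ^ K) F ∈ bdd N) (e : ℤ) :
    rho e F = tau (K + e) ((dd ^ K) F) :=
  (exists_rho e).choose_spec F K N h

lemma rho_eq_tauN {F : J × ℤ × ℤ → M} {K : ℕ} {N : J → ℤ} (h : (dd ^ K) F ∈ bdd N) (e : ℤ) :
    rho e F = tauN N (K + e) ((dd ^ K) F) := by
  rw [rho_eq h, tau_eq_tauN h]

lemma dd_mem_dom {F : J × ℤ × ℤ → M} (hF : F ∈ dom) : dd F ∈ dom := by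
  obtain ⟨K, N, h⟩ := hF
  refine ⟨K, N, ?_⟩
  rw [← Module.End.mul_apply, ← pow_succ, pow_succ']
  exact dd_mem_bdd h

lemma dd_pow_mem_dom {F : J × ℤ × ℤ → M} (hF : F ∈ dom) (n : ℕ) : (dd ^ n) F ∈ dom := by
  induction n with
  | zero => simpa
  | succ n ih => rw [pow_succ']; exact dd_mem_dom ih

lemma mem_dom_of_dd_pow {F : J × ℤ × ℤ → M} {n : ℕ} (hF : (dd ^ n) F ∈ dom) : F ∈ dom := by
  obtain ⟨K, N, h⟩ := hF
  refine ⟨K + n, N, ?_⟩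
  rwa [pow_add]

lemma dd_pow_comm (T : Module.End ℂ (J × ℤ × ℤ → M)) (hT : ∀ F, dd (T F) = T (dd F)) (n : ℕ)
    (F : J × ℤ × ℤ → M) : (dd ^ n) (T F) = T ((dd ^ n) F) :=
  (pow_intertwine (T := T) (fun F => (hT F).symm) n F).symm

lemma shQ_mem_dom {F : J × ℤ × ℤ → M} (hF : F ∈ dom) : shQ F ∈ dom := by
  obtain ⟨K, N, h⟩ := hF
  refine ⟨K, N, ?_⟩
  rw [dd_pow_comm _ dd_shQ]
  exact shQ_mem_bdd h

lemma rho_dd {F : J × ℤ × ℤ → M} (hF : F ∈ dom) (e : ℤ) : rho e (dd F) = rho (e - 1) F := by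
  obtain ⟨K, N, h⟩ := hF
  have h1 : (dd ^ K) (dd F) ∈ bdd N := by
    rw [← Module.End.mul_apply, ← pow_succ, pow_succ']
    exact dd_mem_bdd h
  rw [rho_eq h, rho_eq h1, ← Module.End.mul_apply, ← pow_succ, pow_succ', Module.End.mul_apply,
    tau_dd h]
  congr 1; ring

lemma rho_dd_pow {F : J × ℤ × ℤ → M} (hF : F ∈ dom) (e : ℤ) (n : ℕ) :
    rho e ((dd ^ n) F) = rho (e - n) F := by
  induction n generalizing e with
  | zero => simp
  | succ n ih =>
    rw [pow_succ', Module.End.mul_apply, rho_dd (dd_pow_mem_dom hF n), ih]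
    congr 2; push_cast; ring

lemma rho_shQ {F : J × ℤ × ℤ → M} (hF : F ∈ dom) (e : ℤ) : rho e (shQ F) = sh1 (rho e F) := by
  obtain ⟨K, N, h⟩ := hF
  have h1 : (dd ^ K) (shQ F) ∈ bdd N := by
    rw [dd_pow_comm _ dd_shQ]; exact shQ_mem_bdd h
  rw [rho_eq h, rho_eq h1, dd_pow_comm _ dd_shQ, tau_shQ]

lemma rho_eq_zero_of_lt {F : J × ℤ × ℤ → M} {K : ℕ} {N : J → ℤ} (h : (dd ^ K) F ∈ bdd N) {e : ℤ}
    (he : K + e < 0) : rho e F = 0 := by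
  rw [rho_eq h, tau_of_neg _ he]

lemma rho_trunc {F : J × ℤ × ℤ → M} {K : ℕ} {N : J → ℤ} (h : (dd ^ K) F ∈ bdd N) {e q : ℤ} {j : J}
    (hq : q + K + e < 2 * N j) : rho e F (j, q) = 0 := by
  rw [rho_eq_tauN h, tauN_apply]
  refine Finset.sum_eq_zero fun m hm => ?_
  simp only [Finset.mem_Icc] at hm
  omega

/-- Reindexing the parameter of a two-variable family, with pointwise linear maps. -/
def lift2 (φ : J' → J) (A : J' → M →ₗ[ℂ] M') : (J × ℤ × ℤ → M) →ₗ[ℂ] (J' × ℤ × ℤ → M') :=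
  famMap (fun k => (φ k.1, k.2)) fun k => A k.1

/-- Reindexing the parameter of a one-variable family, with pointwise linear maps. -/
def lift1 (φ : J' → J) (A : J' → M →ₗ[ℂ] M') : (J × ℤ → M) →ₗ[ℂ] (J' × ℤ → M') :=
  famMap (fun k => (φ k.1, k.2)) fun k => A k.1

@[simp] lemma lift2_apply (φ : J' → J) (A : J' → M →ₗ[ℂ] M') (F : J × ℤ × ℤ → M)
    (k : J' × ℤ × ℤ) : lift2 φ A F k = A k.1 (F (φ k.1, k.2)) := rfl

@[simp] lemma lift1_apply (φ : J' → J) (A : J' → M →ₗ[ℂ] M') (F : J × ℤ → M)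
    (k : J' × ℤ) : lift1 φ A F k = A k.1 (F (φ k.1, k.2)) := rfl

lemma lift2_dd (φ : J' → J) (A : J' → M →ₗ[ℂ] M') (F : J × ℤ × ℤ → M) :
    lift2 φ A (dd F) = dd (lift2 φ A F) := by
  ext k; simp

lemma lift2_dd_pow (φ : J' → J) (A : J' → M →ₗ[ℂ] M') (F : J × ℤ × ℤ → M) (n : ℕ) :
    lift2 φ A ((dd ^ n) F) = (dd ^ n) (lift2 φ A F) :=
  pow_intertwine (lift2_dd φ A) n F

lemma lift2_mem_bdd (φ : J' → J) (A : J' → M →ₗ[ℂ] M') {N : J → ℤ} {F : J × ℤ × ℤ → M}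
    (hF : F ∈ bdd N) : lift2 φ A F ∈ bdd (N ∘ φ) :=
  fun j m t h => by simp [hF (φ j) m t h]

lemma lift2_mem_dom (φ : J' → J) (A : J' → M →ₗ[ℂ] M') {F : J × ℤ × ℤ → M}
    (hF : F ∈ dom) : lift2 φ A F ∈ dom := by
  obtain ⟨K, N, h⟩ := hF
  exact ⟨K, _, by rw [← lift2_dd_pow]; exact lift2_mem_bdd φ A h⟩

lemma rho_lift (φ : J' → J) (A : J' → M →ₗ[ℂ] M') {F : J × ℤ × ℤ → M} (hF : F ∈ dom) (e : ℤ) :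
    rho e (lift2 φ A F) = lift1 φ A (rho e F) := by
  obtain ⟨K, N, h⟩ := hF
  have h' := lift2_mem_bdd φ A h
  have h'' := h'
  rw [lift2_dd_pow] at h''
  rw [rho_eq_tauN h, rho_eq_tauN h'', ← lift2_dd_pow]
  ext k
  simp [tauN]

end Tau

end NVA

namespace NVA

/-! ### Nonvanishing of `p(x₀ + x, x)` -/

lemma aeval_K2_C (f : Fin 2 → K2) (a : ℂ) :
    MvPolynomial.aeval f (MvPolynomial.C a) = HahnSeries.single 0 (HahnSeries.single 0 a) := by
  refine (MvPolynomial.aeval_C f a).trans ?_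
  refine (HahnSeries.algebraMap_apply' ℤ (R := LC) a).trans ?_
  have h1 : algebraMap ℂ LC a = HahnSeries.single 0 a := by
    refine (HahnSeries.algebraMap_apply' ℤ (R := ℂ) a).trans ?_
    exact HahnSeries.ofPowerSeries_C a
  have h2 : algebraMap ℂ (PowerSeries LC) a = PowerSeries.C (algebraMap ℂ LC a) :=
    PowerSeries.algebraMap_apply
  refine (congrArg (HahnSeries.ofPowerSeries ℤ LC) h2).trans ?_
  refine (HahnSeries.ofPowerSeries_C _).trans ?_
  rw [h1]; rfl

lemma xOuter_pow_mul_xInner_pow (m n : ℕ) :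
    xOuter ^ m * xInner ^ n = HahnSeries.single (m : ℤ) (HahnSeries.single (n : ℤ) 1) := by
  simp [xOuter, xInner, HahnSeries.single_pow, HahnSeries.single_mul_single]

lemma aeval_outer_inner_coeff (p : MvPolynomial (Fin 2) ℂ) (d : Fin 2 →₀ ℕ) :
    ((MvPolynomial.aeval ![xOuter, xInner] p).coeff (d 0)).coeff (d 1) =
      MvPolynomial.coeff d p := by
  induction p using MvPolynomial.induction_on' with
  | monomial u a =>
    rw [MvPolynomial.aeval_monomial, ← MvPolynomial.aeval_C ![xOuter, xInner], aeval_K2_C,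
      Finsupp.prod_fintype _ _ (by simp), Fin.prod_univ_two]
    simp only [Matrix.cons_val_zero, Matrix.cons_val_one, xOuter_pow_mul_xInner_pow]
    rw [HahnSeries.single_mul_single, HahnSeries.single_mul_single,
      MvPolynomial.coeff_monomial, zero_add, zero_add, mul_one]
    by_cases h0 : d 0 = u 0
    · by_cases h1 : d 1 = u 1
      · have : u = d := by ext i; fin_cases i <;> simp [h0, h1]
        simp [this]
      · have : u ≠ d := fun h => h1 (by rw [h])
        rw [if_neg this, h0, HahnSeries.coeff_single_same, HahnSeries.coeff_single_of_ne
          (by exact_mod_cast h1)]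
    · have : u ≠ d := fun h => h0 (by rw [h])
      rw [if_neg this, HahnSeries.coeff_single_of_ne (by exact_mod_cast h0)]
      simp
  | add p q hp hq => simp [hp, hq]

lemma qK_ne_zero {p : MvPolynomial (Fin 2) ℂ} (hp : p ≠ 0) : qK p 1 ≠ 0 := by
  intro h
  let p' : MvPolynomial (Fin 2) ℂ :=
    MvPolynomial.aeval ![MvPolynomial.X 0 + MvPolynomial.X 1, MvPolynomial.X 1] p
  have h1 : MvPolynomial.aeval ![xOuter, xInner] p' = qK p 1 := by
    rw [← AlgHom.comp_apply]
    refine DFunLike.congr_fun (MvPolynomial.algHom_ext fun i => ?_) p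
    fin_cases i <;> simp [xInnerC, xInner]
  have h2 : p' = 0 := by
    ext d
    rw [← aeval_outer_inner_coeff, h1, h]
    simp
  apply hp
  have h3 : MvPolynomial.aeval ![MvPolynomial.X 0 - MvPolynomial.X 1, MvPolynomial.X 1] p' = p := by
    rw [← AlgHom.comp_apply]
    refine DFunLike.congr_fun (g := AlgHom.id ℂ _) (MvPolynomial.algHom_ext fun i => ?_) p
    fin_cases i <;> simp
  rw [← h3, h2, map_zero]

/-! ### Iterated Hahn modules -/

section HM

variable {M : Type*} [AddCommGroup M] [Module ℂ M]

lemma hm_support_finite {R V : Type*} [Semiring R] [AddCommMonoid V] [Module R V]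
    (x : HahnSeries ℤ R) (y : HahnModule ℤ R V) (a : ℤ) :
    {i : ℤ | x.coeff i ≠ 0 ∧ ((HahnModule.of R).symm y).coeff (a - i) ≠ 0}.Finite := by
  refine ((Finset.VAddAntidiagonal a
    (Set.VAddAntidiagonal.finite_of_isPWO x.isPWO_support
      ((HahnModule.of R).symm y).isPWO_support a)).image Prod.fst).finite_toSet.subset ?_
  intro i hi
  simp only [Finset.coe_image, Set.mem_image, Finset.mem_coe, Prod.exists, exists_and_right,
    exists_eq_right]
  refine ⟨a - i, ?_⟩
  simp only [Finset.mem_vaddAntidiagonal, HahnSeries.mem_support, vadd_eq_add]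
  exact ⟨hi.1, hi.2, by ring⟩

lemma hm_coeff_smul {R V : Type*} [Semiring R] [AddCommMonoid V] [Module R V]
    (x : HahnSeries ℤ R) (y : HahnModule ℤ R V) (a : ℤ) :
    ((HahnModule.of R).symm (x • y)).coeff a =
      ∑ᶠ i : ℤ, x.coeff i • ((HahnModule.of R).symm y).coeff (a - i) := by
  rw [HahnModule.coeff_smul]
  set s := Finset.VAddAntidiagonal a
    (Set.VAddAntidiagonal.finite_of_isPWO x.isPWO_support
      ((HahnModule.of R).symm y).isPWO_support a) with hs
  have hsup : (Function.support fun i : ℤ =>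
      x.coeff i • ((HahnModule.of R).symm y).coeff (a - i)) ⊆ (s.image Prod.fst : Finset ℤ) := by
    intro i hi
    simp only [Finset.coe_image, Set.mem_image, Finset.mem_coe, Prod.exists, exists_and_right,
      exists_eq_right]
    refine ⟨a - i, ?_⟩
    simp only [hs, Finset.mem_vaddAntidiagonal, HahnSeries.mem_support, vadd_eq_add]
    refine ⟨fun h => hi (by simp [h]), fun h => hi (by simp [h]), by ring⟩
  rw [finsum_eq_finsetSum_of_support_subset _ hsup, Finset.sum_image]
  · refine Finset.sum_congr rfl fun ij hij => ?_
    simp only [hs, Finset.mem_vaddAntidiagonal, vadd_eq_add] at hij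
    rw [← hij.2.2, add_sub_cancel_left]
  · intro ij hij ij' hij' h
    simp only [hs, Finset.mem_coe, Finset.mem_vaddAntidiagonal, vadd_eq_add] at hij hij'
    ext
    · exact h
    · have := hij.2.2.trans hij'.2.2.symm
      omega

lemma hm_add_smul {R V : Type*} [CommRing R] [AddCommGroup V] [Module R V]
    (x x' : HahnSeries ℤ R) (y : HahnModule ℤ R V) : (x + x') • y = x • y + x' • y :=
  add_smul _ _ _

lemma hm_mul_smul {R V : Type*} [CommRing R] [AddCommGroup V] [Module R V]
    (x x' : HahnSeries ℤ R) (y : HahnModule ℤ R V) : (x * x') • y = x • x' • y :=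
  mul_smul _ _ _

lemma hm_one_smul {R V : Type*} [CommRing R] [AddCommGroup V] [Module R V]
    (y : HahnModule ℤ R V) : (1 : HahnSeries ℤ R) • y = y :=
  one_smul _ _

/-- Iterated formal Laurent series with coefficients in `M`. -/
abbrev HM2 (M : Type*) [AddCommGroup M] [Module ℂ M] : Type _ :=
  HahnModule ℤ LC (HahnModule ℤ ℂ M)

lemma k2_add_smul (x x' : K2) (y : HM2 M) : (x + x') • y = x • y + x' • y :=
  hm_add_smul (R := LC) x x' y

lemma k2_mul_smul (x x' : K2) (y : HM2 M) : (x * x') • y = x • x' • y :=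
  hm_mul_smul (R := LC) x x' y

lemma k2_one_smul (y : HM2 M) : (1 : K2) • y = y := hm_one_smul (R := LC) y

/-- The coefficient of `x₀^e x^q`. -/
def c2 (y : HM2 M) (e q : ℤ) : M :=
  ((HahnModule.of ℂ).symm (((HahnModule.of LC).symm y).coeff e)).coeff q

lemma c2_add (y z : HM2 M) (e q : ℤ) : c2 (y + z) e q = c2 y e q + c2 z e q := rfl

lemma exists_c2 (f : ℤ → ℤ → M) (h1 : ∃ E, ∀ e < E, f e = 0)
    (h2 : ∀ e, ∃ N, ∀ q < N, f e q = 0) : ∃ y : HM2 M, ∀ e q, c2 y e q = f e q := by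
  obtain ⟨E, hE⟩ := h1
  choose N hN using h2
  refine ⟨HahnModule.of LC (HahnSeries.ofSuppBddBelow (fun e => HahnModule.of ℂ
    (HahnSeries.ofSuppBddBelow (f e) ⟨N e, fun q hq => ?_⟩)) ⟨E, fun e he => ?_⟩),
    fun e q => ?_⟩
  · by_contra hc
    exact hq (hN e q (not_le.1 hc))
  · by_contra hc
    refine he (HahnModule.ext _ _ ?_)
    ext1 q
    simp [hE e (not_le.1 hc)]
  · rfl

lemma c2_single_smul (m n : ℤ) (a : ℂ) (y : HM2 M) (e q : ℤ) :
    c2 ((HahnSeries.single m (HahnSeries.single n a) : K2) • y) e q =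
      a • c2 y (e - m) (q - n) := by
  unfold c2
  have h := HahnModule.coeff_single_smul_vadd (r := (HahnSeries.single n a : LC)) (x := y)
    (a := e - m) (b := m)
  rw [vadd_eq_add, add_sub_cancel] at h
  rw [h]
  have h' := HahnModule.coeff_single_smul_vadd (r := a)
    (x := ((HahnModule.of LC).symm y).coeff (e - m)) (a := q - n) (b := n)
  rw [vadd_eq_add, add_sub_cancel] at h'
  exact h'

lemma c2_smul (x : K2) (y : HM2 M) (e q : ℤ) :
    c2 (x • y) e q =
      ∑ᶠ s : ℤ × ℤ, (x.coeff s.1).coeff s.2 • c2 y (e - s.1) (q - s.2) := by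
  have h1 := hm_support_finite x y e
  have hsum : c2 (x • y) e q = ∑ᶠ i : ℤ, ∑ᶠ k : ℤ,
      (x.coeff i).coeff k • c2 y (e - i) (q - k) := by
    unfold c2
    have h2 := hm_coeff_smul x y e
    rw [h2]
    let L : HahnModule ℤ ℂ M →+ M :=
      { toFun := fun y => ((HahnModule.of ℂ).symm y).coeff q
        map_zero' := rfl
        map_add' := fun _ _ => rfl }
    refine (L.map_finsum (h1.subset fun i hi => ?_)).trans (finsum_congr fun i => ?_)
    · exact ⟨fun h => hi (by simp [h]), fun h => hi (by simp [h])⟩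
    · exact hm_coeff_smul _ _ _
  rw [hsum, finsum_curry]
  refine ((h1.toFinset.sigma fun i => (hm_support_finite (x.coeff i)
    (((HahnModule.of LC).symm y).coeff (e - i)) q).toFinset).image
    fun s => (s.1, s.2)).finite_toSet.subset ?_
  rintro ⟨i, k⟩ hik
  have hx : (x.coeff i).coeff k ≠ 0 := fun h => hik (by simp [h])
  have hy : c2 y (e - i) (q - k) ≠ 0 := fun h => hik (by simp [h])
  simp only [Finset.coe_image, Set.mem_image, Finset.mem_coe]
  refine ⟨⟨i, k⟩, ?_, rfl⟩
  simp only [Finset.mem_sigma, Set.Finite.mem_toFinset]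
  exact ⟨⟨fun h => hx (by simp [h]), fun h => hy (by simp only [c2, h]; rfl)⟩, hx, hy⟩

end HM

end NVA

namespace NVA

/-! ### Multiplication by polynomials -/

section MulPoly

variable {J M : Type*} [AddCommGroup M] [Module ℂ M]

lemma mulPoly_eq_sum {p : MvPolynomial (Fin 2) ℂ} {s : Finset (Fin 2 →₀ ℕ)}
    (hs : p.support ⊆ s) (F : ℤ → ℤ → M) (m t : ℤ) :
    mulPoly p F m t = ∑ d ∈ s, MvPolynomial.coeff d p • F (m - d 0) (t - d 1) :=
  Finset.sum_subset hs fun d _ hd => by rw [MvPolynomial.notMem_support_iff.1 hd, zero_smul]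

lemma mulPoly_add (p q : MvPolynomial (Fin 2) ℂ) (F : ℤ → ℤ → M) (m t : ℤ) :
    mulPoly (p + q) F m t = mulPoly p F m t + mulPoly q F m t := by
  rw [mulPoly_eq_sum (MvPolynomial.support_add (p := p) (q := q)),
    mulPoly_eq_sum (p := p) Finset.subset_union_left,
    mulPoly_eq_sum (p := q) Finset.subset_union_right, ← Finset.sum_add_distrib]
  exact Finset.sum_congr rfl fun d _ => by rw [MvPolynomial.coeff_add, add_smul]

lemma mulPoly_C (a : ℂ) (F : ℤ → ℤ → M) (m t : ℤ) :
    mulPoly (MvPolynomial.C a) F m t = a • F m t := by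
  have h : (MvPolynomial.C a : MvPolynomial (Fin 2) ℂ).support ⊆ {0} := by
    intro d hd
    rw [MvPolynomial.mem_support_iff, MvPolynomial.coeff_C] at hd
    by_contra h
    exact hd (if_neg fun h' => h (by simp [← h']))
  rw [mulPoly_eq_sum h]
  simp

lemma mulPoly_mul_X (p : MvPolynomial (Fin 2) ℂ) (i : Fin 2) (F : ℤ → ℤ → M) (m t : ℤ) :
    mulPoly (p * MvPolynomial.X i) F m t =
      mulPoly p (fun m t => F (m - (Finsupp.single i 1 : Fin 2 →₀ ℕ) 0)
        (t - (Finsupp.single i 1 : Fin 2 →₀ ℕ) 1)) m t := by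
  unfold mulPoly
  rw [MvPolynomial.support_mul_X, Finset.sum_map]
  refine Finset.sum_congr rfl fun d _ => ?_
  simp only [addRightEmbedding_apply, MvPolynomial.coeff_mul_X, Finsupp.add_apply, Nat.cast_add]
  rw [sub_sub, sub_sub]

/-- Multiplication of a two-variable family with parameters by a polynomial. -/
def mulF (p : MvPolynomial (Fin 2) ℂ) (F : J × ℤ × ℤ → M) : J × ℤ × ℤ → M :=
  fun k => mulPoly p (fun m t => F (k.1, m, t)) k.2.1 k.2.2

lemma mulF_add (p q : MvPolynomial (Fin 2) ℂ) (F : J × ℤ × ℤ → M) :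
    mulF (p + q) F = mulF p F + mulF q F := by
  ext k; exact mulPoly_add _ _ _ _ _

lemma mulF_C (a : ℂ) (F : J × ℤ × ℤ → M) : mulF (MvPolynomial.C a) F = a • F := by
  ext k; exact mulPoly_C _ _ _ _

lemma mulF_mul_X_zero (p : MvPolynomial (Fin 2) ℂ) (F : J × ℤ × ℤ → M) :
    mulF (p * MvPolynomial.X 0) F = mulF p (shP F) := by
  ext k
  refine (mulPoly_mul_X _ _ _ _ _).trans ?_
  simp [mulF, shP_apply]

lemma mulF_mul_X_one (p : MvPolynomial (Fin 2) ℂ) (F : J × ℤ × ℤ → M) :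
    mulF (p * MvPolynomial.X 1) F = mulF p (shQ F) := by
  ext k
  refine (mulPoly_mul_X _ _ _ _ _).trans ?_
  simp [mulF, shQ_apply]

lemma mulF_sub_right (p : MvPolynomial (Fin 2) ℂ) (F G : J × ℤ × ℤ → M) :
    mulF p (F - G) = mulF p F - mulF p G := by
  ext k
  simp [mulF, mulPoly, smul_sub, Finset.sum_sub_distrib]

lemma mulF_sub_left (p q : MvPolynomial (Fin 2) ℂ) (F : J × ℤ × ℤ → M) :
    mulF (p - q) F = mulF p F - mulF q F := by
  rw [eq_sub_iff_add_eq, ← mulF_add, sub_add_cancel]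

lemma mulF_X_sub_X_pow (k : ℕ) (F : J × ℤ × ℤ → M) :
    mulF ((MvPolynomial.X 0 - MvPolynomial.X 1) ^ k) F = (dd ^ k) F := by
  induction k generalizing F with
  | zero => rw [pow_zero, ← MvPolynomial.C_1, mulF_C]; simp
  | succ k ih =>
    rw [pow_succ, mul_sub, mulF_sub_left, mulF_mul_X_zero, mulF_mul_X_one, ← mulF_sub_right, ih,
      pow_succ]
    rfl

lemma rho_shP {F : J × ℤ × ℤ → M} (hF : F ∈ dom) (e : ℤ) :
    rho e (shP F) = rho (e - 1) F + sh1 (rho e F) := by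
  have : (shP F : J × ℤ × ℤ → M) = dd F + shQ F := by simp [dd]
  rw [this, map_add, rho_dd hF, rho_shQ hF]

lemma shP_mem_dom {F : J × ℤ × ℤ → M} (hF : F ∈ dom) : shP F ∈ dom := by
  have : (shP F : J × ℤ × ℤ → M) = dd F + shQ F := by simp [dd]
  rw [this]
  exact add_mem (dd_mem_dom hF) (shQ_mem_dom hF)

lemma exists_c2_rho {F : J × ℤ × ℤ → M} (hF : F ∈ dom) (j : J) :
    ∃ y : HM2 M, ∀ e q, c2 y e q = rho e F (j, q) := by
  obtain ⟨K, N, h⟩ := hF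
  refine exists_c2 (fun e q => rho e F (j, q)) ⟨-K, fun e he => ?_⟩
    fun e => ⟨2 * N j - K - e, fun q hq => ?_⟩
  · ext q
    rw [rho_eq_zero_of_lt h (by omega)]
    rfl
  · exact rho_trunc h (by omega)

lemma qK_C (a : ℂ) : qK (MvPolynomial.C a) 1 = HahnSeries.single 0 (HahnSeries.single 0 a) :=
  aeval_K2_C _ a

lemma qK_add (p q : MvPolynomial (Fin 2) ℂ) : qK (p + q) 1 = qK p 1 + qK q 1 := map_add _ _ _

lemma qK_mul_X_zero (p : MvPolynomial (Fin 2) ℂ) :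
    qK (p * MvPolynomial.X 0) 1 = qK p 1 * (xOuter + xInner) := by
  simp [qK, xInnerC, xInner]

lemma qK_mul_X_one (p : MvPolynomial (Fin 2) ℂ) :
    qK (p * MvPolynomial.X 1) 1 = qK p 1 * xInner := by
  simp [qK]

lemma c2_qK_smul (p : MvPolynomial (Fin 2) ℂ) {F : J × ℤ × ℤ → M} (hF : F ∈ dom) {j : J}
    {y : HM2 M} (hy : ∀ e q, c2 y e q = rho e F (j, q)) (e q : ℤ) :
    c2 (qK p 1 • y) e q = rho e (mulF p F) (j, q) := by
  induction p using MvPolynomial.induction_on generalizing F y e q with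
  | C a =>
    rw [qK_C, c2_single_smul, mulF_C, map_smul, sub_zero, sub_zero, hy]
    rfl
  | add p p' ih ih' =>
    rw [qK_add, k2_add_smul, c2_add, ih hF hy, ih' hF hy, mulF_add, map_add]
    rfl
  | mul_X p i ih =>
    fin_cases i
    · simp only [Fin.zero_eta]
      rw [qK_mul_X_zero, k2_mul_smul, mulF_mul_X_zero]
      refine ih (shP_mem_dom hF) (fun e q => ?_) e q
      rw [k2_add_smul, c2_add, xOuter, xInner, c2_single_smul, rho_shP hF]
      have h1 := c2_single_smul 1 0 1 y e q
      rw [show (HahnSeries.single (0 : ℤ) (1 : ℂ) : LC) = 1 from rfl] at h1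
      rw [h1, one_smul, one_smul, sub_zero, sub_zero, hy, hy]
      rfl
    · simp only [Fin.mk_one]
      rw [qK_mul_X_one, k2_mul_smul, mulF_mul_X_one]
      refine ih (shQ_mem_dom hF) (fun e q => ?_) e q
      rw [xInner, c2_single_smul, rho_shQ hF, one_smul, sub_zero, hy]
      rfl

end MulPoly

section YEeq

variable {W : Type*} [AddCommGroup W] [Module ℂ W]

/-- The product `a(x₁) b(x₂)` as a family. -/
def AB (a b : EW W) : W × ℤ × ℤ → W := fun k => Fab a b k.1 k.2.1 k.2.2

lemma AB_apply (a b : EW W) (w : W) (m t : ℤ) :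
    AB a b (w, m, t) = mf a (mf b w (-t - 1)) (-m - 1) := rfl

lemma mf_add (a : EW W) (w w' : W) (n : ℤ) : mf a (w + w') n = mf a w n + mf a w' n := by
  simp [mf]

lemma mf_smul (a : EW W) (c : ℂ) (w : W) (n : ℤ) : mf a (c • w) n = c • mf a w n := by
  simp [mf]

lemma ew_ext {a b : EW W} (h : ∀ w n, mf a w n = mf b w n) : a = b := by
  refine Subtype.ext (LinearMap.ext fun w => funext fun n => h w n)

lemma rho_AB_add {a b : EW W} (h : AB a b ∈ dom) (e : ℤ) (w w' : W) (q : ℤ) :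
    rho e (AB a b) (w + w', q) = rho e (AB a b) (w, q) + rho e (AB a b) (w', q) := by
  have h1 : lift2 (fun k : W × W => k.1 + k.2) (fun _ => LinearMap.id) (AB a b) =
      lift2 (fun k : W × W => k.1) (fun _ => LinearMap.id) (AB a b) +
      lift2 (fun k : W × W => k.2) (fun _ => LinearMap.id) (AB a b) := by
    ext ⟨⟨w, w'⟩, m, t⟩
    simp [AB_apply, mf_add]
  have h2 := congrArg (rho e) h1
  rw [map_add, rho_lift _ _ h, rho_lift _ _ h, rho_lift _ _ h] at h2
  simpa using congrFun h2 ((w, w'), q)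

lemma rho_AB_smul {a b : EW W} (h : AB a b ∈ dom) (e : ℤ) (c : ℂ) (w : W) (q : ℤ) :
    rho e (AB a b) (c • w, q) = c • rho e (AB a b) (w, q) := by
  have h1 : lift2 (fun w : W => c • w) (fun _ => LinearMap.id) (AB a b) = c • AB a b := by
    ext ⟨w, m, t⟩
    simp [AB_apply, mf_smul]
  have h2 := congrArg (rho e) h1
  rw [map_smul, rho_lift _ _ h] at h2
  simpa using congrFun h2 (w, q)

lemma hs_inv_mul_self {R : Type*} [Field R] {x : HahnSeries ℤ R} (hx : x ≠ 0) : x⁻¹ * x = 1 :=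
  inv_mul_cancel₀ hx

lemma fullYE_eq {a b : EW W} (h : AB a b ∈ dom) {p : MvPolynomial (Fin 2) ℂ} (hp : p ≠ 0)
    (hL : ∀ w, IsLaurent2 (mulPoly p (Fab a b w))) (w : W) (e q : ℤ) :
    fullYE 1 p a b w e q = rho e (AB a b) (w, q) := by
  obtain ⟨y, hy⟩ := exists_c2_rho h w
  choose N hN using hL
  have hb : (dd ^ 0) (mulF p (AB a b)) ∈ bdd N := fun w m t hmt => hN w m t hmt
  have hinv : (qInv p 1 * qK p 1 : K2) = 1 :=
    hs_inv_mul_self (R := LC) (qK_ne_zero hp)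
  rw [← hy, ← k2_one_smul y, ← hinv, k2_mul_smul, c2_smul]
  refine finsum_congr fun s => ?_
  rw [c2_qK_smul p h hy, rho_eq hb]
  simp only [Nat.cast_zero, zero_add, pow_zero, Module.End.one_apply]
  congr 1
  split_ifs with h0
  · obtain ⟨j, hj⟩ := Int.eq_ofNat_of_zero_le h0
    rw [hj]
    simp only [Int.toNat_natCast]
    refine finsum_congr fun m => ?_
    rw [one_zpow, mul_one, bz_natCast]
    rfl
  · rw [tau_of_neg _ (by omega)]
    rfl

lemma qcPair_of_mem_dom {a b : EW W} (h : AB a b ∈ dom) : QCPair a b := by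
  obtain ⟨K, N, hK⟩ := h
  refine ⟨(MvPolynomial.X 0 - MvPolynomial.X 1) ^ K, pow_ne_zero _ ?_, fun w => ⟨N w, ?_⟩⟩
  · rw [sub_ne_zero]
    exact fun h => by simpa using MvPolynomial.X_injective h
  · intro m t hmt
    have := hK w m t hmt
    rwa [← mulF_X_sub_X_pow] at this

theorem mf_YE {a b : EW W} (h : AB a b ∈ dom) (n : ℤ) (w : W) (m : ℤ) :
    mf (YE a b n) w m = rho (-n - 1) (AB a b) (w, -m - 1) := by
  have hq := qcPair_of_mem_dom h
  have hraw : ∀ w m, rawYE ((1 : ℂˣ) : ℂ) a b n w m = rho (-n - 1) (AB a b) (w, -m - 1) := by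
    intro w m
    rw [rawYE, dif_pos hq, Units.val_one]
    exact fullYE_eq h hq.choose_spec.1 hq.choose_spec.2 _ _ _
  have hex : ∃ c : EW W, ∀ w m, mf c w m = rawYE ((1 : ℂˣ) : ℂ) a b n w m := by
    refine ⟨⟨{ toFun := fun w m => rho (-n - 1) (AB a b) (w, -m - 1)
               map_add' := fun w w' => funext fun m => rho_AB_add h _ _ _ _
               map_smul' := fun c w => funext fun m => rho_AB_smul h _ _ _ _ }, fun w => ?_⟩,
      fun w m => (hraw w m).symm⟩
    obtain ⟨K, N, hK⟩ := h
    exact ⟨K - n - 1 - 2 * N w, fun m hm => rho_trunc hK (by omega)⟩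
  rw [YE, YEa, dif_pos hex, hex.choose_spec, hraw]

end YEeq

end NVA

namespace NVA

/-! ### Dong's lemma for residue-type products -/

section Dong

lemma nullFam_sub_of {K M : Type*} [AddCommGroup M] [Module ℂ M] {A B : Module.End ℂ (K → M)}
    (hAB : ∀ F, A (B F) = B (A F)) {F : K → M}
    (h : ∀ k, ∃ L : ℕ, ∀ a b : ℕ, L ≤ a + b → (A ^ a) ((B ^ b) F) k = 0) :
    NullFam (A - B) F := by
  have key : ∀ (n : ℕ) (F : K → M) (k : K), (∀ a b : ℕ, a + b = n → (A ^ a) ((B ^ b) F) k = 0) →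
      ((A - B) ^ n) F k = 0 := by
    intro n
    induction n with
    | zero => intro F k h; simpa using h 0 0 rfl
    | succ n ih =>
      intro F k h
      have h1 : ((A - B) ^ (n + 1)) F = ((A - B) ^ n) (A F) - ((A - B) ^ n) (B F) := by
        rw [pow_succ, Module.End.mul_apply, LinearMap.sub_apply, map_sub]
      rw [h1, Pi.sub_apply, ih (A F), ih (B F), sub_zero]
      · intro a b hab
        have := h a (b + 1) (by omega)
        rwa [pow_succ, Module.End.mul_apply] at this
      · intro a b hab
        have := h (a + 1) b (by omega)
        rwa [pow_succ, Module.End.mul_apply, pow_intertwine (T := A) (D' := B) hAB] at this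
  intro k
  obtain ⟨L, hL⟩ := h k
  exact ⟨L, fun n hn => key n F k fun a b hab => hL a b (by omega)⟩

lemma finsum_antidiagonal {M : Type*} [AddCommGroup M] (f : ℕ × ℕ → M) {A B : ℕ}
    (h : ∀ a b, A ≤ a ∨ B ≤ b → f (a, b) = 0) :
    ∑ᶠ n, ∑ x ∈ Finset.HasAntidiagonal.antidiagonal n, f x =
      ∑ b ∈ Finset.range B, ∑ᶠ a, f (a, b) := by
  have h1 : ∀ b, ∑ᶠ a, f (a, b) = ∑ a ∈ Finset.range A, f (a, b) := fun b =>
    finsum_nat_eq_sum_range _ A fun a ha => h a b (Or.inl ha)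
  simp only [h1]
  rw [finsum_nat_eq_sum_range _ (A + B), Finset.sum_comm, ← Finset.sum_product',
    ← Finset.sum_fiberwise_of_maps_to (t := Finset.range (A + B)) (g := fun x : ℕ × ℕ => x.1 + x.2)]
  · refine Finset.sum_congr rfl fun n _ => (Finset.sum_subset ?_ ?_).symm
    · intro x hx
      simp only [Finset.mem_filter] at hx
      exact Finset.HasAntidiagonal.mem_antidiagonal.2 hx.2
    · intro x hx hx'
      rw [Finset.HasAntidiagonal.mem_antidiagonal] at hx
      simp only [Finset.mem_filter, Finset.mem_product, Finset.mem_range] at hx'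
      exact h _ _ (by omega)
  · intro x hx
    simp only [Finset.mem_product, Finset.mem_range] at hx ⊢
    omega
  · intro n hn
    refine Finset.sum_eq_zero fun x hx => h _ _ ?_
    rw [Finset.HasAntidiagonal.mem_antidiagonal] at hx
    omega

variable {I M : Type*} [AddCommGroup M] [Module ℂ M]

/-- Multiplication of a three-variable family by the parameter variable. -/
def shR : Module.End ℂ ((I × ℤ) × ℤ × ℤ → M) :=
  lift2 (fun j => (j.1, j.2 - 1)) fun _ => LinearMap.id

/-- Multiplication of a two-variable family by the parameter variable. -/
def shR1 : Module.End ℂ ((I × ℤ) × ℤ → M) :=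
  lift1 (fun j => (j.1, j.2 - 1)) fun _ => LinearMap.id

@[simp] lemma shR_apply (F : (I × ℤ) × ℤ × ℤ → M) (k : (I × ℤ) × ℤ × ℤ) :
    shR F k = F ((k.1.1, k.1.2 - 1), k.2) := rfl

@[simp] lemma shR1_apply (F : (I × ℤ) × ℤ → M) (k : (I × ℤ) × ℤ) :
    shR1 F k = F ((k.1.1, k.1.2 - 1), k.2) := rfl

/-- Difference of the first and the parameter variables. -/
def dPR : Module.End ℂ ((I × ℤ) × ℤ × ℤ → M) := shP - shR

/-- Difference of the second and the parameter variables. -/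
def dQR : Module.End ℂ ((I × ℤ) × ℤ × ℤ → M) := shQ - shR

/-- Difference of the variable and the parameter variable. -/
def dR1 : Module.End ℂ ((I × ℤ) × ℤ → M) := sh1 - shR1

lemma dPR_eq : (dPR : Module.End ℂ ((I × ℤ) × ℤ × ℤ → M)) = dQR + dd := by
  simp [dPR, dQR, dd]

lemma dPR_dQR (F : (I × ℤ) × ℤ × ℤ → M) : dPR (dQR F) = dQR (dPR F) := by
  ext k
  simp only [dPR, dQR, LinearMap.sub_apply, Pi.sub_apply, shP_apply, shQ_apply, shR_apply]
  abel

lemma dd_dQR (F : (I × ℤ) × ℤ × ℤ → M) : dd (dQR F) = dQR (dd F) := by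
  ext k
  simp only [dd, dQR, LinearMap.sub_apply, Pi.sub_apply, shP_apply, shQ_apply, shR_apply]
  abel

lemma dd_dPR (F : (I × ℤ) × ℤ × ℤ → M) : dd (dPR F) = dPR (dd F) := by
  ext k
  simp only [dd, dPR, LinearMap.sub_apply, Pi.sub_apply, shP_apply, shQ_apply, shR_apply]
  abel

lemma rowFinite_dPR : RowFinite (dPR : Module.End ℂ ((I × ℤ) × ℤ × ℤ → M)) :=
  rowFinite_shP.sub (rowFinite_famMap _ _)

lemma rowFinite_dQR : RowFinite (dQR : Module.End ℂ ((I × ℤ) × ℤ × ℤ → M)) :=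
  rowFinite_shQ.sub (rowFinite_famMap _ _)

lemma rowFinite_dR1 : RowFinite (dR1 : Module.End ℂ ((I × ℤ) × ℤ → M)) :=
  rowFinite_sh1.sub (rowFinite_famMap _ _)

lemma shR_mem_dom {F : (I × ℤ) × ℤ × ℤ → M} (hF : F ∈ dom) : shR F ∈ dom := lift2_mem_dom _ _ hF

lemma dQR_mem_dom {F : (I × ℤ) × ℤ × ℤ → M} (hF : F ∈ dom) : dQR F ∈ dom :=
  sub_mem (shQ_mem_dom hF) (shR_mem_dom hF)

lemma dPR_mem_dom {F : (I × ℤ) × ℤ × ℤ → M} (hF : F ∈ dom) : dPR F ∈ dom :=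
  sub_mem (shP_mem_dom hF) (shR_mem_dom hF)

lemma dQR_pow_mem_dom {F : (I × ℤ) × ℤ × ℤ → M} (hF : F ∈ dom) (n : ℕ) : (dQR ^ n) F ∈ dom := by
  induction n with
  | zero => simpa
  | succ n ih => rw [pow_succ']; exact dQR_mem_dom ih

lemma dPR_pow_mem_dom {F : (I × ℤ) × ℤ × ℤ → M} (hF : F ∈ dom) (n : ℕ) : (dPR ^ n) F ∈ dom := by
  induction n with
  | zero => simpa
  | succ n ih => rw [pow_succ']; exact dPR_mem_dom ih

lemma rho_dQR {F : (I × ℤ) × ℤ × ℤ → M} (hF : F ∈ dom) (e : ℤ) :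
    rho e (dQR F) = dR1 (rho e F) := by
  rw [dQR, LinearMap.sub_apply, map_sub, rho_shQ hF, shR, rho_lift _ _ hF]
  rfl

lemma rho_dQR_pow {F : (I × ℤ) × ℤ × ℤ → M} (hF : F ∈ dom) (e : ℤ) (n : ℕ) :
    rho e ((dQR ^ n) F) = (dR1 ^ n) (rho e F) := by
  induction n with
  | zero => simp
  | succ n ih =>
    rw [pow_succ', Module.End.mul_apply, rho_dQR (dQR_pow_mem_dom hF n), ih, pow_succ' dR1]
    rfl

lemma rho_dPR {F : (I × ℤ) × ℤ × ℤ → M} (hF : F ∈ dom) (e : ℤ) :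
    rho e (dPR F) = dR1 (rho e F) + rho (e - 1) F := by
  rw [dPR_eq, LinearMap.add_apply, map_add, rho_dQR hF, rho_dd hF]

lemma rho_dPR_pow {F : (I × ℤ) × ℤ × ℤ → M} (hF : F ∈ dom) (e : ℤ) (n : ℕ) :
    rho e ((dPR ^ n) F) = ∑ x ∈ Finset.HasAntidiagonal.antidiagonal n,
      (n.choose x.1 : ℂ) • (dR1 ^ x.1) (rho (e - x.2) F) := by
  have hc : Commute (dQR : Module.End ℂ ((I × ℤ) × ℤ × ℤ → M)) dd :=
    LinearMap.ext fun F => (dd_dQR F).symm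
  rw [dPR_eq, hc.add_pow', LinearMap.sum_apply, map_sum]
  refine Finset.sum_congr rfl fun x _ => ?_
  rw [LinearMap.smul_apply, Module.End.mul_apply, map_nsmul, rho_dQR_pow (dd_pow_mem_dom hF _),
    rho_dd_pow hF, Nat.cast_smul_eq_nsmul]

/-- Families, jointly truncated uniformly in small parameter exponents, and truncated in the
parameter exponent. -/
def cls (N : I → ℤ → ℤ) (R : I → ℤ → ℤ → ℤ) : Submodule ℂ ((I × ℤ) × ℤ × ℤ → M) where
  carrier := {Z | (∀ i r r', r' ≤ r → ∀ p q, p < N i r ∨ q < N i r → Z ((i, r'), p, q) = 0) ∧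
    ∀ i p q r p' q', r < R i p q → p' ≤ p → q' ≤ q → Z ((i, r), p', q') = 0}
  add_mem' hF hG := ⟨fun i r r' h p q h' => by simp [hF.1 i r r' h p q h', hG.1 i r r' h p q h'],
    fun i p q r p' q' h1 h2 h3 => by
      simp [hF.2 i p q r p' q' h1 h2 h3, hG.2 i p q r p' q' h1 h2 h3]⟩
  zero_mem' := ⟨fun _ _ _ _ _ _ _ => rfl, fun _ _ _ _ _ _ _ _ _ => rfl⟩
  smul_mem' c F hF := ⟨fun i r r' h p q h' => by simp [hF.1 i r r' h p q h'],
    fun i p q r p' q' h1 h2 h3 => by simp [hF.2 i p q r p' q' h1 h2 h3]⟩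

lemma shP_mem_cls {N : I → ℤ → ℤ} {R : I → ℤ → ℤ → ℤ} {Z : (I × ℤ) × ℤ × ℤ → M}
    (hZ : Z ∈ cls N R) : shP Z ∈ cls N R :=
  ⟨fun i r r' h p q h' => hZ.1 i r r' h (p - 1) q (h'.imp (fun h => by omega) id),
    fun i p q r p' q' h1 h2 h3 => hZ.2 i p q r (p' - 1) q' h1 (by omega) h3⟩

lemma shQ_mem_cls {N : I → ℤ → ℤ} {R : I → ℤ → ℤ → ℤ} {Z : (I × ℤ) × ℤ × ℤ → M}
    (hZ : Z ∈ cls N R) : shQ Z ∈ cls N R :=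
  ⟨fun i r r' h p q h' => hZ.1 i r r' h p (q - 1) (h'.imp id fun h => by omega),
    fun i p q r p' q' h1 h2 h3 => hZ.2 i p q r p' (q' - 1) h1 h2 (by omega)⟩

lemma shR_mem_cls {N : I → ℤ → ℤ} {R : I → ℤ → ℤ → ℤ} {Z : (I × ℤ) × ℤ × ℤ → M}
    (hZ : Z ∈ cls N R) : shR Z ∈ cls N R :=
  ⟨fun i r r' h p q h' => hZ.1 i r (r' - 1) (by omega) p q h',
    fun i p q r p' q' h1 h2 h3 => hZ.2 i p q (r - 1) p' q' (by omega) h2 h3⟩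

lemma pow_mem_cls {N : I → ℤ → ℤ} {R : I → ℤ → ℤ → ℤ}
    {D : Module.End ℂ ((I × ℤ) × ℤ × ℤ → M)} (hD : ∀ Z ∈ cls N R, D Z ∈ cls N R)
    {Z : (I × ℤ) × ℤ × ℤ → M} (hZ : Z ∈ cls N R) (n : ℕ) : (D ^ n) Z ∈ cls N R := by
  induction n with
  | zero => simpa
  | succ n ih => rw [pow_succ']; exact hD _ ih

lemma psAct_mem_cls {N : I → ℤ → ℤ} {R : I → ℤ → ℤ → ℤ}
    {D : Module.End ℂ ((I × ℤ) × ℤ × ℤ → M)} (hD : ∀ Z ∈ cls N R, D Z ∈ cls N R)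
    {Z : (I × ℤ) × ℤ × ℤ → M} (hZ : Z ∈ cls N R) (g : PowerSeries ℂ) : psAct D g Z ∈ cls N R :=
  ⟨fun i r r' h p q h' => psAct_eq_zero g fun n => (pow_mem_cls hD hZ n).1 i r r' h p q h',
    fun i p q r p' q' h1 h2 h3 => psAct_eq_zero g fun n =>
      (pow_mem_cls hD hZ n).2 i p q r p' q' h1 h2 h3⟩

lemma dPR_mem_cls {N : I → ℤ → ℤ} {R : I → ℤ → ℤ → ℤ} (Z : (I × ℤ) × ℤ × ℤ → M)
    (hZ : Z ∈ cls N R) : dPR Z ∈ cls N R := sub_mem (shP_mem_cls hZ) (shR_mem_cls hZ)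

lemma dQR_mem_cls {N : I → ℤ → ℤ} {R : I → ℤ → ℤ → ℤ} (Z : (I × ℤ) × ℤ × ℤ → M)
    (hZ : Z ∈ cls N R) : dQR Z ∈ cls N R := sub_mem (shQ_mem_cls hZ) (shR_mem_cls hZ)

lemma dd_mem_cls {N : I → ℤ → ℤ} {R : I → ℤ → ℤ → ℤ} (Z : (I × ℤ) × ℤ × ℤ → M)
    (hZ : Z ∈ cls N R) : dd Z ∈ cls N R := sub_mem (shP_mem_cls hZ) (shQ_mem_cls hZ)

lemma shP_pow_apply {J : Type*} (n : ℕ) (F : J × ℤ × ℤ → M) (k : J × ℤ × ℤ) :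
    (shP ^ n) F k = F (k.1, k.2.1 - n, k.2.2) := by
  induction n generalizing F with
  | zero => simp
  | succ n ih =>
    rw [pow_succ, Module.End.mul_apply, ih, shP_apply]
    simp only [Nat.cast_succ, sub_sub]

lemma shQ_pow_apply {J : Type*} (n : ℕ) (F : J × ℤ × ℤ → M) (k : J × ℤ × ℤ) :
    (shQ ^ n) F k = F (k.1, k.2.1, k.2.2 - n) := by
  induction n generalizing F with
  | zero => simp
  | succ n ih =>
    rw [pow_succ, Module.End.mul_apply, ih, shQ_apply]
    simp only [Nat.cast_succ, sub_sub]

lemma shR_pow_apply (n : ℕ) (F : (I × ℤ) × ℤ × ℤ → M) (k : (I × ℤ) × ℤ × ℤ) :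
    (shR ^ n) F k = F ((k.1.1, k.1.2 - n), k.2) := by
  induction n generalizing F with
  | zero => simp
  | succ n ih =>
    rw [pow_succ, Module.End.mul_apply, ih, shR_apply]
    simp only [Nat.cast_succ, sub_sub]

lemma nullFam_dPR {N : I → ℤ → ℤ} {R : I → ℤ → ℤ → ℤ} {Z : (I × ℤ) × ℤ × ℤ → M}
    (hZ : Z ∈ cls N R) : NullFam dPR Z := by
  refine nullFam_sub_of (A := shP) (B := shR) (fun F => rfl) ?_
  rintro ⟨⟨i, r⟩, p, q⟩
  refine ⟨(p - N i r).toNat + 1 + ((r - R i p q).toNat + 1), fun a b hab => ?_⟩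
  rw [shP_pow_apply, shR_pow_apply]
  by_cases ha : (p - N i r).toNat + 1 ≤ a
  · exact hZ.1 i r (r - b) (by omega) _ _ (Or.inl (by simp only; omega))
  · exact hZ.2 i p q (r - b) (p - a) q (by omega) (by omega) le_rfl

lemma nullFam_dQR {N : I → ℤ → ℤ} {R : I → ℤ → ℤ → ℤ} {Z : (I × ℤ) × ℤ × ℤ → M}
    (hZ : Z ∈ cls N R) : NullFam dQR Z := by
  refine nullFam_sub_of (A := shQ) (B := shR) (fun F => rfl) ?_
  rintro ⟨⟨i, r⟩, p, q⟩
  refine ⟨(q - N i r).toNat + 1 + ((r - R i p q).toNat + 1), fun a b hab => ?_⟩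
  rw [shQ_pow_apply, shR_pow_apply]
  by_cases ha : (q - N i r).toNat + 1 ≤ a
  · exact hZ.1 i r (r - b) (by omega) _ _ (Or.inr (by simp only; omega))
  · exact hZ.2 i p q (r - b) p (q - a) (by omega) le_rfl (by omega)

lemma cls_le_bdd (N : I → ℤ → ℤ) (R : I → ℤ → ℤ → ℤ) {Z : (I × ℤ) × ℤ × ℤ → M}
    (hZ : Z ∈ cls N R) : (dd ^ 0) Z ∈ bdd fun j : I × ℤ => N j.1 j.2 :=
  fun j p q h => hZ.1 j.1 j.2 j.2 le_rfl p q h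

lemma cls_le_dom {N : I → ℤ → ℤ} {R : I → ℤ → ℤ → ℤ} {Z : (I × ℤ) × ℤ × ℤ → M}
    (hZ : Z ∈ cls N R) : Z ∈ dom := ⟨0, _, cls_le_bdd N R hZ⟩

lemma rho_eq_tauN_of_cls {N : I → ℤ → ℤ} {R : I → ℤ → ℤ → ℤ} {Z : (I × ℤ) × ℤ × ℤ → M}
    (hZ : Z ∈ cls N R) (e : ℤ) : rho e Z = tauN (fun j : I × ℤ => N j.1 j.2) e Z := by
  rw [rho_eq_tauN (cls_le_bdd N R hZ)]
  simp

lemma nullFam_rho {N : I → ℤ → ℤ} {R : I → ℤ → ℤ → ℤ} {Z : (I × ℤ) × ℤ × ℤ → M}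
    (hZ : Z ∈ cls N R) (e : ℤ) : NullFam dR1 (rho e Z) := by
  intro k
  obtain ⟨L, hL⟩ := (nullFam_dQR hZ).rowFinite (rowFinite_tauN (fun j : I × ℤ => N j.1 j.2) e) k
  refine ⟨L, fun n hn => ?_⟩
  rw [← rho_dQR_pow (cls_le_dom hZ), rho_eq_tauN_of_cls (pow_mem_cls dQR_mem_cls hZ n), hL n hn]

lemma rho_psAct_dQR {N : I → ℤ → ℤ} {R : I → ℤ → ℤ → ℤ} {Z : (I × ℤ) × ℤ × ℤ → M}
    (hZ : Z ∈ cls N R) (e : ℤ) (g : PowerSeries ℂ) :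
    rho e (psAct dQR g Z) = psAct dR1 g (rho e Z) := by
  ext k
  rw [rho_eq_tauN_of_cls (psAct_mem_cls dQR_mem_cls hZ g),
    psAct_rowFinite_sum (nullFam_dQR hZ) (rowFinite_tauN _ _)]
  refine finsum_congr fun n => ?_
  rw [← rho_dQR_pow (cls_le_dom hZ), rho_eq_tauN_of_cls (pow_mem_cls dQR_mem_cls hZ n)]

lemma rho_of_cls_neg {N : I → ℤ → ℤ} {R : I → ℤ → ℤ → ℤ} {Z : (I × ℤ) × ℤ × ℤ → M}
    (hZ : Z ∈ cls N R) {e : ℤ} (he : e < 0) : rho e Z = 0 :=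
  rho_eq_zero_of_lt (cls_le_bdd N R hZ) (by simpa using he)

lemma rho_psAct_dPR {N : I → ℤ → ℤ} {R : I → ℤ → ℤ → ℤ} {Z : (I × ℤ) × ℤ × ℤ → M}
    (hZ : Z ∈ cls N R) (e : ℤ) (h : PowerSeries ℂ) :
    rho e (psAct dPR h Z) = ∑ b ∈ Finset.range (e.toNat + 1),
      psAct dR1 (PowerSeries.mk fun a => ((a + b).choose a : ℂ) * PowerSeries.coeff (a + b) h)
        (rho (e - b) Z) := by
  ext k
  rw [rho_eq_tauN_of_cls (psAct_mem_cls dPR_mem_cls hZ h),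
    psAct_rowFinite_sum (nullFam_dPR hZ) (rowFinite_tauN _ _), Finset.sum_apply]
  choose L hL using fun b : ℕ => nullFam_rho hZ (e - b) k
  let f : ℕ × ℕ → M := fun x => (((x.1 + x.2).choose x.1 : ℂ) * PowerSeries.coeff (x.1 + x.2) h) •
    (dR1 ^ x.1) (rho (e - x.2) Z) k
  have hf : ∀ a b, (Finset.range (e.toNat + 1)).sup L ≤ a ∨ e.toNat + 1 ≤ b → f (a, b) = 0 := by
    intro a b hab
    by_cases hb : e.toNat + 1 ≤ b
    · simp [f, rho_of_cls_neg hZ (show e - b < 0 by omega)]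
    · have : L b ≤ a := (Finset.le_sup (Finset.mem_range.2 (by omega))).trans
        (hab.resolve_right hb)
      simp [f, hL b a this]
  rw [show (∑ b ∈ Finset.range (e.toNat + 1), psAct dR1 (PowerSeries.mk fun a =>
      ((a + b).choose a : ℂ) * PowerSeries.coeff (a + b) h) (rho (e - b) Z) k) =
      ∑ b ∈ Finset.range (e.toNat + 1), ∑ᶠ a, f (a, b) by
    simp only [psAct, PowerSeries.coeff_mk, f], ← finsum_antidiagonal f hf]
  refine finsum_congr fun n => ?_
  rw [← rho_eq_tauN_of_cls (pow_mem_cls dPR_mem_cls hZ n), rho_dPR_pow (cls_le_dom hZ),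
    Finset.sum_apply, Finset.smul_sum]
  refine Finset.sum_congr rfl fun x hx => ?_
  rw [Finset.HasAntidiagonal.mem_antidiagonal] at hx
  simp only [f, hx, Pi.smul_apply, smul_smul]
  rw [mul_comm]

end Dong

end NVA

namespace NVA

section DongCore

section PSMore

variable {K M : Type*} [AddCommGroup M] [Module ℂ M] {D : Module.End ℂ (K → M)} {X : Set (K → M)}

lemma PS_psAct_mem (hX : ∀ F ∈ X, NullFam D F) (hD : RowFinite D) (g : PowerSeries ℂ) {F : K → M}
    (hF : F ∈ PS D X) : psAct D g F ∈ PS D X := by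
  refine (PS_induction (p := fun F => NullFam D F ∧ psAct D g F ∈ PS D X)
    ⟨nullFam_zero, by simp [psAct_zero]⟩ ?_ ?_ ?_ hF).2
  · rintro F G ⟨h1, h2⟩ ⟨h3, h4⟩
    exact ⟨h1.add h3, by rw [psAct_add h1 h3]; exact add_mem h2 h4⟩
  · rintro c F ⟨h1, h2⟩
    exact ⟨h1.smul c, by rw [psAct_smul h1]; exact Submodule.smul_mem _ _ h2⟩
  · intro h G hG
    exact ⟨(hX G hG).psAct hD h, by rw [← psAct_mul hD (hX G hG)]; exact psAct_mem_PS _ hG⟩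

lemma psAct_span_mem (hX : ∀ F ∈ X, NullFam D F) (hD : RowFinite D) (g : PowerSeries ℂ) {F : K → M}
    (hF : F ∈ Submodule.span ℂ X) : psAct D g F ∈ PS D X :=
  PS_psAct_mem hX hD g (Submodule.span_le.2 (fun _ h => mem_PS h) hF)

lemma PS_pow_mem_of_le (hX : ∀ F ∈ X, NullFam D F) (hD : RowFinite D) {F : K → M} {m n : ℕ}
    (hF : (D ^ m) F ∈ PS D X) (h : m ≤ n) : (D ^ n) F ∈ PS D X := by
  obtain ⟨k, rfl⟩ := Nat.exists_eq_add_of_le' h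
  rw [pow_add, Module.End.mul_apply]
  exact PS_pow_mem hX hD k hF

end PSMore

variable {I M : Type*} [AddCommGroup M] [Module ℂ M]

/-- Membership in one of the classes `cls N R`. -/
def IsCls (Z : (I × ℤ) × ℤ × ℤ → M) : Prop := ∃ N R, Z ∈ cls N R

lemma IsCls.dd_pow {Z : (I × ℤ) × ℤ × ℤ → M} {K K' : ℕ} (h : IsCls ((dd ^ K) Z)) (hK : K ≤ K') :
    IsCls ((dd ^ K') Z) := by
  obtain ⟨N, R, h⟩ := h
  obtain ⟨n, rfl⟩ := Nat.exists_eq_add_of_le' hK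
  refine ⟨N, R, ?_⟩
  rw [pow_add, Module.End.mul_apply]
  exact pow_mem_cls dd_mem_cls h n

/-- Pointwise truncation conditions ensuring membership in a class `cls N R`. -/
lemma isCls_of {Z : (I × ℤ) × ℤ × ℤ → M} (N : I → ℤ)
    (h1 : ∀ i r p q, p < N i ∨ q < N i → Z ((i, r), p, q) = 0)
    (h2 : ∀ i p q, ∃ R : ℤ, ∀ r < R, Z ((i, r), p, q) = 0) : IsCls Z := by
  choose R hR using h2
  choose R' hR' using fun i (p q : ℤ) =>
    ((Finset.Icc (N i) p ×ˢ Finset.Icc (N i) q).image fun x => R i x.1 x.2).bddBelow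
  refine ⟨fun i _ => N i, R', fun i r r' _ p q h => h1 i r' p q h,
    fun i p q r p' q' hr hp hq => ?_⟩
  by_cases h : p' < N i ∨ q' < N i
  · exact h1 i r p' q' h
  · push Not at h
    refine hR i p' q' r (hr.trans_le (hR' i p q ?_))
    exact Finset.mem_coe.2 (Finset.mem_image.2 ⟨(p', q'), by simp; omega, rfl⟩)

lemma rho_descent_dPR {F : (I × ℤ) × ℤ × ℤ → M} (hF : F ∈ dom)
    {P : Submodule ℂ ((I × ℤ) × ℤ → M)} (hP : ∀ n, ∀ G ∈ P, (dR1 ^ n) G ∈ P)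
    (h : ∀ e, ∃ L : ℕ, (dR1 ^ L) (rho e (dPR F)) ∈ P) (e : ℤ) :
    ∃ L : ℕ, (dR1 ^ L) (rho e F) ∈ P := by
  have hF' := hF
  obtain ⟨K, N, hKN⟩ := hF'
  have key : ∀ n : ℕ, ∃ L : ℕ, (dR1 ^ L) (rho (n - K - 1) F) ∈ P := by
    intro n
    induction n with
    | zero => exact ⟨0, by rw [rho_eq_zero_of_lt hKN (by push_cast; omega)]; simp⟩
    | succ n ih =>
      obtain ⟨L, hL⟩ := ih
      obtain ⟨L', hL'⟩ := h ((n + 1 : ℕ) - K - 1)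
      refine ⟨L + L' + 1, ?_⟩
      have h1 : dR1 (rho ((n + 1 : ℕ) - K - 1) F) =
          rho ((n + 1 : ℕ) - K - 1) (dPR F) - rho (n - K - 1) F := by
        rw [rho_dPR hF, show (((n + 1 : ℕ) : ℤ) - K - 1 - 1) = n - K - 1 by push_cast; ring]
        abel
      rw [pow_succ, Module.End.mul_apply, h1, map_sub]
      refine sub_mem ?_ ?_
      · rw [pow_add, Module.End.mul_apply]; exact hP _ _ hL'
      · rw [add_comm, pow_add, Module.End.mul_apply]; exact hP _ _ hL
  by_cases he : (K : ℤ) + e < 0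
  · exact ⟨0, by rw [rho_eq_zero_of_lt hKN he]; simp⟩
  · obtain ⟨L, hL⟩ := key (K + e + 1).toNat
    exact ⟨L, by rwa [show (((K + e + 1).toNat : ℤ) - K - 1) = e by omega] at hL⟩

lemma rho_descent_dQR {F : (I × ℤ) × ℤ × ℤ → M} (hF : F ∈ dom)
    {P : Submodule ℂ ((I × ℤ) × ℤ → M)}
    (h : ∀ e, ∃ L : ℕ, (dR1 ^ L) (rho e (dQR F)) ∈ P) (e : ℤ) :
    ∃ L : ℕ, (dR1 ^ L) (rho e F) ∈ P := by
  obtain ⟨L, hL⟩ := h e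
  refine ⟨L + 1, ?_⟩
  rwa [rho_dQR hF, ← Module.End.mul_apply, ← pow_succ] at hL

/-- One of the two differences with the parameter variable. -/
def IsDir (D : Module.End ℂ ((I × ℤ) × ℤ × ℤ → M)) : Prop := D = dPR ∨ D = dQR

section IsDir

variable {D : Module.End ℂ ((I × ℤ) × ℤ × ℤ → M)}

lemma IsDir.rowFinite (hD : IsDir D) : RowFinite D := by
  rcases hD with rfl | rfl
  exacts [rowFinite_dPR, rowFinite_dQR]

lemma IsDir.mem_cls (hD : IsDir D) {N : I → ℤ → ℤ} {R : I → ℤ → ℤ → ℤ} (Z : (I × ℤ) × ℤ × ℤ → M)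
    (hZ : Z ∈ cls N R) : D Z ∈ cls N R := by
  rcases hD with rfl | rfl
  exacts [dPR_mem_cls Z hZ, dQR_mem_cls Z hZ]

lemma IsDir.nullFam (hD : IsDir D) {N : I → ℤ → ℤ} {R : I → ℤ → ℤ → ℤ} {Z : (I × ℤ) × ℤ × ℤ → M}
    (hZ : Z ∈ cls N R) : NullFam D Z := by
  rcases hD with rfl | rfl
  exacts [nullFam_dPR hZ, nullFam_dQR hZ]

lemma IsDir.comm (hD : IsDir D) {D' : Module.End ℂ ((I × ℤ) × ℤ × ℤ → M)} (hD' : IsDir D')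
    (F : (I × ℤ) × ℤ × ℤ → M) : D (D' F) = D' (D F) := by
  rcases hD with rfl | rfl <;> rcases hD' with rfl | rfl
  exacts [rfl, dPR_dQR F, (dPR_dQR F).symm, rfl]

lemma IsDir.dd_comm (hD : IsDir D) (F : (I × ℤ) × ℤ × ℤ → M) : dd (D F) = D (dd F) := by
  rcases hD with rfl | rfl
  exacts [dd_dPR F, dd_dQR F]

lemma IsDir.pow_mem_dom (hD : IsDir D) {F : (I × ℤ) × ℤ × ℤ → M} (hF : F ∈ dom) (n : ℕ) :
  (D ^ n) F ∈ dom := by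
  rcases hD with rfl | rfl
  exacts [dPR_pow_mem_dom hF n, dQR_pow_mem_dom hF n]

lemma IsDir.descent (hD : IsDir D) {F : (I × ℤ) × ℤ × ℤ → M} (hF : F ∈ dom)
    {P : Submodule ℂ ((I × ℤ) × ℤ → M)} (hP : ∀ n, ∀ G ∈ P, (dR1 ^ n) G ∈ P) (n : ℕ)
    (h : ∀ e, ∃ L : ℕ, (dR1 ^ L) (rho e ((D ^ n) F)) ∈ P) (e : ℤ) :
    ∃ L : ℕ, (dR1 ^ L) (rho e F) ∈ P := by
  induction n generalizing e with
  | zero => simpa using h e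
  | succ n ih =>
    refine ih (fun e => ?_) e
    simp only [pow_succ', Module.End.mul_apply] at h
    have hn := hD.pow_mem_dom hF n
    rcases hD with rfl | rfl
    exacts [rho_descent_dPR hn hP h e, rho_descent_dQR hn h e]

lemma IsDir.rho_psAct_mem (hD : IsDir D) {X : Set ((I × ℤ) × ℤ → M)} (hX : ∀ G ∈ X, NullFam dR1 G)
    {N : I → ℤ → ℤ} {R : I → ℤ → ℤ → ℤ} {Z : (I × ℤ) × ℤ × ℤ → M} (hZ : Z ∈ cls N R)
    (h : ∀ e, rho e Z ∈ PS dR1 X) (g : PowerSeries ℂ) (e : ℤ) : rho e (psAct D g Z) ∈ PS dR1 X := by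
  rcases hD with rfl | rfl
  · rw [rho_psAct_dPR hZ]
    exact sum_mem fun b _ => PS_psAct_mem hX rowFinite_dR1 _ (h _)
  · rw [rho_psAct_dQR hZ]
    exact PS_psAct_mem hX rowFinite_dR1 _ (h _)

end IsDir

lemma nullFam_rho_of {Z : (I × ℤ) × ℤ × ℤ → M} (h : ∃ K : ℕ, IsCls ((dd ^ K) Z)) (i : ℤ) :
    NullFam dR1 (rho i Z) := by
  obtain ⟨K, N, R, h⟩ := h
  have := nullFam_rho h (i + K)
  rwa [rho_dd_pow (mem_dom_of_dd_pow (cls_le_dom h)), add_sub_cancel_right] at this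

/-- Residue products preserve exchange relations: the abstract form of Dong's lemma. -/
theorem dong {D₁ D₂ : Module.End ℂ ((I × ℤ) × ℤ × ℤ → M)} (h₁ : IsDir D₁) (h₂ : IsDir D₂)
    {F : (I × ℤ) × ℤ × ℤ → M} (hF : F ∈ dom) {𝒢 𝒮 : Set ((I × ℤ) × ℤ × ℤ → M)}
    (hG : ∀ Z ∈ 𝒢, ∃ K : ℕ, IsCls ((dd ^ K) Z)) (hGn : ∀ Z ∈ 𝒢, NullFam D₂ Z)
    (hSn : ∀ X ∈ 𝒮, NullFam D₁ X) (hS : ∀ X ∈ 𝒮, ∃ k : ℕ, (D₂ ^ k) X ∈ PS D₂ 𝒢)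
    (hFS : ∃ k : ℕ, (D₁ ^ k) F ∈ PS D₁ 𝒮) (e : ℤ) :
    ∃ L : ℕ, (dR1 ^ L) (rho e F) ∈ PS dR1 {G | ∃ i, ∃ Z ∈ 𝒢, G = rho i Z} := by
  set P := PS (dR1 : Module.End ℂ ((I × ℤ) × ℤ → M)) {G | ∃ i, ∃ Z ∈ 𝒢, G = rho i Z} with hPdef
  let 𝒯 : Set ((I × ℤ) × ℤ × ℤ → M) :=
    {T | ∃ h, ∃ Z ∈ 𝒢, ∃ K : ℕ, IsCls ((dd ^ K) Z) ∧ T = psAct D₂ h ((dd ^ K) Z)}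
  have hdom : ∀ Z ∈ 𝒢, Z ∈ dom := by
    intro Z hZ
    obtain ⟨K, N, R, h⟩ := hG Z hZ
    exact mem_dom_of_dd_pow (cls_le_dom h)
  have hTn : ∀ T ∈ 𝒯, NullFam D₁ T := by
    rintro _ ⟨h, Z, hZ, K, ⟨N, R, hc⟩, rfl⟩
    exact h₁.nullFam (psAct_mem_cls h₂.mem_cls hc h)
  have hgen : ∀ G ∈ {G : (I × ℤ) × ℤ → M | ∃ i, ∃ Z ∈ 𝒢, G = rho i Z}, NullFam dR1 G := by
    rintro _ ⟨i, Z, hZ, rfl⟩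
    exact nullFam_rho_of (hG Z hZ) i
  have hP : ∀ n, ∀ G ∈ P, (dR1 ^ n) G ∈ P := fun n G hG => PS_pow_mem hgen rowFinite_dR1 n hG
  have hQ : ∀ Y ∈ PS D₁ 𝒯, ∀ e, rho e Y ∈ P := by
    intro Y hY e
    refine PS_induction (p := fun Y => rho e Y ∈ P) (by simp) (fun _ _ h h' => by
      rw [map_add]; exact add_mem h h') (fun c _ h => by
      rw [map_smul]; exact Submodule.smul_mem _ _ h) (fun g T hT => ?_) hY
    obtain ⟨h, Z, hZ, K, ⟨N, R, hc⟩, rfl⟩ := hT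
    refine h₁.rho_psAct_mem hgen (psAct_mem_cls h₂.mem_cls hc h)
      (h₂.rho_psAct_mem hgen hc (fun e => mem_PS ⟨e - K, Z, hZ, ?_⟩) h) g e
    rw [rho_dd_pow (hdom Z hZ)]
  have hcomm : ∀ K k : ℕ, ∀ H : (I × ℤ) × ℤ × ℤ → M,
      (dd ^ K) ((D₂ ^ k) (D₁ H)) = D₁ ((dd ^ K) ((D₂ ^ k) H)) := by
    intro K k H
    rw [← pow_intertwine (T := D₁) (h₁.comm h₂),
      ← pow_intertwine (T := D₁) (fun H => (h₁.dd_comm H).symm)]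
  have hcomm' : ∀ K : ℕ, ∀ H : (I × ℤ) × ℤ × ℤ → M, (dd ^ K) (D₂ H) = D₂ ((dd ^ K) H) := by
    intro K H
    rw [← pow_intertwine (T := D₂) (fun H => (h₂.dd_comm H).symm)]
  have h1 : ∀ Y ∈ PS D₂ 𝒢, ∃ K₀ : ℕ, ∀ K, K₀ ≤ K → (dd ^ K) Y ∈ Submodule.span ℂ 𝒯 := by
    intro Y hY
    refine PS_induction (p := fun Y => ∃ K₀ : ℕ, ∀ K, K₀ ≤ K → (dd ^ K) Y ∈ Submodule.span ℂ 𝒯)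
      ⟨0, by simp⟩ ?_ ?_ ?_ hY
    · rintro F G ⟨K, h⟩ ⟨K', h'⟩
      exact ⟨max K K', fun n hn => by
        rw [map_add]
        exact add_mem (h n (le_of_max_le_left hn)) (h' n (le_of_max_le_right hn))⟩
    · rintro c F ⟨K, h⟩
      exact ⟨K, fun n hn => by rw [map_smul]; exact Submodule.smul_mem _ _ (h n hn)⟩
    · intro g Z hZ
      obtain ⟨K, hK⟩ := hG Z hZ
      refine ⟨K, fun n hn => Submodule.subset_span ⟨g, Z, hZ, n, hK.dd_pow hn, ?_⟩⟩
      exact psAct_map (hGn Z hZ) (rowFinite_dd.pow n) (hcomm' n) g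
  have h2 : ∀ Y ∈ PS D₁ 𝒮, ∃ k₀ : ℕ, ∀ k, k₀ ≤ k → ∃ K₀ : ℕ, ∀ K, K₀ ≤ K →
      (dd ^ K) ((D₂ ^ k) Y) ∈ PS D₁ 𝒯 := by
    intro Y hY
    refine PS_induction (p := fun Y => ∃ k₀ : ℕ, ∀ k, k₀ ≤ k → ∃ K₀ : ℕ, ∀ K, K₀ ≤ K →
      (dd ^ K) ((D₂ ^ k) Y) ∈ PS D₁ 𝒯) ⟨0, fun _ _ => ⟨0, by simp⟩⟩ ?_ ?_ ?_ hY
    · rintro F G ⟨K, h⟩ ⟨K', h'⟩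
      refine ⟨max K K', fun k hk => ?_⟩
      obtain ⟨L, hL⟩ := h k (le_of_max_le_left hk)
      obtain ⟨L', hL'⟩ := h' k (le_of_max_le_right hk)
      exact ⟨max L L', fun n hn => by
        rw [map_add, map_add]
        exact add_mem (hL n (le_of_max_le_left hn)) (hL' n (le_of_max_le_right hn))⟩
    · rintro c F ⟨K, h⟩
      refine ⟨K, fun k hk => ?_⟩
      obtain ⟨L, hL⟩ := h k hk
      exact ⟨L, fun n hn => by
        rw [map_smul, map_smul]; exact Submodule.smul_mem _ _ (hL n hn)⟩
    · intro g X hX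
      obtain ⟨k₀, hk₀⟩ := hS X hX
      refine ⟨k₀, fun k hk => ?_⟩
      obtain ⟨K₀, hK₀⟩ := h1 _ (PS_pow_mem_of_le hGn h₂.rowFinite hk₀ hk)
      refine ⟨K₀, fun K hK => ?_⟩
      have := psAct_map (hSn X hX) (T := (dd ^ K) ∘ₗ (D₂ ^ k))
        ((rowFinite_dd.pow K).comp (h₂.rowFinite.pow k)) (hcomm K k) g
      simp only [LinearMap.comp_apply] at this
      rw [this]
      exact psAct_span_mem hTn h₁.rowFinite g (hK₀ K hK)
  obtain ⟨k, hk⟩ := hFS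
  obtain ⟨k', h⟩ := h2 _ hk
  obtain ⟨K, h⟩ := h k' le_rfl
  refine h₁.descent hF hP k (h₂.descent (h₁.pow_mem_dom hF k) hP k' fun e => ⟨0, ?_⟩) e
  have := hQ _ (h K le_rfl) (e + K)
  rw [rho_dd_pow (h₂.pow_mem_dom (h₁.pow_mem_dom hF k) k'), add_sub_cancel_right] at this
  simpa

end DongCore

end NVA

namespace NVA

/-! ### Multiplication by expansions of Laurent series -/

section SmulExp

variable {J M : Type*} [AddCommGroup M] [Module ℂ M]

/-- The family `ι_{x₂,x₁} f(x₂ - x₁) G`. -/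
def smulJ (f : LC) (G : J × ℤ × ℤ → M) : J × ℤ × ℤ → M :=
  fun k => smulFam (expandSub f) (fun m t => G (k.1, m, t)) k.2.1 k.2.2

/-- Families lying in `M((x₂))((x₁))`. -/
def IterTrunc (G : J × ℤ × ℤ → M) : Prop :=
  (∀ j, ∃ N : ℤ, ∀ p < N, ∀ q, G (j, p, q) = 0) ∧ ∀ j p, ∃ N : ℤ, ∀ q < N, G (j, p, q) = 0

lemma IterTrunc.dd_null {J M : Type*} [AddCommGroup M] {G : J × ℤ × ℤ → M}
    (hG : IterTrunc G) (k : J × ℤ × ℤ) :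
    ∃ L : ℕ, ∀ a b : ℕ, L ≤ a + b → G (k.1, k.2.1 - a, k.2.2 - b) = 0 := by
  obtain ⟨j, p, q⟩ := k
  obtain ⟨N, hN⟩ := hG.1 j
  choose R hR using hG.2 j
  obtain ⟨B, hB⟩ := ((Finset.Icc N p).image R).bddBelow
  refine ⟨(p - N).toNat + 1 + ((q - B).toNat + 1), fun a b hab => ?_⟩
  by_cases ha : p - a < N
  · exact hN _ ha _
  · refine hR (p - a) _ (lt_of_lt_of_le ?_ (hB (Finset.mem_coe.2 (Finset.mem_image.2
      ⟨p - a, Finset.mem_Icc.2 ⟨by omega, by omega⟩, rfl⟩))))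
    simp only
    omega

lemma IterTrunc.nullFam {G : J × ℤ × ℤ → M} (hG : IterTrunc G) : NullFam dd G := by
  refine nullFam_sub_of (A := shP) (B := shQ) (fun F => rfl) fun k => ?_
  obtain ⟨L, hL⟩ := hG.dd_null k
  refine ⟨L, fun a b hab => ?_⟩
  rw [shP_pow_apply, shQ_pow_apply]
  exact hL a b hab

lemma expandSub_of_neg (f : LC) {m : ℤ} (hm : m < 0) (t : ℤ) : expandSub f m t = 0 :=
  if_neg (by omega)

lemma IterTrunc.smul_support {G : J × ℤ × ℤ → M} (hG : IterTrunc G) (c : ℤ → ℤ → ℂ)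
    (hc : ∀ m t, m < 0 → c m t = 0) {n : ℤ} (hf : ∀ m t, m + t < n → c m t = 0) (k : J × ℤ × ℤ) :
    (Function.support fun s : ℤ × ℤ => c s.1 s.2 • G (k.1, k.2.1 - s.1, k.2.2 - s.2)).Finite := by
  obtain ⟨j, p, q⟩ := k
  obtain ⟨N, hN⟩ := hG.1 j
  choose R hR using hG.2 j
  refine (((Finset.Icc 0 (p - N)).sigma fun m =>
    Finset.Icc (n - m) (q - R (p - m))).finite_toSet.image fun x => (x.1, x.2)).subset ?_
  rintro ⟨m, t⟩ h
  rw [Function.mem_support] at h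
  have h1 : ¬ m < 0 := fun h' => h (by simp [hc m t h'])
  have h2 : ¬ m + t < n := fun h' => h (by simp [hf m t h'])
  have h3 : ¬ p - m < N := fun h' => h (by simp [hN _ h'])
  have h4 : ¬ q - t < R (p - m) := fun h' => h (by simp [hR _ _ h'])
  refine ⟨⟨m, t⟩, ?_, rfl⟩
  simp only [Finset.coe_sigma, Set.mem_sigma_iff, Finset.mem_coe, Finset.mem_Icc]
  omega

lemma coeff_X_mul_LC (f : LC) (n : ℤ) :
    (HahnSeries.single (1 : ℤ) (1 : ℂ) * f : LC).coeff n = f.coeff (n - 1) := by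
  have := HahnSeries.coeff_single_mul_add (r := (1 : ℂ)) (x := f) (a := n - 1) (b := (1 : ℤ))
  rwa [sub_add_cancel, one_mul] at this

lemma expandSub_X_mul (f : LC) (m t : ℤ) :
    expandSub (HahnSeries.single (1 : ℤ) (1 : ℂ) * f : LC) m t =
      expandSub f m (t - 1) - expandSub f (m - 1) t := by
  have hc : ∀ n : ℤ, (HahnSeries.single (1 : ℤ) (1 : ℂ) * f : LC).coeff n = f.coeff (n - 1) :=
    coeff_X_mul_LC f
  rcases lt_trichotomy m 0 with h | rfl | h
  · rw [expandSub_of_neg _ h, expandSub_of_neg _ h, expandSub_of_neg _ (by omega), sub_zero]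
  · rw [expandSub_of_neg f (show (0 : ℤ) - 1 < 0 by omega)]
    simp [expandSub, hc, binom]
  · obtain ⟨k, rfl⟩ : ∃ k : ℕ, m = k + 1 := ⟨(m - 1).toNat, by omega⟩
    have e1 : ((k : ℤ) + 1).toNat = k + 1 := by omega
    have e2 : ((k : ℤ) + 1 - 1).toNat = k := by omega
    have hp := bz_succ (t + k) (k + 1)
    rw [show ((k : ℤ) + 1 - 1) = ((k : ℕ) : ℤ) by omega,
      show ((k : ℤ) + 1) = ((k + 1 : ℕ) : ℤ) by push_cast; rfl, bz_natCast, bz_natCast,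
      bz_natCast] at hp
    simp only [expandSub, if_pos (show (0 : ℤ) ≤ k + 1 by omega), e1, e2,
      if_pos (show (0 : ℤ) ≤ k + 1 - 1 by omega), hc]
    rw [show t - 1 + ((k : ℤ) + 1) = t + k by ring, show t + ((k : ℤ) + 1) = t + k + 1 by ring,
      show t + ((k : ℤ) + 1 - 1) = t + k by ring, hp, show t + (k : ℤ) + 1 - 1 = t + k by ring]
    ring

lemma exists_coeff_eq_zero (f : LC) : ∃ n : ℤ, ∀ m < n, f.coeff m = 0 :=
  ⟨f.order, fun _ h => HahnSeries.coeff_eq_zero_of_lt_order h⟩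

lemma neg_dd_smulJ (f : LC) {G : J × ℤ × ℤ → M} (hG : IterTrunc G) :
    (-dd) (smulJ f G) = smulJ (HahnSeries.single (1 : ℤ) (1 : ℂ) * f) G := by
  obtain ⟨n, hn⟩ := exists_coeff_eq_zero f
  ext ⟨j, p, q⟩
  have hf : ∀ m t, m + t < n → expandSub f m t = 0 := by
    intro m t h
    rw [expandSub, hn _ (by omega : t + m < n)]
    simp
  have h1 : smulJ f G (j, p, q - 1) =
      ∑ᶠ s : ℤ × ℤ, expandSub f s.1 (s.2 - 1) • G (j, p - s.1, q - s.2) := by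
    refine (finsum_comp_equiv (((Equiv.refl ℤ).prodCongr (Equiv.subRight (1 : ℤ))))).symm.trans ?_
    refine finsum_congr fun s => ?_
    simp only [Equiv.prodCongr_apply, Prod.map, Equiv.refl_apply, Equiv.subRight_apply]
    rw [show q - 1 - (s.2 - 1) = q - s.2 by ring]
  have h2 : smulJ f G (j, p - 1, q) =
      ∑ᶠ s : ℤ × ℤ, expandSub f (s.1 - 1) s.2 • G (j, p - s.1, q - s.2) := by
    refine (finsum_comp_equiv (((Equiv.subRight (1 : ℤ)).prodCongr (Equiv.refl ℤ)))).symm.trans ?_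
    refine finsum_congr fun s => ?_
    simp only [Equiv.prodCongr_apply, Prod.map, Equiv.refl_apply, Equiv.subRight_apply]
    rw [show p - 1 - (s.1 - 1) = p - s.1 by ring]
  have h3 : (-dd) (smulJ f G) (j, p, q) = smulJ f G (j, p, q - 1) - smulJ f G (j, p - 1, q) := by
    simp [dd]
  rw [h3, h1, h2, ← finsum_sub_distrib]
  · refine finsum_congr fun s => ?_
    simp only
    rw [expandSub_X_mul, sub_smul]
  · exact hG.smul_support (fun m t => expandSub f m (t - 1))
      (fun m t h => expandSub_of_neg f h _) (n := n + 1) (fun m t h => hf _ _ (by omega)) (j, p, q)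
  · exact hG.smul_support (fun m t => expandSub f (m - 1) t)
      (fun m t h => expandSub_of_neg f (by omega) _) (n := n + 1) (fun m t h => hf _ _ (by omega))
      (j, p, q)

lemma neg_dd_pow_smulJ (n : ℕ) (f : LC) {G : J × ℤ × ℤ → M} (hG : IterTrunc G) :
    ((-dd) ^ n) (smulJ f G) = smulJ (HahnSeries.single (1 : ℤ) (1 : ℂ) ^ n * f) G := by
  induction n generalizing f with
  | zero => rw [pow_zero, pow_zero, one_mul]; rfl
  | succ n ih =>
    rw [pow_succ, Module.End.mul_apply, neg_dd_smulJ f hG, ih, ← mul_assoc, ← pow_succ]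

lemma neg_dd_pow_apply (n : ℕ) (F : J × ℤ × ℤ → M) (k : J × ℤ × ℤ) :
    ((-dd) ^ n) F k = ∑ x ∈ Finset.HasAntidiagonal.antidiagonal n,
      ((-1) ^ x.1 * (n.choose x.1 : ℂ)) • F (k.1, k.2.1 - x.1, k.2.2 - x.2) := by
  have hc : Commute (-shP : Module.End ℂ (J × ℤ × ℤ → M)) shQ := LinearMap.ext fun F => rfl
  rw [dd, show -(shP - shQ : Module.End ℂ (J × ℤ × ℤ → M)) = -shP + shQ by abel, hc.add_pow',
    LinearMap.sum_apply, Finset.sum_apply]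
  refine Finset.sum_congr rfl fun x _ => ?_
  rw [LinearMap.smul_apply, Module.End.mul_apply, ← neg_one_smul ℂ shP, smul_pow,
    LinearMap.smul_apply, Pi.smul_apply, Pi.smul_apply, shP_pow_apply, shQ_pow_apply,
    ← Nat.cast_smul_eq_nsmul ℂ, smul_smul, mul_comm]

lemma binom_natCast_eq (n k : ℕ) : binom n k = (n.choose k : ℂ) := by
  induction n generalizing k with
  | zero =>
    cases k with
    | zero => simp [binom]
    | succ k => simp [binom, Finset.prod_range_succ']
  | succ n ih =>
    cases k with
    | zero => simp [binom]
    | succ k =>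
      rw [Nat.cast_succ, binom_succ_succ, ih, ih, Nat.choose_succ_succ, Nat.cast_add]
      ring

lemma smulJ_ofPowerSeries (g : PowerSeries ℂ) {G : J × ℤ × ℤ → M} (hG : IterTrunc G) :
    smulJ (HahnSeries.ofPowerSeries ℤ ℂ g) G = psAct (-dd) g G := by
  ext k
  obtain ⟨L, hL⟩ := hG.dd_null k
  let ψ : ℕ × ℕ → M := fun x => (PowerSeries.coeff (x.1 + x.2) g *
    ((-1) ^ x.1 * ((x.1 + x.2).choose x.1 : ℂ))) • G (k.1, k.2.1 - x.1, k.2.2 - x.2)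
  have h1 : psAct (-dd) g G k = ∑ b ∈ Finset.range L, ∑ᶠ a, ψ (a, b) := by
    rw [← finsum_antidiagonal ψ (A := L) fun a b h =>
      by simp only [ψ]; rw [hL a b (by omega), smul_zero]]
    refine finsum_congr fun n => ?_
    rw [neg_dd_pow_apply, Finset.smul_sum]
    refine Finset.sum_congr rfl fun x hx => ?_
    rw [Finset.HasAntidiagonal.mem_antidiagonal] at hx
    simp only [ψ, hx, smul_smul]
  have h2 : ∀ b, ∑ᶠ a, ψ (a, b) = ∑ a ∈ Finset.range L, ψ (a, b) := fun b =>
    finsum_nat_eq_sum_range _ L fun a ha => by simp only [ψ]; rw [hL a b (by omega), smul_zero]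
  rw [h1]
  simp only [h2]
  rw [Finset.sum_comm, ← Finset.sum_product']
  have hcoef : ∀ s : ℤ × ℤ, expandSub (HahnSeries.ofPowerSeries ℤ ℂ g) s.1 s.2 ≠ 0 →
      ∃ x : ℕ × ℕ, s = ((x.1 : ℤ), (x.2 : ℤ)) := by
    rintro ⟨m, t⟩ h
    have hm : ¬ m < 0 := fun h' => h (expandSub_of_neg _ h' _)
    obtain ⟨a, rfl⟩ := Int.eq_ofNat_of_zero_le (not_lt.1 hm)
    by_cases h0 : t + (a : ℤ) < 0
    · refine absurd ?_ h
      have : (HahnSeries.ofPowerSeries ℤ ℂ g).coeff (t + a) = 0 := by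
        rw [HahnSeries.ofPowerSeries_apply]
        refine HahnSeries.embDomain_of_notMem_range ?_
        rintro ⟨n, hn⟩
        simp at hn
        omega
      simp [expandSub, this]
    · obtain ⟨n, hn⟩ := Int.eq_ofNat_of_zero_le (not_lt.1 h0)
      by_cases ht : 0 ≤ t
      · exact ⟨(a, t.toNat), by simp [ht]⟩
      · refine absurd ?_ h
        simp only [expandSub, hn]
        rw [binom_natCast_eq, Nat.choose_eq_zero_of_lt (by simp; omega)]
        simp
  have hval : ∀ x : ℕ × ℕ, expandSub (HahnSeries.ofPowerSeries ℤ ℂ g) x.1 x.2 =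
      PowerSeries.coeff (x.1 + x.2) g * ((-1) ^ x.1 * ((x.1 + x.2).choose x.1 : ℂ)) := by
    intro x
    simp only [expandSub, if_pos (Int.natCast_nonneg x.1), Int.toNat_natCast]
    rw [show (x.2 : ℤ) + x.1 = ((x.1 + x.2 : ℕ) : ℤ) by push_cast; ring, binom_natCast_eq,
      HahnSeries.ofPowerSeries_apply_coeff, mul_comm]
  have hinj : Function.Injective fun x : ℕ × ℕ => ((x.1 : ℤ), (x.2 : ℤ)) := by
    rintro ⟨a, b⟩ ⟨c, d⟩ h
    simpa using h
  refine (finsum_eq_sum_of_support_subset _ (s := (Finset.range L ×ˢ Finset.range L).map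
    ⟨_, hinj⟩) ?_).trans ?_
  · intro s hs
    rw [Function.mem_support] at hs
    obtain ⟨x, rfl⟩ := hcoef s fun h => hs (by rw [h, zero_smul])
    simp only [Finset.coe_map, Function.Embedding.coeFn_mk]
    refine ⟨x, ?_, rfl⟩
    by_contra hx
    simp only [Finset.coe_product, Finset.coe_range, Set.mem_prod, Set.mem_Iio] at hx
    exact hs (by simp only; rw [hL x.1 x.2 (by omega), smul_zero])
  · rw [Finset.sum_map]
    refine Finset.sum_congr rfl fun x _ => ?_
    simp only [Function.Embedding.coeFn_mk, ψ]
    rw [hval]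

lemma neg_dd_pow_smulJ_eq {n : ℕ} {f : LC} {g : PowerSeries ℂ}
    (h : HahnSeries.single (1 : ℤ) (1 : ℂ) ^ n * f = HahnSeries.ofPowerSeries ℤ ℂ g)
    {G : J × ℤ × ℤ → M} (hG : IterTrunc G) : ((-dd) ^ n) (smulJ f G) = psAct (-dd) g G := by
  rw [neg_dd_pow_smulJ n f hG, h, smulJ_ofPowerSeries g hG]

lemma exists_powerSeries_mul (f : LC) : ∃ M : ℕ, ∀ n, M ≤ n → ∃ g : PowerSeries ℂ,
    (HahnSeries.single (1 : ℤ) (1 : ℂ) ^ n * f : LC) = HahnSeries.ofPowerSeries ℤ ℂ g := by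
  obtain ⟨N, hN⟩ := exists_coeff_eq_zero f
  refine ⟨(-N).toNat, fun n hn => ?_⟩
  have hc : ∀ m : ℤ, (HahnSeries.single (1 : ℤ) (1 : ℂ) ^ n * f : LC).coeff m =
    f.coeff (m - n) := by
    intro m
    rw [HahnSeries.single_pow, one_pow, nsmul_eq_mul, mul_one]
    have := HahnSeries.coeff_single_mul_add (r := (1 : ℂ)) (x := f) (a := m - n) (b := (n : ℤ))
    rwa [sub_add_cancel, one_mul] at this
  refine ⟨PowerSeries.mk fun m => f.coeff (m - n), ?_⟩
  ext m
  rw [hc]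
  by_cases hm : 0 ≤ m
  · obtain ⟨m, rfl⟩ := Int.eq_ofNat_of_zero_le hm
    rw [HahnSeries.ofPowerSeries_apply_coeff, PowerSeries.coeff_mk]
  · rw [hN _ (by omega), HahnSeries.ofPowerSeries_apply, HahnSeries.embDomain_of_notMem_range]
    rintro ⟨n, hn⟩
    simp at hn
    omega

end SmulExp

end NVA

namespace NVA

/-! ### Locality of vertex operators -/

section Locality

variable {W : Type*} [AddCommGroup W] [Module ℂ W]

/-- The opposite product `u(x₂) v(x₁)` as a family. -/
def BA (u v : EW W) : W × ℤ × ℤ → W := fun k => Fab u v k.1 k.2.2 k.2.1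

lemma BA_apply (u v : EW W) (w : W) (m t : ℤ) :
    BA u v (w, m, t) = mf u (mf v w (-m - 1)) (-t - 1) := rfl

/-- The mode `a_n` as a linear map. -/
def mfL (a : EW W) (n : ℤ) : W →ₗ[ℂ] W where
  toFun w := mf a w n
  map_add' w w' := mf_add a w w' n
  map_smul' c w := mf_smul a c w n

@[simp] lemma mfL_apply (a : EW W) (n : ℤ) (w : W) : mfL a n w = mf a w n := rfl

lemma mf_zero_right (a : EW W) (n : ℤ) : mf a 0 n = 0 := (mfL a n).map_zero

lemma mf_trunc (a : EW W) (w : W) : ∃ N : ℤ, ∀ p < N, mf a w (-p - 1) = 0 := by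
  obtain ⟨N, hN⟩ := a.2 w
  exact ⟨-N, fun p hp => hN _ (by omega)⟩

lemma iterTrunc_BA (u v : EW W) : IterTrunc (BA u v) := by
  refine ⟨fun w => ?_, fun w p => ?_⟩
  · obtain ⟨N, hN⟩ := mf_trunc v w
    exact ⟨N, fun p hp q => by rw [BA_apply, hN p hp, mf_zero_right]⟩
  · obtain ⟨N, hN⟩ := mf_trunc u (mf v w (-p - 1))
    exact ⟨N, fun q hq => hN q hq⟩

/-- The families `u(x₂) v(x₁)` with `u ∈ B` and `v ∈ A`. -/
def BASet (A B : Set (EW W)) : Set (W × ℤ × ℤ → W) := {Z | ∃ u ∈ B, ∃ v ∈ A, Z = BA u v}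

lemma nullFam_BASet (A B : Set (EW W)) : ∀ F ∈ BASet A B, NullFam dd F := by
  rintro _ ⟨u, _, v, _, rfl⟩
  exact (iterTrunc_BA u v).nullFam

lemma BASet_mono {A A' B B' : Set (EW W)} (hA : A ⊆ A') (hB : B ⊆ B') : BASet A B ⊆ BASet A' B' :=
  fun _ ⟨u, hu, v, hv, h⟩ => ⟨u, hB hu, v, hA hv, h⟩

/-- The ordered product `a(x₁) b(x₂)` can be exchanged, with outputs `u(x₂) v(x₁)`, `u ∈ B`,
`v ∈ A`. -/
def Loc (A B : Set (EW W)) (a b : EW W) : Prop := ∃ k : ℕ, (dd ^ k) (AB a b) ∈ PS dd (BASet A B)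

lemma Loc.mono {A A' B B' : Set (EW W)} {a b : EW W} (h : Loc A B a b) (hA : A ⊆ A')
    (hB : B ⊆ B') : Loc A' B' a b :=
  h.imp fun _ hk => PS_mono _ (BASet_mono hA hB) hk

lemma Loc.pow_mem {A B : Set (EW W)} {k n : ℕ} {a b : EW W}
    (h : (dd ^ k) (AB a b) ∈ PS dd (BASet A B)) (hn : k ≤ n) :
    (dd ^ n) (AB a b) ∈ PS dd (BASet A B) :=
  PS_pow_mem_of_le (nullFam_BASet A B) rowFinite_dd h hn

lemma AB_add_left (a a' b : EW W) : AB (a + a') b = AB a b + AB a' b := rfl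

lemma AB_smul_left (c : ℂ) (a b : EW W) : AB (c • a) b = c • AB a b := rfl

lemma AB_add_right (a b b' : EW W) : AB a (b + b') = AB a b + AB a b' := by
  ext ⟨w, m, t⟩; exact mf_add a _ _ _

lemma AB_smul_right (c : ℂ) (a b : EW W) : AB a (c • b) = c • AB a b := by
  ext ⟨w, m, t⟩; exact mf_smul a _ _ _

lemma AB_zero_left (b : EW W) : AB 0 b = 0 := rfl

lemma AB_zero_right (a : EW W) : AB a 0 = 0 := by
  ext ⟨w, m, t⟩; exact mf_zero_right a _

lemma Loc.add_left {A B : Set (EW W)} {a a' b : EW W} (h : Loc A B a b) (h' : Loc A B a' b) :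
    Loc A B (a + a') b := by
  obtain ⟨k, hk⟩ := h
  obtain ⟨k', hk'⟩ := h'
  refine ⟨max k k', ?_⟩
  rw [AB_add_left, map_add]
  exact add_mem (Loc.pow_mem hk (le_max_left _ _)) (Loc.pow_mem hk' (le_max_right _ _))

lemma Loc.smul_left {A B : Set (EW W)} {a b : EW W} (c : ℂ) (h : Loc A B a b) :
    Loc A B (c • a) b := by
  obtain ⟨k, hk⟩ := h
  refine ⟨k, ?_⟩
  rw [AB_smul_left, map_smul]
  exact Submodule.smul_mem _ _ hk

lemma Loc.add_right {A B : Set (EW W)} {a b b' : EW W} (h : Loc A B a b) (h' : Loc A B a b') :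
    Loc A B a (b + b') := by
  obtain ⟨k, hk⟩ := h
  obtain ⟨k', hk'⟩ := h'
  refine ⟨max k k', ?_⟩
  rw [AB_add_right, map_add]
  exact add_mem (Loc.pow_mem hk (le_max_left _ _)) (Loc.pow_mem hk' (le_max_right _ _))

lemma Loc.smul_right {A B : Set (EW W)} {a b : EW W} (c : ℂ) (h : Loc A B a b) :
    Loc A B a (c • b) := by
  obtain ⟨k, hk⟩ := h
  refine ⟨k, ?_⟩
  rw [AB_smul_right, map_smul]
  exact Submodule.smul_mem _ _ hk

lemma loc_zero_left (A B : Set (EW W)) (b : EW W) : Loc A B 0 b :=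
  ⟨0, by rw [AB_zero_left, map_zero]; exact zero_mem _⟩

lemma loc_zero_right (A B : Set (EW W)) (a : EW W) : Loc A B a 0 :=
  ⟨0, by rw [AB_zero_right, map_zero]; exact zero_mem _⟩

lemma Loc.span_left {A B X : Set (EW W)} {a b : EW W} (h : ∀ x ∈ X, Loc A B x b)
    (ha : a ∈ Submodule.span ℂ X) : Loc A B a b :=
  Submodule.span_induction h (loc_zero_left A B b) (fun _ _ _ _ h h' => h.add_left h')
    (fun c _ _ h => h.smul_left c) ha

lemma Loc.span_right {A B X : Set (EW W)} {a b : EW W} (h : ∀ x ∈ X, Loc A B a x)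
    (hb : b ∈ Submodule.span ℂ X) : Loc A B a b :=
  Submodule.span_induction h (loc_zero_right A B a) (fun _ _ _ _ h h' => h.add_right h')
    (fun c _ _ h => h.smul_right c) hb

lemma mf_one (w : W) (n : ℤ) : mf oneE w n = if n = -1 then w else 0 := rfl

lemma AB_one_left (b : EW W) : AB oneE b = BA b oneE := by
  ext ⟨w, m, t⟩
  rw [AB_apply, BA_apply, mf_one, mf_one]
  split_ifs
  · rfl
  · rw [mf_zero_right]

lemma AB_one_right (a : EW W) : AB a oneE = BA oneE a := by
  ext ⟨w, m, t⟩
  rw [AB_apply, BA_apply, mf_one, mf_one]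
  split_ifs
  · rfl
  · rw [mf_zero_right]

lemma loc_one_left {A B : Set (EW W)} {b : EW W} (hA : oneE ∈ A) (hb : b ∈ B) :
    Loc A B oneE b := ⟨0, mem_PS ⟨b, hb, oneE, hA, AB_one_left b⟩⟩

lemma loc_one_right {A B : Set (EW W)} {a : EW W} (ha : a ∈ A) (hB : oneE ∈ B) :
    Loc A B a oneE := ⟨0, mem_PS ⟨oneE, hB, a, ha, AB_one_right a⟩⟩

lemma loc_of_sLocal {S : Set (EW W)} (hS : SLocal S) {a b : EW W} (ha : a ∈ S) (hb : b ∈ S) :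
    Loc S S a b := by
  obtain ⟨k, r, f, u, v, hu, hv, h⟩ := hS a ha b hb
  choose M hM using fun i => exists_powerSeries_mul (f i)
  set n := Finset.univ.sup M
  choose g hg using fun i => hM i n (Finset.le_sup (Finset.mem_univ i))
  have h1 : (dd ^ k) (AB a b) = ∑ i, (dd ^ k) (smulJ (f i) (BA (u i) (v i))) := by
    ext ⟨w, m, t⟩
    rw [Finset.sum_apply]
    simp only [← mulF_X_sub_X_pow]
    exact h w m t
  refine ⟨n + k, ?_⟩
  rw [pow_add, Module.End.mul_apply, h1, map_sum]
  refine sum_mem fun i _ => ?_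
  rw [← Module.End.mul_apply, ← pow_add, add_comm, pow_add, Module.End.mul_apply]
  refine PS_pow_mem (nullFam_BASet S S) rowFinite_dd k ?_
  have h2 := neg_dd_pow_smulJ_eq (hg i) (iterTrunc_BA (u i) (v i))
  have h3 : (dd ^ n) (smulJ (f i) (BA (u i) (v i))) =
      (-1 : ℂ) ^ n • psAct (-dd) (g i) (BA (u i) (v i)) := by
    rw [← h2, ← neg_one_smul ℂ dd, smul_pow, LinearMap.smul_apply, smul_smul, ← mul_pow]
    simp
  rw [h3, psAct_neg]
  exact Submodule.smul_mem _ _ (psAct_mem_PS _ ⟨u i, hu i, v i, hv i, rfl⟩)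

lemma PS_BASet_trunc {A B : Set (EW W)} {F : W × ℤ × ℤ → W} (hF : F ∈ PS dd (BASet A B)) (w : W) :
    ∃ N : ℤ, ∀ p < N, ∀ q, F (w, p, q) = 0 := by
  refine PS_induction (p := fun F => ∃ N : ℤ, ∀ p < N, ∀ q, F (w, p, q) = 0)
    ⟨0, fun _ _ _ => rfl⟩ ?_ ?_ ?_ hF
  · rintro F G ⟨N, hN⟩ ⟨N', hN'⟩
    exact ⟨min N N', fun p hp q => by
      rw [Pi.add_apply, hN p (lt_min_iff.1 hp).1, hN' p (lt_min_iff.1 hp).2, add_zero]⟩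
  · rintro c F ⟨N, hN⟩
    exact ⟨N, fun p hp q => by rw [Pi.smul_apply, hN p hp, smul_zero]⟩
  · rintro g _ ⟨u, _, v, _, rfl⟩
    obtain ⟨N, hN⟩ := (iterTrunc_BA u v).1 w
    have key : ∀ n : ℕ, ∀ p < N, ∀ q, (dd ^ n) (BA u v) (w, p, q) = 0 := by
      intro n
      induction n with
      | zero => simpa using hN
      | succ n ih =>
        intro p hp q
        rw [pow_succ', Module.End.mul_apply]
        change (dd ^ n) (BA u v) (w, p - 1, q) - (dd ^ n) (BA u v) (w, p, q - 1) = 0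
        rw [ih _ (by omega), ih _ hp, sub_zero]
    exact ⟨N, fun p hp q => psAct_eq_zero g fun n => key n p hp q⟩

lemma AB_trunc (a b : EW W) (w : W) (k : ℕ) :
    ∃ N : ℤ, ∀ q < N, ∀ p, (dd ^ k) (AB a b) (w, p, q) = 0 := by
  obtain ⟨N, hN⟩ := mf_trunc b w
  refine ⟨N, ?_⟩
  induction k with
  | zero => intro q hq p; simp [AB_apply, hN q hq, mf_zero_right]
  | succ n ih =>
    intro q hq p
    rw [pow_succ', Module.End.mul_apply]
    change (dd ^ n) (AB a b) (w, p - 1, q) - (dd ^ n) (AB a b) (w, p, q - 1) = 0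
    rw [ih _ hq, ih _ (by omega), sub_zero]

lemma Loc.mem_dom {A B : Set (EW W)} {a b : EW W} (h : Loc A B a b) : AB a b ∈ dom := by
  obtain ⟨k, hk⟩ := h
  choose N hN using PS_BASet_trunc hk
  choose N' hN' using fun w => AB_trunc a b w k
  refine ⟨k, fun w => min (N w) (N' w), fun w p q hpq => ?_⟩
  rcases hpq with h | h
  · exact hN w p (lt_min_iff.1 h).1 q
  · exact hN' w q (lt_min_iff.1 h).2 p

lemma rho_AB {a b : EW W} (h : AB a b ∈ dom) (e : ℤ) (w : W) (q : ℤ) :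
    rho e (AB a b) (w, q) = mf (YE a b (-e - 1)) w (-q - 1) := by
  rw [mf_YE h]
  ring_nf

end Locality

section DongLeft

variable {W : Type*} [AddCommGroup W] [Module ℂ W]

lemma isCls_of_index {I M : Type*} [AddCommGroup M] [Module ℂ M] {Z : (I × ℤ) × ℤ × ℤ → M}
    (h1 : ∀ i r, ∃ N : ℤ, ∀ p q, p < N ∨ q < N → Z ((i, r), p, q) = 0)
    (h2 : ∀ i, ∃ R : ℤ, ∀ r < R, ∀ p q, Z ((i, r), p, q) = 0) : IsCls Z := by
  choose N hN using h1
  choose R hR using h2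
  choose N' hN' using fun i (r : ℤ) => ((Finset.Icc (R i) r).image (N i)).bddBelow
  refine ⟨N', fun i _ _ => R i, fun i r r' hr p q h => ?_,
    fun i p q r p' q' hr _ _ => hR i r hr _ _⟩
  by_cases h' : r' < R i
  · exact hR i r' h' p q
  · have : N' i r ≤ N i r' :=
      hN' i r (Finset.mem_coe.2 (Finset.mem_image.2 ⟨r', by simp; omega, rfl⟩))
    exact hN i r' p q (h.imp (fun h => h.trans_le this) fun h => h.trans_le this)

lemma dd_pow_of_index_zero {J M : Type*} [AddCommGroup M] [Module ℂ M] {F : J × ℤ × ℤ → M} {j : J}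
    (n : ℕ) (h : ∀ p q, F (j, p, q) = 0) {p q : ℤ} : (dd ^ n) F (j, p, q) = 0 := by
  induction n generalizing p q with
  | zero => exact h p q
  | succ n ih =>
    rw [pow_succ', Module.End.mul_apply]
    change (dd ^ n) F (j, p - 1, q) - (dd ^ n) F (j, p, q - 1) = 0
    rw [ih, ih, sub_zero]

lemma nullFam_neg {K M : Type*} [AddCommGroup M] [Module ℂ M] {D : Module.End ℂ (K → M)}
    {F : K → M} (h : NullFam D F) : NullFam (-D) F := fun k => by
  obtain ⟨N, hN⟩ := h k
  refine ⟨N, fun n hn => ?_⟩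
  rw [← neg_one_smul ℂ D, smul_pow, LinearMap.smul_apply, Pi.smul_apply, hN n hn, smul_zero]

lemma nullFam_of_neg {K M : Type*} [AddCommGroup M] [Module ℂ M] {D : Module.End ℂ (K → M)}
    {F : K → M} (h : NullFam (-D) F) : NullFam D F := by
  simpa using nullFam_neg h

/-- The elements `a_n b` with `a, b ∈ A`. -/
def YESet (A : Set (EW W)) : Set (EW W) := {c | ∃ a ∈ A, ∃ b ∈ A, ∃ n, c = YE a b n}

/-- The parametric families `c(z) a(x₁) b(x₂)`. -/
def tripL (c : EW W) (F : W × ℤ × ℤ → W) : (W × ℤ) × ℤ × ℤ → W :=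
  lift2 (fun k : W × ℤ => k.1) (fun k => mfL c (-k.2 - 1)) F

lemma rho_tripL (c : EW W) {a b : EW W} (h : AB a b ∈ dom) (e : ℤ) (w : W) (r q : ℤ) :
    rho e (tripL c (AB a b)) ((w, r), q) = AB c (YE a b (-e - 1)) (w, r, q) := by
  rw [tripL, rho_lift _ _ h, lift1_apply]
  simp only [mfL_apply]
  rw [rho_AB h, AB_apply]

lemma isCls_tripL (c : EW W) {a b : EW W} (h : AB a b ∈ dom) :
    ∃ K : ℕ, IsCls ((dd ^ K) (tripL c (AB a b))) := by
  obtain ⟨K, N, hK⟩ := h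
  refine ⟨K, isCls_of N ?_ ?_⟩
  · intro w r p q hpq
    rw [tripL, ← lift2_dd_pow, lift2_apply]
    simp only
    rw [hK w p q hpq, map_zero]
  · intro w p q
    obtain ⟨R, hR⟩ := mf_trunc c ((dd ^ K) (AB a b) (w, p, q))
    refine ⟨R, fun r hr => ?_⟩
    rw [tripL, ← lift2_dd_pow, lift2_apply]
    exact hR r hr

theorem loc_YE_left {A C : Set (EW W)} (hA : ∀ a ∈ A, ∀ b ∈ A, AB a b ∈ dom)
    (hAC : ∀ a ∈ A, ∀ c ∈ C, Loc A C a c) {a b c : EW W} (ha : a ∈ A) (hb : b ∈ A) (hc : c ∈ C)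
    (n : ℤ) : Loc (YESet A) C (YE a b n) c := by
  let F : (W × ℤ) × ℤ × ℤ → W :=
    lift2 (fun k : W × ℤ => mf c k.1 (-k.2 - 1)) (fun _ => LinearMap.id) (AB a b)
  have hF : F ∈ dom := lift2_mem_dom _ _ (hA a ha b hb)
  let T₁ (a : EW W) : (W × ℤ × ℤ → W) →ₗ[ℂ] ((W × ℤ) × ℤ × ℤ → W) :=
    famMap (fun k => (k.1.1, k.2.2, k.1.2)) fun k => mfL a (-k.2.1 - 1)
  let T₂ (b : EW W) : (W × ℤ × ℤ → W) →ₗ[ℂ] ((W × ℤ) × ℤ × ℤ → W) :=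
    pull fun k => (mf b k.1.1 (-k.2.2 - 1), k.2.1, k.1.2)
  have hT₁ : ∀ a H, T₁ a (dd H) = dQR (T₁ a H) := fun a H => by
    ext k; simp [T₁, dd, dQR, famMap_apply, mf]
  have hT₂ : ∀ b H, T₂ b (dd H) = dPR (T₂ b H) := fun b H => rfl
  let 𝒮 : Set ((W × ℤ) × ℤ × ℤ → W) := {X | ∃ c ∈ C, ∃ b ∈ A, X = T₁ a (BA c b)}
  let 𝒢 : Set ((W × ℤ) × ℤ × ℤ → W) := {X | ∃ c ∈ C, ∃ a ∈ A, ∃ b ∈ A, X = T₂ b (BA c a)}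
  have hG : ∀ c a b, T₂ b (BA c a) = tripL c (AB a b) := fun c a b => rfl
  have hS : ∀ c b, T₁ a (BA c b) = T₂ b (AB a c) := fun c b => rfl
  have hFT : F = T₁ a (AB b c) := rfl
  have hGc : ∀ Z ∈ 𝒢, ∃ K : ℕ, IsCls ((dd ^ K) Z) := by
    rintro _ ⟨c, hc, a, ha, b, hb, rfl⟩
    exact isCls_tripL c (hA a ha b hb)
  have hGn : ∀ Z ∈ 𝒢, NullFam dPR Z := by
    rintro _ ⟨c, hc, a, ha, b, hb, rfl⟩
    exact (iterTrunc_BA c a).nullFam.map (rowFinite_famMap _ _) (hT₂ b)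
  have hSn : ∀ X ∈ 𝒮, NullFam dQR X := by
    rintro _ ⟨c, hc, b, hb, rfl⟩
    exact (iterTrunc_BA c b).nullFam.map (rowFinite_famMap _ _) (hT₁ a)
  obtain ⟨L, hL⟩ := dong (D₁ := dQR) (D₂ := dPR) (Or.inr rfl) (Or.inl rfl) hF (𝒢 := 𝒢) (𝒮 := 𝒮)
    hGc hGn hSn (by
      rintro _ ⟨c, hc, b, hb, rfl⟩
      obtain ⟨k, hk⟩ := hAC a ha c hc
      refine ⟨k, ?_⟩
      rw [hS, ← pow_intertwine (hT₂ b)]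
      refine PS_map (nullFam_BASet A C) (rowFinite_famMap _ _) (hT₂ b) ?_ hGn rowFinite_dPR hk
      rintro _ ⟨c, hc, a, ha, rfl⟩
      exact mem_PS ⟨c, hc, a, ha, b, hb, rfl⟩)
    (by
      obtain ⟨k, hk⟩ := hAC b hb c hc
      refine ⟨k, ?_⟩
      rw [hFT, ← pow_intertwine (hT₁ a)]
      refine PS_map (nullFam_BASet A C) (rowFinite_famMap _ _) (hT₁ a) ?_ hSn rowFinite_dQR hk
      rintro _ ⟨c, hc, b, hb, rfl⟩
      exact mem_PS ⟨c, hc, b, hb, rfl⟩) (-n - 1)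
  let T₃ : ((W × ℤ) × ℤ → W) →ₗ[ℂ] (W × ℤ × ℤ → W) := pull fun k => ((k.1, k.2.2), k.2.1)
  have hT₃ : ∀ H, T₃ (dR1 H) = dd (T₃ H) := fun H => rfl
  refine ⟨L, ?_⟩
  have hAB : AB (YE a b n) c = T₃ (rho (-n - 1) F) := by
    ext ⟨w, q, r⟩
    simp only [T₃, famMap_apply, LinearMap.id_apply]
    rw [rho_lift _ _ (hA a ha b hb), lift1_apply, LinearMap.id_apply, rho_AB (hA a ha b hb),
      AB_apply]
    congr 2
    ring
  rw [hAB, ← pow_intertwine hT₃]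
  refine PS_map ?_ (rowFinite_famMap _ _) hT₃ ?_ (nullFam_BASet _ _) rowFinite_dd hL
  · rintro _ ⟨i, Z, hZ, rfl⟩
    exact nullFam_rho_of (hGc Z hZ) i
  · rintro _ ⟨i, _, ⟨c, hc, a, ha, b, hb, rfl⟩, rfl⟩
    refine mem_PS ⟨c, hc, YE a b (-i - 1), ⟨a, ha, b, hb, _, rfl⟩, ?_⟩
    ext ⟨w, q, r⟩
    simp only [famMap_apply, LinearMap.id_apply]
    rw [hG, rho_tripL c (hA a ha b hb)]
    rfl

lemma isCls_precomp (c : EW W) {a b : EW W} (h : AB a b ∈ dom) :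
    ∃ K : ℕ, IsCls ((dd ^ K) (lift2 (fun k : W × ℤ => mf c k.1 (-k.2 - 1))
      (fun _ => LinearMap.id) (AB a b))) := by
  obtain ⟨K, N, hK⟩ := h
  refine ⟨K, isCls_of_index (fun w r => ⟨N (mf c w (-r - 1)), fun p q hpq => ?_⟩) fun w => ?_⟩
  · rw [← lift2_dd_pow, lift2_apply, LinearMap.id_apply]
    exact hK _ p q hpq
  · obtain ⟨R, hR⟩ := mf_trunc c w
    refine ⟨R, fun r hr p q => ?_⟩
    rw [← lift2_dd_pow, lift2_apply, LinearMap.id_apply]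
    simp only
    rw [hR r hr]
    exact dd_pow_of_index_zero K fun p q => by rw [AB_apply, mf_zero_right, mf_zero_right]

theorem loc_YE_right {A C : Set (EW W)} (hA : ∀ a ∈ A, ∀ b ∈ A, AB a b ∈ dom)
    (hCA : ∀ c ∈ C, ∀ a ∈ A, Loc C A c a) {a b c : EW W} (ha : a ∈ A) (hb : b ∈ A) (hc : c ∈ C)
    (n : ℤ) : Loc C (YESet A) c (YE a b n) := by
  let F : (W × ℤ) × ℤ × ℤ → W := tripL c (AB a b)
  have hF : F ∈ dom := lift2_mem_dom _ _ (hA a ha b hb)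
  let T₁ (b : EW W) : (W × ℤ × ℤ → W) →ₗ[ℂ] ((W × ℤ) × ℤ × ℤ → W) :=
    pull fun k => (mf b k.1.1 (-k.2.2 - 1), k.1.2, k.2.1)
  let T₂ (a : EW W) : (W × ℤ × ℤ → W) →ₗ[ℂ] ((W × ℤ) × ℤ × ℤ → W) :=
    famMap (fun k => (k.1.1, k.1.2, k.2.2)) fun k => mfL a (-k.2.1 - 1)
  have hT₁ : ∀ b H, T₁ b (dd H) = (-dPR) (T₁ b H) := fun b H => by
    ext k; simp [T₁, dd, dPR, famMap_apply]
  have hT₂ : ∀ a H, T₂ a (dd H) = (-dQR) (T₂ a H) := fun a H => by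
    ext k; simp [T₂, dd, dQR, famMap_apply, mf]
  have hneg : ∀ (D : Module.End ℂ ((W × ℤ) × ℤ × ℤ → W)) (k : ℕ) (H) (P : Submodule ℂ _),
      ((-D) ^ k) H ∈ P → (D ^ k) H ∈ P := by
    intro D k H P h
    rw [← neg_one_smul ℂ D, smul_pow, LinearMap.smul_apply] at h
    exact (Submodule.smul_mem_iff _ (pow_ne_zero _ (by norm_num))).1 h
  let 𝒮 : Set ((W × ℤ) × ℤ × ℤ → W) := {X | ∃ a ∈ A, ∃ c ∈ C, X = T₁ b (BA a c)}
  let 𝒢 : Set ((W × ℤ) × ℤ × ℤ → W) := {X | ∃ a ∈ A, ∃ b ∈ A, ∃ c ∈ C, X = T₂ a (BA b c)}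
  let Q (c a b : EW W) : (W × ℤ) × ℤ × ℤ → W :=
    lift2 (fun k : W × ℤ => mf c k.1 (-k.2 - 1)) (fun _ => LinearMap.id) (AB a b)
  have hG : ∀ a b c, T₂ a (BA b c) = Q c a b := fun a b c => rfl
  have hS : ∀ a c, T₁ b (BA a c) = T₂ a (AB c b) := fun a c => rfl
  have hFT : F = T₁ b (AB c a) := rfl
  have hGc : ∀ Z ∈ 𝒢, ∃ K : ℕ, IsCls ((dd ^ K) Z) := by
    rintro _ ⟨a, ha, b, hb, c, hc, rfl⟩
    exact isCls_precomp c (hA a ha b hb)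
  have hGn : ∀ Z ∈ 𝒢, NullFam dQR Z := by
    rintro _ ⟨a, ha, b, hb, c, hc, rfl⟩
    exact nullFam_of_neg ((iterTrunc_BA b c).nullFam.map (rowFinite_famMap _ _) (hT₂ a))
  have hSn : ∀ X ∈ 𝒮, NullFam dPR X := by
    rintro _ ⟨a, ha, c, hc, rfl⟩
    exact nullFam_of_neg ((iterTrunc_BA a c).nullFam.map (rowFinite_famMap _ _) (hT₁ b))
  obtain ⟨L, hL⟩ := dong (D₁ := dPR) (D₂ := dQR) (Or.inl rfl) (Or.inr rfl) hF (𝒢 := 𝒢) (𝒮 := 𝒮)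
    hGc hGn hSn (by
      rintro _ ⟨a, ha, c, hc, rfl⟩
      obtain ⟨k, hk⟩ := hCA c hc b hb
      refine ⟨k, hneg _ _ _ _ ?_⟩
      rw [hS, ← pow_intertwine (hT₂ a), ← PS_neg]
      refine PS_map (nullFam_BASet C A) (rowFinite_famMap _ _) (hT₂ a) ?_
        (fun Z hZ => nullFam_neg (hGn Z hZ)) rowFinite_dQR.neg hk
      rintro _ ⟨b, hb, c, hc, rfl⟩
      exact mem_PS ⟨a, ha, b, hb, c, hc, rfl⟩)
    (by
      obtain ⟨k, hk⟩ := hCA c hc a ha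
      refine ⟨k, hneg _ _ _ _ ?_⟩
      rw [hFT, ← pow_intertwine (hT₁ b), ← PS_neg]
      refine PS_map (nullFam_BASet C A) (rowFinite_famMap _ _) (hT₁ b) ?_
        (fun Z hZ => nullFam_neg (hSn Z hZ)) rowFinite_dPR.neg hk
      rintro _ ⟨a, ha, c, hc, rfl⟩
      exact mem_PS ⟨a, ha, c, hc, rfl⟩) (-n - 1)
  let T₃ : ((W × ℤ) × ℤ → W) →ₗ[ℂ] (W × ℤ × ℤ → W) := pull fun k => ((k.1, k.2.1), k.2.2)
  have hT₃ : ∀ H, T₃ (dR1 H) = (-dd) (T₃ H) := fun H => by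
    ext k; simp [T₃, dd, dR1, famMap_apply]
  refine ⟨L, ?_⟩
  have hAB : AB c (YE a b n) = T₃ (rho (-n - 1) F) := by
    ext ⟨w, r, q⟩
    simp only [T₃, famMap_apply, LinearMap.id_apply]
    rw [rho_tripL c (hA a ha b hb)]
    congr 2
    ring
  refine (Submodule.smul_mem_iff _ (pow_ne_zero L (by norm_num : (-1 : ℂ) ≠ 0))).1 ?_
  rw [← LinearMap.smul_apply, ← smul_pow, neg_one_smul, hAB, ← pow_intertwine hT₃, ← PS_neg]
  refine PS_map ?_ (rowFinite_famMap _ _) hT₃ ?_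
    (fun Z hZ => nullFam_neg (nullFam_BASet _ _ Z hZ)) rowFinite_dd.neg hL
  · rintro _ ⟨i, Z, hZ, rfl⟩
    exact nullFam_rho_of (hGc Z hZ) i
  · rintro _ ⟨i, _, ⟨a, ha, b, hb, c, hc, rfl⟩, rfl⟩
    refine mem_PS ⟨YE a b (-i - 1), ⟨a, ha, b, hb, _, rfl⟩, c, hc, ?_⟩
    ext ⟨w, r, q⟩
    simp only [famMap_apply, LinearMap.id_apply]
    rw [hG, rho_lift _ _ (hA a ha b hb), lift1_apply, LinearMap.id_apply, rho_AB (hA a ha b hb),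
      BA_apply]

end DongLeft

end NVA

namespace NVA

/-! ### Locality of the generated algebra -/

section Generated

variable {W : Type*} [AddCommGroup W] [Module ℂ W]

lemma exists_AB_one_right_mem_bdd (a : EW W) : ∃ N, (dd ^ 0) (AB a oneE) ∈ bdd N := by
  choose N hN using mf_trunc a
  refine ⟨fun w => min (N w) 0, fun w p q h => ?_⟩
  simp only at h
  rw [pow_zero, Module.End.one_apply, AB_apply, mf_one]
  split_ifs with h'
  · exact hN w p (by omega)
  · exact mf_zero_right _ _

lemma exists_AB_one_left_mem_bdd (b : EW W) : ∃ N, (dd ^ 0) (AB oneE b) ∈ bdd N := by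
  choose N hN using mf_trunc b
  refine ⟨fun w => min (N w) 0, fun w p q h => ?_⟩
  simp only at h
  rw [pow_zero, Module.End.one_apply, AB_apply, mf_one]
  split_ifs with h'
  · exact hN w q (by omega)
  · rfl

lemma AB_one_right_mem_dom (a : EW W) : AB a oneE ∈ dom := ⟨0, exists_AB_one_right_mem_bdd a⟩

lemma AB_one_left_mem_dom (b : EW W) : AB oneE b ∈ dom := ⟨0, exists_AB_one_left_mem_bdd b⟩

lemma YE_one_right_of_nonneg (a : EW W) {n : ℤ} (hn : 0 ≤ n) : YE a oneE n = 0 := by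
  apply ew_ext
  intro w m
  obtain ⟨N, h⟩ := exists_AB_one_right_mem_bdd a
  rw [mf_YE (AB_one_right_mem_dom a), rho_eq_zero_of_lt h (by simp; omega)]
  rfl

lemma YE_one_right (a : EW W) : YE a oneE (-1) = a := by
  apply ew_ext
  intro w m
  obtain ⟨N, h⟩ := exists_AB_one_right_mem_bdd a
  rw [mf_YE (AB_one_right_mem_dom a), rho_eq h, pow_zero, Module.End.one_apply]
  simp only [tau, Nat.cast_zero]
  rw [finsum_eq_single _ (-m - 1)]
  · rw [AB_apply, mf_one, if_pos (by ring)]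
    norm_num [bz_zero_right]
  · intro p hp
    rw [AB_apply, mf_one, if_neg (by omega), mf_zero_right, smul_zero]

lemma YE_one_left (b : EW W) (n : ℤ) : YE oneE b n = if n = -1 then b else 0 := by
  apply ew_ext
  intro w m
  obtain ⟨N, h⟩ := exists_AB_one_left_mem_bdd b
  rw [mf_YE (AB_one_left_mem_dom b), rho_eq h, pow_zero, Module.End.one_apply]
  simp only [tau, Nat.cast_zero]
  rw [finsum_eq_single _ 0]
  · rw [AB_apply, mf_one, if_pos (by ring), bz_zero_left]
    split_ifs with h1 h2 h2
    · subst h2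
      norm_num
    · omega
    · omega
    · rw [zero_smul]; rfl
  · intro p hp
    rw [AB_apply, mf_one, if_neg (by omega), smul_zero]

/-- The ascending chain of subspaces obtained from `S ∪ {1}` by taking all products `a_n b`. -/
def chain (S : Set (EW W)) : ℕ → Submodule ℂ (EW W)
  | 0 => Submodule.span ℂ (insert oneE S)
  | n + 1 => Submodule.span ℂ (YESet (chain S n : Set (EW W)))

lemma one_mem_chain (S : Set (EW W)) (n : ℕ) : oneE ∈ chain S n := by
  induction n with
  | zero => exact Submodule.subset_span (Set.mem_insert _ _)
  | succ n ih => exact Submodule.subset_span ⟨_, ih, _, ih, -1, (YE_one_right _).symm⟩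

lemma chain_le_succ (S : Set (EW W)) (n : ℕ) : chain S n ≤ chain S (n + 1) :=
  fun a ha => Submodule.subset_span ⟨a, ha, _, one_mem_chain S n, -1, (YE_one_right a).symm⟩

lemma chain_mono (S : Set (EW W)) : Monotone (chain S) := monotone_nat_of_le_succ (chain_le_succ S)

lemma loc_chain {S : Set (EW W)} (hS : SLocal S) (n : ℕ) : ∀ a ∈ chain S n, ∀ b ∈ chain S n,
    Loc (chain S n : Set (EW W)) (chain S n : Set (EW W)) a b := by
  induction n with
  | zero =>
    intro a ha b hb
    have hS' : S ⊆ (chain S 0 : Set (EW W)) := fun x hx => Submodule.subset_span (Or.inr hx)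
    refine Loc.span_left (fun a ha' => Loc.span_right (fun b hb' => ?_) hb) ha
    have ha : a ∈ chain S 0 := Submodule.subset_span ha'
    have hb : b ∈ chain S 0 := Submodule.subset_span hb'
    rcases ha' with rfl | ha'
    · exact loc_one_left ha hb
    rcases hb' with rfl | hb'
    · exact loc_one_right ha hb
    exact (loc_of_sLocal hS ha' hb').mono hS' hS'
  | succ n ih =>
    have hsub : YESet (chain S n : Set (EW W)) ⊆ (chain S (n + 1) : Set (EW W)) :=
      Submodule.subset_span
    have hA : ∀ a ∈ (chain S n : Set (EW W)), ∀ b ∈ (chain S n : Set (EW W)), AB a b ∈ dom :=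
      fun a ha b hb => (ih a ha b hb).mem_dom
    have h1 : ∀ c ∈ (chain S (n + 1) : Set (EW W)), ∀ a ∈ (chain S n : Set (EW W)),
        Loc (chain S (n + 1) : Set (EW W)) (chain S n : Set (EW W)) c a := by
      intro c hc a ha
      refine Loc.span_left ?_ hc
      rintro _ ⟨x, hx, y, hy, m, rfl⟩
      exact (loc_YE_left hA ih hx hy ha m).mono hsub subset_rfl
    intro c hc d hd
    refine Loc.span_right ?_ hd
    rintro _ ⟨x, hx, y, hy, m, rfl⟩
    exact (loc_YE_right hA h1 hx hy hc m).mono subset_rfl hsub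

theorem loc_of_isGenVA {S : Set (EW W)} (hS : SLocal S) {U : Submodule ℂ (EW W)}
    (hU : IsGenVA S U) {a b : EW W} (ha : a ∈ U) (hb : b ∈ U) :
    Loc (U : Set (EW W)) (U : Set (EW W)) a b := by
  obtain ⟨hQ, hY, h1, hSU, hmin⟩ := hU
  have hle : ∀ n, chain S n ≤ U := by
    intro n
    induction n with
    | zero => exact Submodule.span_le.2 (Set.insert_subset h1 hSU)
    | succ n ih =>
      refine Submodule.span_le.2 ?_
      rintro _ ⟨x, hx, y, hy, m, rfl⟩
      exact hY _ (ih hx) _ (ih hy) m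
  have hdir := (chain_mono S).directed_le
  have key : U ≤ ⨆ n, chain S n := by
    refine hmin _ ⟨fun r ψ hψ => hQ r ψ fun i => iSup_le hle (hψ i), fun a ha b hb n => ?_,
      Submodule.mem_iSup_of_mem 0 (one_mem_chain S 0), fun x hx =>
      Submodule.mem_iSup_of_mem 0 (Submodule.subset_span (Or.inr hx))⟩
    obtain ⟨i, hi⟩ := (Submodule.mem_iSup_of_directed _ hdir).1 ha
    obtain ⟨j, hj⟩ := (Submodule.mem_iSup_of_directed _ hdir).1 hb
    exact Submodule.mem_iSup_of_mem (max i j + 1) (Submodule.subset_span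
      ⟨a, chain_mono S (le_max_left i j) hi, b, chain_mono S (le_max_right i j) hj, n, rfl⟩)
  obtain ⟨i, hi⟩ := (Submodule.mem_iSup_of_directed _ hdir).1 (key ha)
  obtain ⟨j, hj⟩ := (Submodule.mem_iSup_of_directed _ hdir).1 (key hb)
  exact (loc_chain hS _ a (chain_mono S (le_max_left i j) hi) b
    (chain_mono S (le_max_right i j) hj)).mono (hle _) (hle _)

end Generated

end NVA

namespace NVA

/-! ### Substitution in three-variable families -/

section Triple

variable {I M : Type*} [AddCommGroup M] [Module ℂ M]

lemma psAct_map_on {K M K' M' : Type*} [AddCommGroup M] [Module ℂ M] [AddCommGroup M']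
    [Module ℂ M'] {D : Module.End ℂ (K → M)} {D' : Module.End ℂ (K' → M')} {F : K → M}
    (hF : NullFam D F) {T : (K → M) →ₗ[ℂ] (K' → M')} (hT : RowFinite T)
    {P : Submodule ℂ (K → M)} (hP : ∀ F ∈ P, D F ∈ P) (hc : ∀ F ∈ P, T (D F) = D' (T F))
    (hFP : F ∈ P) (g : PowerSeries ℂ) : T (psAct D g F) = psAct D' g (T F) := by
  have h : ∀ n : ℕ, (D ^ n) F ∈ P ∧ T ((D ^ n) F) = (D' ^ n) (T F) := by
    intro n
    induction n with
    | zero => exact ⟨hFP, rfl⟩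
    | succ n ih =>
      rw [pow_succ', pow_succ', Module.End.mul_apply, Module.End.mul_apply, hc _ ih.1, ih.2]
      exact ⟨hP _ ih.1, rfl⟩
  ext k'
  rw [psAct_rowFinite_sum hF hT]
  simp only [psAct, (h _).2]

lemma pow_mem_submodule {V : Type*} [AddCommGroup V] [Module ℂ V] {D : Module.End ℂ V}
    {P : Submodule ℂ V} (hP : ∀ F ∈ P, D F ∈ P) {F : V} (hF : F ∈ P) (n : ℕ) :
    (D ^ n) F ∈ P := by
  induction n with
  | zero => exact hF
  | succ n ih => rw [pow_succ']; exact hP _ ih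

/-- Difference of the parameter variable and the last variable. -/
def e1 : Module.End ℂ ((I × ℤ) × ℤ × ℤ → M) := shR - shQ

/-- Difference of the parameter variable and the first variable. -/
def dRP : Module.End ℂ ((I × ℤ) × ℤ × ℤ → M) := shR - shP

lemma e1_eq : (e1 : Module.End ℂ ((I × ℤ) × ℤ × ℤ → M)) = -dQR := by simp [e1, dQR]

lemma dRP_eq : (dRP : Module.End ℂ ((I × ℤ) × ℤ × ℤ → M)) = e1 - dd := by simp [dRP, e1, dd]

lemma rowFinite_shR : RowFinite (shR : Module.End ℂ ((I × ℤ) × ℤ × ℤ → M)) := rowFinite_famMap _ _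

lemma rowFinite_e1 : RowFinite (e1 : Module.End ℂ ((I × ℤ) × ℤ × ℤ → M)) :=
  rowFinite_shR.sub rowFinite_shQ

lemma commute_e1_dd : Commute (e1 : Module.End ℂ ((I × ℤ) × ℤ × ℤ → M)) dd :=
  LinearMap.ext fun F => by
    rw [e1_eq]; exact (congrArg Neg.neg (dd_dQR F)).symm.trans (map_neg dd (dQR F)).symm

lemma commute_e1_dRP : Commute (e1 : Module.End ℂ ((I × ℤ) × ℤ × ℤ → M)) dRP := by
  rw [dRP_eq]; exact (Commute.refl _).sub_right commute_e1_dd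

lemma commute_dd_dRP : Commute (dd : Module.End ℂ ((I × ℤ) × ℤ × ℤ → M)) dRP := by
  rw [dRP_eq]; exact commute_e1_dd.symm.sub_right (Commute.refl _)

/-- Make the parameter exponent the first exponent. -/
def rr : ((I × ℤ) × ℤ → M) →ₗ[ℂ] (I × ℤ × ℤ → M) := pull fun k => ((k.1, k.2.1), k.2.2)

@[simp] lemma rr_apply (H : (I × ℤ) × ℤ → M) (k : I × ℤ × ℤ) :
    rr H k = H ((k.1, k.2.1), k.2.2) := rfl

lemma rr_dR1 (H : (I × ℤ) × ℤ → M) : rr (dR1 H) = -dd (rr H) := by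
  ext k; simp [dd, dR1]

/-- The three-variable families for which both substitutions in `subst3` are defined. -/
def dom3 : Submodule ℂ ((I × ℤ) × ℤ × ℤ → M) where
  carrier := {F | F ∈ dom ∧ ∀ j, rr (rho j F) ∈ dom}
  add_mem' h h' := ⟨add_mem h.1 h'.1, fun j => by
    rw [map_add, map_add]; exact add_mem (h.2 j) (h'.2 j)⟩
  zero_mem' := ⟨zero_mem _, fun j => by rw [map_zero, map_zero]; exact zero_mem _⟩
  smul_mem' c _ h := ⟨Submodule.smul_mem _ c h.1, fun j => by
    rw [map_smul, map_smul]; exact Submodule.smul_mem _ c (h.2 j)⟩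

/-- Substitute `x₂ = x + z₂`, then `x₁ = x + z₁`, with `x` the third variable. -/
def subst3 : Module.End ℂ ((I × ℤ) × ℤ × ℤ → M) where
  toFun F k := rho k.2.1 (rr (rho k.2.2 F)) k.1
  map_add' F G := by ext; simp
  map_smul' c F := by ext; simp

lemma subst3_apply (F : (I × ℤ) × ℤ × ℤ → M) (k : (I × ℤ) × ℤ × ℤ) :
    subst3 F k = rho k.2.1 (rr (rho k.2.2 F)) k.1 := rfl

lemma dd_mem_dom3 {F : (I × ℤ) × ℤ × ℤ → M} (hF : F ∈ dom3) : dd F ∈ dom3 :=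
  ⟨dd_mem_dom hF.1, fun j => by rw [rho_dd hF.1]; exact hF.2 _⟩

lemma rr_rho_e1 {F : (I × ℤ) × ℤ × ℤ → M} (hF : F ∈ dom) (j : ℤ) :
    rr (rho j (e1 F)) = dd (rr (rho j F)) := by
  rw [e1_eq, LinearMap.neg_apply, map_neg, rho_dQR hF, map_neg, rr_dR1, neg_neg]

lemma e1_mem_dom3 {F : (I × ℤ) × ℤ × ℤ → M} (hF : F ∈ dom3) : e1 F ∈ dom3 :=
  ⟨by rw [e1_eq]; exact neg_mem (dQR_mem_dom hF.1), fun j => by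
    rw [rr_rho_e1 hF.1]; exact dd_mem_dom (hF.2 j)⟩

lemma dRP_mem_dom3 {F : (I × ℤ) × ℤ × ℤ → M} (hF : F ∈ dom3) : dRP F ∈ dom3 := by
  rw [dRP_eq]; exact sub_mem (e1_mem_dom3 hF) (dd_mem_dom3 hF)

lemma subst3_dd {F : (I × ℤ) × ℤ × ℤ → M} (hF : F ∈ dom3) : subst3 (dd F) = shQ (subst3 F) := by
  ext k
  rw [subst3_apply, rho_dd hF.1]
  rfl

lemma subst3_e1 {F : (I × ℤ) × ℤ × ℤ → M} (hF : F ∈ dom3) : subst3 (e1 F) = shP (subst3 F) := by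
  ext k
  rw [subst3_apply, rr_rho_e1 hF.1, rho_dd (hF.2 _)]
  rfl

lemma subst3_dRP {F : (I × ℤ) × ℤ × ℤ → M} (hF : F ∈ dom3) : subst3 (dRP F) = dd (subst3 F) := by
  rw [dRP_eq, LinearMap.sub_apply, map_sub, subst3_dd hF, subst3_e1 hF]
  rfl

lemma subst3_pow {D D' : Module.End ℂ ((I × ℤ) × ℤ × ℤ → M)} (hD : ∀ F ∈ dom3, D F ∈ dom3)
    (h : ∀ F ∈ dom3, subst3 (D F) = D' (subst3 F)) {F : (I × ℤ) × ℤ × ℤ → M} (hF : F ∈ dom3)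
    (n : ℕ) : subst3 ((D ^ n) F) = (D' ^ n) (subst3 F) := by
  induction n with
  | zero => rfl
  | succ n ih =>
    rw [pow_succ', pow_succ', Module.End.mul_apply, Module.End.mul_apply,
      h _ (pow_mem_submodule hD hF n), ih]

/-- Three-variable families vanishing when one of the exponents is below the bound. -/
def bdd3 (N : I → ℤ) : Submodule ℂ ((I × ℤ) × ℤ × ℤ → M) where
  carrier := {X | ∀ i p q r, p < N i ∨ q < N i ∨ r < N i → X ((i, p), q, r) = 0}
  add_mem' h h' i p q r hp := by simp [h i p q r hp, h' i p q r hp]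
  zero_mem' := fun _ _ _ _ _ => rfl
  smul_mem' c X h i p q r hp := by simp [h i p q r hp]

lemma e1_mem_bdd3 {N : I → ℤ} {X : (I × ℤ) × ℤ × ℤ → M} (hX : X ∈ bdd3 N) : e1 X ∈ bdd3 N :=
  sub_mem (fun i p q r h => hX i (p - 1) q r (by omega))
    fun i p q r h => hX i p q (r - 1) (by omega)

lemma dd_mem_bdd3 {N : I → ℤ} {X : (I × ℤ) × ℤ × ℤ → M} (hX : X ∈ bdd3 N) : dd X ∈ bdd3 N :=
  sub_mem (fun i p q r h => hX i p (q - 1) r (by omega))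
    fun i p q r h => hX i p q (r - 1) (by omega)

lemma dRP_mem_bdd3 {N : I → ℤ} {X : (I × ℤ) × ℤ × ℤ → M} (hX : X ∈ bdd3 N) : dRP X ∈ bdd3 N := by
  rw [dRP_eq]; exact sub_mem (e1_mem_bdd3 hX) (dd_mem_bdd3 hX)

lemma psAct_dRP_mem_bdd3 {N : I → ℤ} {X : (I × ℤ) × ℤ × ℤ → M} (hX : X ∈ bdd3 N)
    (g : PowerSeries ℂ) : psAct dRP g X ∈ bdd3 N := fun i p q r h =>
  psAct_eq_zero g fun n => pow_mem_submodule (fun _ => dRP_mem_bdd3) hX n i p q r h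

lemma bdd3_le_bdd {N : I → ℤ} {X : (I × ℤ) × ℤ × ℤ → M} (hX : X ∈ bdd3 N) :
    X ∈ bdd fun k : I × ℤ => N k.1 := fun k q r h => hX k.1 k.2 q r (Or.inr h)

lemma rho_of_bdd {J : Type*} {N : J → ℤ} {F : J × ℤ × ℤ → M} (h : F ∈ bdd N) (e : ℤ) :
    rho e F = tau e F := by
  rw [rho_eq (K := 0) h]; simp

lemma rr_rho_mem_bdd {N : I → ℤ} {X : (I × ℤ) × ℤ × ℤ → M} (hX : X ∈ bdd3 N) (j : ℤ) :
    rr (rho j X) ∈ bdd fun i => min (N i) (2 * N i - j) := by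
  rintro i p r h
  simp only [lt_min_iff] at h
  rw [rr_apply, rho_of_bdd (bdd3_le_bdd hX)]
  refine finsum_eq_zero_of_forall_eq_zero fun m => ?_
  simp only
  rw [hX i p m _ (by omega), smul_zero]

lemma bdd3_le_dom3 {N : I → ℤ} {X : (I × ℤ) × ℤ × ℤ → M} (hX : X ∈ bdd3 N) : X ∈ dom3 :=
  ⟨⟨0, _, bdd3_le_bdd hX⟩, fun j => ⟨0, _, rr_rho_mem_bdd hX j⟩⟩

/-- Sum of the entries of total degree `d`, with weights `c`. -/
def wsum (N : I → ℤ) (c : ℤ → ℤ → ℂ) (i : I) (d : ℤ) (X : (I × ℤ) × ℤ × ℤ → M) : M :=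
  ∑ m ∈ Finset.Icc (N i) (d - 2 * N i), ∑ m' ∈ Finset.Icc (N i) (d - 2 * N i),
    c m m' • X ((i, m), m', d - m - m')

lemma finsum_bdd3 {N : I → ℤ} {X : (I × ℤ) × ℤ × ℤ → M} (hX : X ∈ bdd3 N) (c : ℤ → ℤ → ℂ) (i : I)
    (d m : ℤ) : ∑ᶠ m' : ℤ, c m m' • X ((i, m), m', d - m - m') =
      ∑ m' ∈ Finset.Icc (N i) (d - 2 * N i), c m m' • X ((i, m), m', d - m - m') := by
  refine finsum_eq_finsetSum_of_support_subset _ fun m' hm' => ?_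
  by_contra h
  rw [Finset.mem_coe, Finset.mem_Icc] at h
  refine hm' ?_
  simp only
  rw [hX i m m' _ (by omega), smul_zero]

lemma finsum_finsum_bdd3 {N : I → ℤ} {X : (I × ℤ) × ℤ × ℤ → M} (hX : X ∈ bdd3 N)
    (c : ℤ → ℤ → ℂ) (i : I) (d : ℤ) :
    ∑ᶠ m : ℤ, ∑ᶠ m' : ℤ, c m m' • X ((i, m), m', d - m - m') = wsum N c i d X := by
  simp only [finsum_bdd3 hX]
  refine finsum_eq_finsetSum_of_support_subset _ fun m hm => ?_
  by_contra h
  rw [Finset.mem_coe, Finset.mem_Icc] at h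
  refine hm (Finset.sum_eq_zero fun m' hm' => ?_)
  rw [Finset.mem_Icc] at hm'
  rw [hX i m m' _ (by omega), smul_zero]

lemma subst3_eq_wsum {N : I → ℤ} {X : (I × ℤ) × ℤ × ℤ → M} (hX : X ∈ bdd3 N) (i : I)
    (s p q : ℤ) :
    subst3 X ((i, s), p, q) = wsum N (fun m m' => bz m p * bz m' q) i (s + p + q) X := by
  rw [subst3_apply, rho_of_bdd (rr_rho_mem_bdd hX _), rho_of_bdd (bdd3_le_bdd hX),
    ← finsum_finsum_bdd3 hX]
  refine finsum_congr fun m => ?_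
  rw [rr_apply, tau, smul_finsum]
  refine finsum_congr fun m' => ?_
  simp only
  rw [smul_smul]
  congr 3
  ring_nf

/-- Row-finite version of `subst3`. -/
def substN (N : I → ℤ) : Module.End ℂ ((I × ℤ) × ℤ × ℤ → M) where
  toFun X k := wsum N (fun m m' => bz m k.2.1 * bz m' k.2.2) k.1.1 (k.1.2 + k.2.1 + k.2.2) X
  map_add' X Y := by ext; simp [wsum, Finset.sum_add_distrib]
  map_smul' c X := by ext; simp [wsum, Finset.smul_sum, smul_comm c]

lemma rowFinite_substN (N : I → ℤ) : RowFinite (substN N : Module.End ℂ ((I × ℤ) × ℤ × ℤ → M)) := by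
  rintro ⟨⟨i, s⟩, p, q⟩
  set B := Finset.Icc (N i) (s + p + q - 2 * N i)
  refine ⟨(B ×ˢ B).image fun m => ((i, m.1), m.2, s + p + q - m.1 - m.2), fun F hF => ?_⟩
  change wsum N (fun m m' => bz m p * bz m' q) i (s + p + q) F = 0
  rw [wsum]
  refine Finset.sum_eq_zero fun m hm => Finset.sum_eq_zero fun m' hm' => ?_
  rw [hF _ (Finset.mem_image.2 ⟨(m, m'), Finset.mem_product.2 ⟨hm, hm'⟩, rfl⟩), smul_zero]

lemma subst3_eq_substN {N : I → ℤ} {X : (I × ℤ) × ℤ × ℤ → M} (hX : X ∈ bdd3 N) :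
    subst3 X = substN N X := by
  ext ⟨⟨i, s⟩, p, q⟩
  exact subst3_eq_wsum hX i s p q

lemma subst3_psAct {N : I → ℤ} {X : (I × ℤ) × ℤ × ℤ → M} (hX : X ∈ bdd3 N)
    (hXn : NullFam dRP X) (g : PowerSeries ℂ) :
    subst3 (psAct dRP g X) = psAct dd g (subst3 X) := by
  rw [subst3_eq_substN (psAct_dRP_mem_bdd3 hX g), subst3_eq_substN hX]
  refine psAct_map_on hXn (rowFinite_substN N) (P := bdd3 N) (fun _ => dRP_mem_bdd3) ?_ hX g
  intro F hF
  rw [← subst3_eq_substN hF, ← subst3_eq_substN (dRP_mem_bdd3 hF), subst3_dRP (bdd3_le_dom3 hF)]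

/-- Exchange of the parameter exponent and the first exponent. -/
def swapRP : Module.End ℂ ((I × ℤ) × ℤ × ℤ → M) := pull fun k => ((k.1.1, k.2.1), k.1.2, k.2.2)

/-- Exchange of the two exponents. -/
def swapPQ {J : Type*} : Module.End ℂ (J × ℤ × ℤ → M) := pull fun k => (k.1, k.2.2, k.2.1)

lemma swapRP_e1 (F : (I × ℤ) × ℤ × ℤ → M) : swapRP (e1 F) = dd (swapRP F) := rfl

lemma swapRP_dd (F : (I × ℤ) × ℤ × ℤ → M) : swapRP (dd F) = e1 (swapRP F) := rfl

lemma swapRP_mem_bdd3 {N : I → ℤ} {X : (I × ℤ) × ℤ × ℤ → M} (hX : X ∈ bdd3 N) :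
    swapRP X ∈ bdd3 N := fun i p q r h => hX i q p r (by omega)

lemma subst3_swap {N : I → ℤ} {X : (I × ℤ) × ℤ × ℤ → M} (hX : X ∈ bdd3 N) :
    subst3 (swapRP X) = swapPQ (subst3 X) := by
  ext ⟨⟨i, s⟩, p, q⟩
  rw [subst3_eq_wsum (swapRP_mem_bdd3 hX)]
  change _ = subst3 X ((i, s), q, p)
  rw [subst3_eq_wsum hX, wsum, wsum, Finset.sum_comm, show s + q + p = s + p + q by ring]
  refine Finset.sum_congr rfl fun m _ => Finset.sum_congr rfl fun m' _ => ?_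
  rw [mul_comm]
  congr 1
  change X ((i, m), m', _) = _
  rw [show s + p + q - m' - m = s + p + q - m - m' by ring]

end Triple

end NVA

namespace NVA

/-! ### Comparison of products of operators with products of vertex operators -/

section Comp

variable {W V : Type*} [AddCommGroup W] [Module ℂ W] [AddCommGroup V] [Module ℂ V]

/-- Let a two-variable family act on the modes of `c`. -/
def sub3 (c : EW W) : (W × ℤ × ℤ → W) →ₗ[ℂ] ((W × ℤ) × ℤ × ℤ → W) :=
  pull fun k => (mf c k.1.1 (-k.2.2 - 1), k.1.2, k.2.1)

lemma rowFinite_sub3 (c : EW W) : RowFinite (sub3 c) := rowFinite_famMap _ _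

lemma sub3_dd (c : EW W) (G : W × ℤ × ℤ → W) : sub3 c (dd G) = dRP (sub3 c G) := rfl

lemma sub3_AB (a b c : EW W) : sub3 c (AB a b) = tripL a (AB b c) := rfl

/-- The mode of a field at a fixed vector, as a linear map in the field. -/
def modeL (w : W) (n : ℤ) : EW W →ₗ[ℂ] W where
  toFun a := mf a w n
  map_add' _ _ := rfl
  map_smul' _ _ := rfl

@[simp] lemma modeL_apply (w : W) (n : ℤ) (a : EW W) : modeL w n a = mf a w n := rfl

variable (ι : V →ₗ[ℂ] EW W)

/-- Evaluate a family of fields at `c`, and expand in modes. -/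
def til (c : V) : (V × ℤ × ℤ → V) →ₗ[ℂ] ((W × ℤ) × ℤ × ℤ → W) :=
  lift2 (fun _ => c) fun k => modeL k.1 (-k.2 - 1) ∘ₗ ι

lemma til_apply (c : V) (Ψ : V × ℤ × ℤ → V) (w : W) (s p q : ℤ) :
    til ι c Ψ ((w, s), p, q) = mf (ι (Ψ (c, p, q))) w (-s - 1) := rfl

/-- `sub3`, followed by multiplication by a power of the differences with the last variable. -/
def compL (c : EW W) (K : ℕ) : (W × ℤ × ℤ → W) →ₗ[ℂ] ((W × ℤ) × ℤ × ℤ → W) :=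
  ((e1 * dd : Module.End ℂ ((W × ℤ) × ℤ × ℤ → W)) ^ K) ∘ₗ sub3 c

/-- `til`, followed by multiplication by a power of the variables. -/
def compR (c : V) (K : ℕ) : (V × ℤ × ℤ → V) →ₗ[ℂ] ((W × ℤ) × ℤ × ℤ → W) :=
  ((shP * shQ : Module.End ℂ ((W × ℤ) × ℤ × ℤ → W)) ^ K) ∘ₗ til ι c

lemma compL_succ (c : EW W) (K : ℕ) (G : W × ℤ × ℤ → W) :
    compL c (K + 1) G = e1 (dd (compL c K G)) := by
  rw [compL, pow_succ']; rfl

lemma compR_succ (c : V) (K : ℕ) (Ψ : V × ℤ × ℤ → V) :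
    compR ι c (K + 1) Ψ = shP (shQ (compR ι c K Ψ)) := by
  rw [compR, pow_succ']; rfl

lemma compL_dd (c : EW W) (K : ℕ) (G : W × ℤ × ℤ → W) :
    compL c K (dd G) = dRP (compL c K G) :=
  congrArg (fun T : Module.End ℂ ((W × ℤ) × ℤ × ℤ → W) => T (sub3 c G))
    ((commute_e1_dRP.mul_left commute_dd_dRP).pow_left K)

lemma commute_shP_dd {J M : Type*} [AddCommGroup M] [Module ℂ M] :
    Commute (shP : Module.End ℂ (J × ℤ × ℤ → M)) dd :=
  (Commute.refl _).sub_right rfl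

lemma commute_shQ_dd {J M : Type*} [AddCommGroup M] [Module ℂ M] :
    Commute (shQ : Module.End ℂ (J × ℤ × ℤ → M)) dd :=
  Commute.sub_right rfl (Commute.refl _)

lemma compR_dd (c : V) (K : ℕ) (Ψ : V × ℤ × ℤ → V) :
    compR ι c K (dd Ψ) = dd (compR ι c K Ψ) := by
  rw [compR, LinearMap.comp_apply, til, lift2_dd]
  exact congrArg (fun T : Module.End ℂ ((W × ℤ) × ℤ × ℤ → W) => T (til ι c Ψ))
    ((commute_shP_dd.mul_left commute_shQ_dd).pow_left K)

lemma rowFinite_compL (c : EW W) (K : ℕ) : RowFinite (compL c K) :=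
  RowFinite.comp (S := (e1 * dd : Module.End ℂ ((W × ℤ) × ℤ × ℤ → W)) ^ K)
    (RowFinite.pow (RowFinite.comp rowFinite_e1 rowFinite_dd) K) (rowFinite_sub3 c)

lemma rowFinite_compR (c : V) (K : ℕ) : RowFinite (compR ι c K) :=
  RowFinite.comp (S := (shP * shQ : Module.End ℂ ((W × ℤ) × ℤ × ℤ → W)) ^ K)
    (RowFinite.pow (RowFinite.comp rowFinite_shP rowFinite_shQ) K) (rowFinite_famMap _ _)

/-- `Ψ` is the family of vertex operators corresponding to the family of operators `G`. -/
def Comp (G : W × ℤ × ℤ → W) (Ψ : V × ℤ × ℤ → V) : Prop :=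
  ∀ c : V, ∃ K₀ : ℕ, ∃ N : W → ℤ, ∀ K, K₀ ≤ K →
    compL (ι c) K G ∈ bdd3 N ∧ subst3 (compL (ι c) K G) = compR ι c K Ψ

variable {ι}

lemma Comp.of_exists {G : W × ℤ × ℤ → W} {Ψ : V × ℤ × ℤ → V}
    (h : ∀ c : V, ∃ K : ℕ, ∃ N : W → ℤ,
      compL (ι c) K G ∈ bdd3 N ∧ subst3 (compL (ι c) K G) = compR ι c K Ψ) : Comp ι G Ψ := by
  intro c
  obtain ⟨K₀, N, h⟩ := h c
  refine ⟨K₀, N, fun K hK => ?_⟩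
  induction K, hK using Nat.le_induction with
  | base => exact h
  | succ K _ ih =>
    rw [compL_succ, compR_succ, subst3_e1 (bdd3_le_dom3 (dd_mem_bdd3 ih.1)),
      subst3_dd (bdd3_le_dom3 ih.1), ih.2]
    exact ⟨e1_mem_bdd3 (dd_mem_bdd3 ih.1), rfl⟩

lemma bdd3_anti {I M : Type*} [AddCommGroup M] [Module ℂ M] {N N' : I → ℤ} (h : N' ≤ N)
    {X : (I × ℤ) × ℤ × ℤ → M} (hX : X ∈ bdd3 N) : X ∈ bdd3 N' := fun i p q r hp =>
  hX i p q r (by have : N' i ≤ N i := h i; omega)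

lemma Comp.zero : Comp ι 0 (0 : V × ℤ × ℤ → V) := fun c => ⟨0, 0, fun K _ => by
  rw [map_zero, map_zero, map_zero]; exact ⟨zero_mem _, rfl⟩⟩

lemma Comp.add {G G' : W × ℤ × ℤ → W} {Ψ Ψ' : V × ℤ × ℤ → V} (h : Comp ι G Ψ)
    (h' : Comp ι G' Ψ') : Comp ι (G + G') (Ψ + Ψ') := by
  intro c
  obtain ⟨K, N, h⟩ := h c
  obtain ⟨K', N', h'⟩ := h' c
  refine ⟨max K K', N ⊓ N', fun L hL => ?_⟩
  specialize h L (le_of_max_le_left hL)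
  specialize h' L (le_of_max_le_right hL)
  rw [map_add, map_add, map_add, h.2, h'.2]
  exact ⟨add_mem (bdd3_anti inf_le_left h.1) (bdd3_anti inf_le_right h'.1), rfl⟩

lemma Comp.smul {G : W × ℤ × ℤ → W} {Ψ : V × ℤ × ℤ → V} (h : Comp ι G Ψ) (x : ℂ) :
    Comp ι (x • G) (x • Ψ) := by
  intro c
  obtain ⟨K, N, h⟩ := h c
  refine ⟨K, N, fun L hL => ?_⟩
  specialize h L hL
  rw [map_smul, map_smul, map_smul, h.2]
  exact ⟨Submodule.smul_mem _ x h.1, rfl⟩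

lemma Comp.dd {G : W × ℤ × ℤ → W} {Ψ : V × ℤ × ℤ → V} (h : Comp ι G Ψ) :
    Comp ι (dd G) (dd Ψ) := by
  intro c
  obtain ⟨K, N, h⟩ := h c
  refine ⟨K, N, fun L hL => ?_⟩
  specialize h L hL
  rw [compL_dd, compR_dd, subst3_dRP (bdd3_le_dom3 h.1), h.2]
  exact ⟨dRP_mem_bdd3 h.1, rfl⟩

lemma Comp.dd_pow {G : W × ℤ × ℤ → W} {Ψ : V × ℤ × ℤ → V} (h : Comp ι G Ψ) (n : ℕ) :
    Comp ι ((NVA.dd ^ n) G) ((NVA.dd ^ n) Ψ) := by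
  induction n with
  | zero => exact h
  | succ n ih => rw [pow_succ', pow_succ']; exact ih.dd

lemma Comp.psAct {G : W × ℤ × ℤ → W} {Ψ : V × ℤ × ℤ → V} (h : Comp ι G Ψ)
    (hG : NullFam NVA.dd G) (hΨ : NullFam NVA.dd Ψ) (g : PowerSeries ℂ) :
    Comp ι (psAct NVA.dd g G) (psAct NVA.dd g Ψ) := by
  intro c
  obtain ⟨K, N, h⟩ := h c
  refine ⟨K, N, fun L hL => ?_⟩
  specialize h L hL
  rw [psAct_map hG (rowFinite_compL _ _) (compL_dd _ _),
    psAct_map hΨ (rowFinite_compR _ _ _) (compR_dd _ _ _), subst3_psAct h.1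
    (hG.map (rowFinite_compL _ _) (compL_dd _ _)), h.2]
  exact ⟨psAct_dRP_mem_bdd3 h.1 g, rfl⟩

lemma compL_swapPQ (c : EW W) (K : ℕ) (G : W × ℤ × ℤ → W) :
    compL c K (swapPQ G) = swapRP (compL c K G) := by
  induction K with
  | zero => rfl
  | succ K ih =>
    rw [compL_succ, compL_succ, ih, swapRP_e1, swapRP_dd]
    exact (congrArg (fun T : Module.End ℂ ((W × ℤ) × ℤ × ℤ → W) => T _) commute_e1_dd)

lemma compR_swapPQ (c : V) (K : ℕ) (Ψ : V × ℤ × ℤ → V) :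
    compR ι c K (swapPQ Ψ) = swapPQ (compR ι c K Ψ) := by
  induction K with
  | zero => rfl
  | succ K ih => rw [compR_succ, compR_succ, ih]; rfl

lemma Comp.swap {G : W × ℤ × ℤ → W} {Ψ : V × ℤ × ℤ → V} (h : Comp ι G Ψ) :
    Comp ι (swapPQ G) (swapPQ Ψ) := by
  intro c
  obtain ⟨K, N, h⟩ := h c
  refine ⟨K, N, fun L hL => ?_⟩
  specialize h L hL
  rw [compL_swapPQ, compR_swapPQ, subst3_swap h.1, h.2]
  exact ⟨swapRP_mem_bdd3 h.1, rfl⟩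

lemma shP_injective {J M : Type*} [AddCommGroup M] [Module ℂ M] :
    Function.Injective (shP : Module.End ℂ (J × ℤ × ℤ → M)) := fun F G h => by
  ext ⟨j, p, q⟩
  have := congrFun h (j, p + 1, q)
  simpa using this

lemma shQ_injective {J M : Type*} [AddCommGroup M] [Module ℂ M] :
    Function.Injective (shQ : Module.End ℂ (J × ℤ × ℤ → M)) := fun F G h => by
  ext ⟨j, p, q⟩
  have := congrFun h (j, p, q + 1)
  simpa using this

lemma Comp.unique (hι : Function.Injective ι) {G : W × ℤ × ℤ → W} {Ψ Ψ' : V × ℤ × ℤ → V}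
    (h : Comp ι G Ψ) (h' : Comp ι G Ψ') : Ψ = Ψ' := by
  ext ⟨c, p, q⟩
  obtain ⟨K, N, h⟩ := h c
  obtain ⟨K', N', h'⟩ := h' c
  have hh := (h _ (le_max_left K K')).2.symm.trans (h' _ (le_max_right K K')).2
  generalize max K K' = L at hh
  have ht : til ι c Ψ = til ι c Ψ' := by
    induction L with
    | zero => exact hh
    | succ L ih =>
      rw [compR_succ, compR_succ] at hh
      exact ih (shQ_injective (shP_injective hh))
  refine hι (ew_ext ?_)
  intro w m
  have := congrFun ht ((w, -m - 1), p, q)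
  rw [til_apply, til_apply] at this
  simpa using this

end Comp

end NVA

namespace NVA

section Van

variable {I M : Type*} [AddCommGroup M] [Module ℂ M]

/-- Closure of a set of exponents under decreasing the exponents. -/
def Down (P : Set ((I × ℤ) × ℤ × ℤ)) : Prop :=
  ∀ i p q r, ((i, p), q, r) ∈ P →
    ((i, p - 1), q, r) ∈ P ∧ ((i, p), q - 1, r) ∈ P ∧ ((i, p), q, r - 1) ∈ P

/-- Families vanishing on a set of exponents. -/
def van (P : Set ((I × ℤ) × ℤ × ℤ)) : Submodule ℂ ((I × ℤ) × ℤ × ℤ → M) where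
  carrier := {X | ∀ k ∈ P, X k = 0}
  add_mem' h h' k hk := by simp [h k hk, h' k hk]
  zero_mem' := fun _ _ => rfl
  smul_mem' c X h k hk := by simp [h k hk]

variable {P : Set ((I × ℤ) × ℤ × ℤ)} {X : (I × ℤ) × ℤ × ℤ → M}

lemma van_fst_anti {N N' : I → ℤ} (h : N' ≤ N) (hX : X ∈ van {k | k.1.2 < N k.1.1}) :
    X ∈ van {k | k.1.2 < N' k.1.1} :=
  fun k hk => hX k (lt_of_lt_of_le (show k.1.2 < N' k.1.1 from hk) (h k.1.1))

lemma e1_mem_van (hP : Down P) (X : (I × ℤ) × ℤ × ℤ → M) (hX : X ∈ van P) : e1 X ∈ van P :=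
  sub_mem (fun _ hk => hX _ (hP _ _ _ _ hk).1) fun _ hk => hX _ (hP _ _ _ _ hk).2.2

lemma dd_mem_van (hP : Down P) (X : (I × ℤ) × ℤ × ℤ → M) (hX : X ∈ van P) : dd X ∈ van P :=
  sub_mem (fun _ hk => hX _ (hP _ _ _ _ hk).2.1) fun _ hk => hX _ (hP _ _ _ _ hk).2.2

lemma dRP_mem_van (hP : Down P) (X : (I × ℤ) × ℤ × ℤ → M) (hX : X ∈ van P) : dRP X ∈ van P := by
  rw [dRP_eq]; exact sub_mem (e1_mem_van hP X hX) (dd_mem_van hP X hX)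

lemma e1_pow_mem_van (hP : Down P) (hX : X ∈ van P) (n : ℕ) : (e1 ^ n) X ∈ van P :=
  pow_mem_submodule (e1_mem_van hP) hX n

lemma dd_pow_mem_van (hP : Down P) (hX : X ∈ van P) (n : ℕ) : (dd ^ n) X ∈ van P :=
  pow_mem_submodule (dd_mem_van hP) hX n

lemma dRP_pow_mem_van (hP : Down P) (hX : X ∈ van P) (n : ℕ) : (dRP ^ n) X ∈ van P :=
  pow_mem_submodule (dRP_mem_van hP) hX n

lemma psAct_dRP_mem_van (hP : Down P) (hX : X ∈ van P) (g : PowerSeries ℂ) :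
    psAct dRP g X ∈ van P := fun k hk =>
  psAct_eq_zero g fun n => pow_mem_submodule (dRP_mem_van hP) hX n k hk

lemma down_fst (N : I → ℤ) : Down {k : (I × ℤ) × ℤ × ℤ | k.1.2 < N k.1.1} :=
  fun i p _ _ h => ⟨show p - 1 < N i from (sub_one_lt p).trans h, h, h⟩

lemma down_snd (N : I → ℤ) : Down {k : (I × ℤ) × ℤ × ℤ | k.2.1 < N k.1.1} :=
  fun i _ q _ h => ⟨h, show q - 1 < N i from (sub_one_lt q).trans h, h⟩

lemma down_trd (N : I → ℤ) : Down {k : (I × ℤ) × ℤ × ℤ | k.2.2 < N k.1.1} :=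
  fun i _ _ r h => ⟨h, h, show r - 1 < N i from (sub_one_lt r).trans h⟩

lemma mem_bdd3_of_van {N₁ N₂ N₃ : I → ℤ} (h₁ : X ∈ van {k | k.1.2 < N₁ k.1.1})
    (h₂ : X ∈ van {k | k.2.1 < N₂ k.1.1}) (h₃ : X ∈ van {k | k.2.2 < N₃ k.1.1}) :
    X ∈ bdd3 (N₁ ⊓ N₂ ⊓ N₃) := by
  rintro i p q r h
  simp only [Pi.inf_apply, lt_inf_iff] at h
  rcases h with h | h | h
  · exact h₁ _ h.1.1
  · exact h₂ _ h.1.2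
  · exact h₃ _ h.2

end Van

section CompAB

variable {W V : Type*} [AddCommGroup W] [Module ℂ W] [AddCommGroup V] [Module ℂ V]

lemma compL_eq (c : EW W) (K : ℕ) (G : W × ℤ × ℤ → W) :
    compL c K G = (e1 ^ K) ((dd ^ K) (sub3 c G)) := by
  rw [compL, commute_e1_dd.mul_pow]; rfl

lemma compL_eq' (c : EW W) (K : ℕ) (G : W × ℤ × ℤ → W) :
    compL c K G = (dd ^ K) ((e1 ^ K) (sub3 c G)) := by
  rw [compL, commute_e1_dd.mul_pow, (commute_e1_dd.pow_pow K K).eq]; rfl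

lemma sub3_dd_pow (c : EW W) (n : ℕ) (G : W × ℤ × ℤ → W) :
    sub3 c ((dd ^ n) G) = (dRP ^ n) (sub3 c G) := pow_intertwine (sub3_dd c) n G

lemma e1_pow_sub3_BA (u v c : EW W) (K : ℕ) (w : W) (p q r : ℤ) :
    (e1 ^ K) (sub3 c (BA u v)) ((w, p), q, r) = mf u ((dd ^ K) (AB v c) (w, p, r)) (-q - 1) := by
  have h := pow_intertwine (D := dd) (D' := e1)
    (T := famMap (fun k : (W × ℤ) × ℤ × ℤ => (k.1.1, k.1.2, k.2.2)) fun k => mfL u (-k.2.1 - 1))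
    (fun F => by ext k; simp [e1, dd, shR, shP, shQ, famMap, map_sub]) K (AB v c)
  exact (congrFun h ((w, p), q, r)).symm

lemma exists_e1_pow_van {A : Set (EW W)} {c : EW W} (hc : ∀ v ∈ A, AB v c ∈ dom)
    {G : W × ℤ × ℤ → W} (hG : G ∈ PS dd (BASet A A)) :
    ∃ (K₀ : ℕ) (N : W → ℤ), ∀ K, K₀ ≤ K → (e1 ^ K) (sub3 c G) ∈ van {k | k.1.2 < N k.1.1} := by
  refine PS_induction (p := fun G => ∃ (K₀ : ℕ) (N : W → ℤ), ∀ K, K₀ ≤ K →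
    (e1 ^ K) (sub3 c G) ∈ van {k | k.1.2 < N k.1.1}) ?_ ?_ ?_ ?_ hG
  · exact ⟨0, 0, fun K _ => by rw [map_zero, map_zero]; exact zero_mem _⟩
  · rintro F G ⟨K, N, h⟩ ⟨K', N', h'⟩
    refine ⟨max K K', N ⊓ N', fun L hL => ?_⟩
    rw [map_add, map_add]
    exact add_mem (van_fst_anti inf_le_left (h L (le_of_max_le_left hL)))
      (van_fst_anti inf_le_right (h' L (le_of_max_le_right hL)))
  · rintro x F ⟨K, N, h⟩
    refine ⟨K, N, fun L hL => ?_⟩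
    rw [map_smul, map_smul]
    exact Submodule.smul_mem _ x (h L hL)
  · rintro g _ ⟨u, hu, v, hv, rfl⟩
    obtain ⟨K, N, h⟩ := hc v hv
    refine ⟨K, N, fun L hL => ?_⟩
    have hn := nullFam_BASet A A _ ⟨u, hu, v, hv, rfl⟩
    have e := psAct_map hn (T := (e1 ^ L : Module.End ℂ ((W × ℤ) × ℤ × ℤ → W)) ∘ₗ sub3 c)
      (RowFinite.comp (RowFinite.pow rowFinite_e1 L) (rowFinite_sub3 c))
      (D' := dRP) (fun F => congrArg (fun T : Module.End ℂ ((W × ℤ) × ℤ × ℤ → W) => T (sub3 c F))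
        (commute_e1_dRP.pow_left L)) g
    rw [LinearMap.comp_apply] at e
    rw [e]
    refine psAct_dRP_mem_van (down_fst N) ?_ g
    rintro ⟨⟨w, p⟩, q, r⟩ hk
    rw [LinearMap.comp_apply, e1_pow_sub3_BA,
      dd_pow_mem_of_le h hL w p r (Or.inl hk), mf_zero_right]

lemma dd_pow_tripL_mem_van {b c : EW W} (h : AB b c ∈ dom) (a : EW W) :
    ∃ (K₀ : ℕ) (N : W → ℤ), ∀ K, K₀ ≤ K →
      (dd ^ K) (tripL a (AB b c)) ∈ van {k | k.2.1 < N k.1.1} := by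
  obtain ⟨K, N, h⟩ := h
  refine ⟨K, N, fun L hL => ?_⟩
  rw [tripL, ← lift2_dd_pow]
  rintro ⟨⟨w, p⟩, q, r⟩ hk
  rw [lift2_apply]
  simp only
  rw [dd_pow_mem_of_le h hL w q r (Or.inl hk), map_zero]

lemma tripL_mem_van (a b c : EW W) :
    ∃ N : W → ℤ, tripL a (AB b c) ∈ van {k | k.2.2 < N k.1.1} := by
  choose N hN using mf_trunc c
  refine ⟨N, ?_⟩
  rintro ⟨⟨w, p⟩, q, r⟩ hk
  change mf a (mf b (mf c w (-r - 1)) (-q - 1)) (-p - 1) = 0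
  rw [hN w r hk, mf_zero_right, mf_zero_right]

lemma exists_compL_mem_bdd3 {A : Set (EW W)} {a b c : EW W} (hc : ∀ v ∈ A, AB v c ∈ dom)
    (hbc : AB b c ∈ dom) {k : ℕ} (h : (dd ^ k) (AB a b) ∈ PS dd (BASet A A)) :
    ∃ (K : ℕ) (N : W → ℤ), compL c K ((dd ^ k) (AB a b)) ∈ bdd3 N := by
  obtain ⟨K₁, N₁, h₁⟩ := exists_e1_pow_van hc h
  obtain ⟨K₂, N₂, h₂⟩ := dd_pow_tripL_mem_van hbc a
  obtain ⟨N₃, h₃⟩ := tripL_mem_van a b c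
  refine ⟨max K₁ K₂, N₁ ⊓ N₂ ⊓ N₃, mem_bdd3_of_van ?_ ?_ ?_⟩
  · rw [compL_eq']
    exact dd_pow_mem_van (down_fst N₁) (h₁ _ (le_max_left _ _)) _
  · rw [compL_eq, sub3_dd_pow,
      ← Module.End.mul_apply (f := dd ^ _), (commute_dd_dRP.pow_pow _ _).eq]
    exact e1_pow_mem_van (down_snd N₂)
      (dRP_pow_mem_van (down_snd N₂) (h₂ _ (le_max_right _ _)) _) _
  · rw [compL_eq, sub3_dd_pow, sub3_AB]
    exact e1_pow_mem_van (down_trd N₃)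
      (dd_pow_mem_van (down_trd N₃) (dRP_pow_mem_van (down_trd N₃) h₃ _) _) _

variable {ι : V →ₗ[ℂ] EW W} {Y : V →ₗ[ℂ] EW V}

lemma rr_rho_tripL (a : EW W) {b c : EW W} (h : AB b c ∈ dom) (j : ℤ) :
    rr (rho j (tripL a (AB b c))) = AB a (YE b c (-j - 1)) := by
  ext ⟨w, p, q⟩
  rw [rr_apply, rho_tripL a h]

lemma tripL_mem_dom3 (hY : ∀ a b n, ι (mf (Y a) b n) = YE (ι a) (ι b) n)
    (hd : ∀ a b, AB (ι a) (ι b) ∈ dom) (a b c : V) :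
    tripL (ι a) (AB (ι b) (ι c)) ∈ dom3 :=
  ⟨lift2_mem_dom _ _ (hd b c), fun j => by
    rw [rr_rho_tripL _ (hd b c), ← hY]; exact hd _ _⟩

lemma subst3_tripL (hY : ∀ a b n, ι (mf (Y a) b n) = YE (ι a) (ι b) n)
    (hd : ∀ a b, AB (ι a) (ι b) ∈ dom) (a b c : V) :
    subst3 (tripL (ι a) (AB (ι b) (ι c))) = til ι c (AB (Y a) (Y b)) := by
  ext ⟨⟨w, s⟩, i, j⟩
  rw [subst3_apply, rr_rho_tripL _ (hd b c), til_apply, AB_apply, hY, ← hY, rho_AB (hd _ _)]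

lemma comp_dd_pow_AB (hY : ∀ a b n, ι (mf (Y a) b n) = YE (ι a) (ι b) n)
    (hd : ∀ a b, AB (ι a) (ι b) ∈ dom) {a b : V} {k : ℕ}
    (h : (dd ^ k) (AB (ι a) (ι b)) ∈ PS dd (BASet (Set.range ι) (Set.range ι))) :
    Comp ι ((dd ^ k) (AB (ι a) (ι b))) ((dd ^ k) (AB (Y a) (Y b))) := by
  refine Comp.of_exists fun c => ?_
  obtain ⟨K, N, hK⟩ := exists_compL_mem_bdd3 (c := ι c)
    (by rintro _ ⟨v, rfl⟩; exact hd v c) (hd b c) h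
  refine ⟨K, N, hK, ?_⟩
  have h3 := tripL_mem_dom3 hY hd a b c
  rw [compL, LinearMap.comp_apply, sub3_dd_pow, sub3_AB,
    subst3_pow (D := e1 * dd) (D' := shP * shQ) (fun F hF => e1_mem_dom3 (dd_mem_dom3 hF))
      (fun F hF => by
        rw [Module.End.mul_apply, subst3_e1 (dd_mem_dom3 hF), subst3_dd hF]; rfl)
      (pow_mem_submodule (fun _ => dRP_mem_dom3) h3 k),
    subst3_pow (fun _ => dRP_mem_dom3) (fun _ => subst3_dRP) h3, subst3_tripL hY hd, compR,
    LinearMap.comp_apply, til, lift2_dd_pow]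

lemma swapPQ_dd_pow {J M : Type*} [AddCommGroup M] [Module ℂ M] (n : ℕ) (F : J × ℤ × ℤ → M) :
    swapPQ ((dd ^ n) F) = (-1 : ℂ) ^ n • (dd ^ n) (swapPQ F) := by
  rw [pow_intertwine (D' := -dd) (T := swapPQ) (fun F => by ext k; simp [swapPQ, dd, pull, famMap])]
  rcases Nat.even_or_odd n with h | h <;>
    simp [h.neg_pow (dd : Module.End ℂ (J × ℤ × ℤ → M)), h.neg_one_pow]

lemma comp_dd_pow_BA (hY : ∀ a b n, ι (mf (Y a) b n) = YE (ι a) (ι b) n)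
    (hd : ∀ a b, AB (ι a) (ι b) ∈ dom) {a b : V} {k : ℕ}
    (h : (dd ^ k) (AB (ι a) (ι b)) ∈ PS dd (BASet (Set.range ι) (Set.range ι))) :
    Comp ι ((dd ^ k) (BA (ι a) (ι b))) ((dd ^ k) (BA (Y a) (Y b))) := by
  have := ((comp_dd_pow_AB hY hd h).swap).smul ((-1) ^ k)
  rwa [swapPQ_dd_pow, swapPQ_dd_pow, smul_smul, smul_smul, ← mul_pow, neg_one_mul, neg_neg,
    one_pow, one_smul, one_smul] at this

lemma nullFam_dd_pow {J M : Type*} [AddCommGroup M] [Module ℂ M] {F : J × ℤ × ℤ → M}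
    (hF : NullFam dd F) (n : ℕ) : NullFam dd ((dd ^ n) F) :=
  hF.map (RowFinite.pow rowFinite_dd n) fun F =>
    congrArg (fun T : Module.End ℂ (J × ℤ × ℤ → M) => T F) ((Commute.refl dd).pow_left n)

lemma dd_pow_psAct {J M : Type*} [AddCommGroup M] [Module ℂ M] {F : J × ℤ × ℤ → M}
    (hF : NullFam dd F) (g : PowerSeries ℂ) (n : ℕ) :
    (dd ^ n) (psAct dd g F) = psAct dd g ((dd ^ n) F) :=
  psAct_map hF (RowFinite.pow rowFinite_dd n) (fun F =>
    congrArg (fun T : Module.End ℂ (J × ℤ × ℤ → M) => T F) ((Commute.refl dd).pow_left n)) g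

lemma exists_comp (hY : ∀ a b n, ι (mf (Y a) b n) = YE (ι a) (ι b) n)
    (hL : ∀ a b, Loc (Set.range ι) (Set.range ι) (ι a) (ι b)) {G : W × ℤ × ℤ → W}
    (hG : G ∈ PS dd (BASet (Set.range ι) (Set.range ι))) :
    ∃ L₀ : ℕ, ∀ L, L₀ ≤ L → ∃ Ψ ∈ PS dd (BASet (Set.range Y) (Set.range Y)),
      Comp ι ((dd ^ L) G) Ψ := by
  have hd : ∀ a b, AB (ι a) (ι b) ∈ dom := fun a b => (hL a b).mem_dom
  refine PS_induction (p := fun G => ∃ L₀ : ℕ, ∀ L, L₀ ≤ L →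
    ∃ Ψ ∈ PS dd (BASet (Set.range Y) (Set.range Y)), Comp ι ((dd ^ L) G) Ψ) ?_ ?_ ?_ ?_ hG
  · exact ⟨0, fun L _ => ⟨0, zero_mem _, by rw [map_zero]; exact Comp.zero⟩⟩
  · rintro F G ⟨L, h⟩ ⟨L', h'⟩
    refine ⟨max L L', fun K hK => ?_⟩
    obtain ⟨Ψ, hΨ, hc⟩ := h K (le_of_max_le_left hK)
    obtain ⟨Ψ', hΨ', hc'⟩ := h' K (le_of_max_le_right hK)
    exact ⟨Ψ + Ψ', add_mem hΨ hΨ', by rw [map_add]; exact hc.add hc'⟩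
  · rintro x F ⟨L, h⟩
    refine ⟨L, fun K hK => ?_⟩
    obtain ⟨Ψ, hΨ, hc⟩ := h K hK
    exact ⟨x • Ψ, Submodule.smul_mem _ x hΨ, by rw [map_smul]; exact hc.smul x⟩
  · rintro g _ ⟨_, ⟨u, rfl⟩, _, ⟨v, rfl⟩, rfl⟩
    obtain ⟨k, hk⟩ := hL u v
    refine ⟨k, fun K hK => ⟨(dd ^ K) (psAct dd g (BA (Y u) (Y v))), ?_, ?_⟩⟩
    · exact PS_pow_mem (nullFam_BASet _ _) rowFinite_dd K
        (psAct_mem_PS g ⟨_, ⟨u, rfl⟩, _, ⟨v, rfl⟩, rfl⟩)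
    · have n2 : NullFam dd (BA (Y u) (Y v)) :=
        nullFam_BASet (Set.range Y) (Set.range Y) _ ⟨_, ⟨u, rfl⟩, _, ⟨v, rfl⟩, rfl⟩
      have n1 : NullFam dd (BA (ι u) (ι v)) :=
        nullFam_BASet (Set.range ι) (Set.range ι) _ ⟨_, ⟨u, rfl⟩, _, ⟨v, rfl⟩, rfl⟩
      rw [dd_pow_psAct n1, dd_pow_psAct n2]
      exact (comp_dd_pow_BA hY hd (Loc.pow_mem hk hK)).psAct (nullFam_dd_pow n1 K)
        (nullFam_dd_pow n2 K) g

/-- The vertex operators inherit the locality of the fields. -/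
lemma loc_vertexOperators (hι : Function.Injective ι)
    (hY : ∀ a b n, ι (mf (Y a) b n) = YE (ι a) (ι b) n)
    (hL : ∀ a b, Loc (Set.range ι) (Set.range ι) (ι a) (ι b)) (a b : V) :
    Loc (Set.range Y) (Set.range Y) (Y a) (Y b) := by
  have hd : ∀ a b, AB (ι a) (ι b) ∈ dom := fun a b => (hL a b).mem_dom
  obtain ⟨k, hk⟩ := hL a b
  obtain ⟨L, h⟩ := exists_comp hY hL hk
  obtain ⟨Ψ, hΨ, hc⟩ := h L le_rfl
  refine ⟨L + k, ?_⟩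
  rw [pow_add, Module.End.mul_apply, ← hc.unique hι ((comp_dd_pow_AB hY hd hk).dd_pow L)]
  exact hΨ

end CompAB

end NVA

namespace NVA

lemma binom_eq_choose (m : ℤ) (j : ℕ) : binom m j = ((Ring.choose m j : ℤ) : ℂ) := by
  induction m using Int.induction_on generalizing j with
  | zero =>
    cases j with
    | zero => simp [binom_zero_right]
    | succ j =>
      rw [Ring.choose_zero_succ, ← bz_natCast, bz_zero_left, if_neg (by omega), Int.cast_zero]
  | succ i ih =>
    cases j with
    | zero => simp [binom_zero_right]
    | succ j => rw [binom_succ_succ, Ring.choose_succ_succ, ih, ih, Int.cast_add, add_comm]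
  | pred i ih =>
    induction j with
    | zero => simp [binom_zero_right]
    | succ j hj =>
      have h1 := ih (j + 1)
      rw [← sub_add_cancel (-(i : ℤ)) 1, binom_succ_succ, Ring.choose_succ_succ, hj,
        Int.cast_add, add_comm] at h1
      exact add_left_cancel h1

lemma sum_bz_mul_bz (m m' e t : ℤ) :
    ∑ p ∈ Finset.Icc 0 (t + e), bz p e * (bz m p * bz m' (t + e - p)) =
      bz m e * bz (m + m' - e) t := by
  rcases lt_or_ge e 0 with he | he
  · rw [bz_of_neg m he, zero_mul]
    exact Finset.sum_eq_zero fun p _ => by rw [bz_of_neg p he, zero_mul]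
  obtain ⟨k, rfl⟩ := Int.eq_ofNat_of_zero_le he
  have hlow : ∀ p ∈ Finset.Icc 0 (t + k), p < k → bz p k * (bz m p * bz m' (t + k - p)) = 0 := by
    intro p hp hpk
    obtain ⟨n, rfl⟩ := Int.eq_ofNat_of_zero_le (Finset.mem_Icc.1 hp).1
    rw [bz_natCast, binom_eq_choose, Ring.choose_natCast, Nat.choose_eq_zero_of_lt (by omega)]
    simp
  rcases lt_or_ge t 0 with ht | ht
  · rw [bz_of_neg _ ht, mul_zero]
    exact Finset.sum_eq_zero fun p hp => hlow p hp (by have := Finset.mem_Icc.1 hp; omega)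
  obtain ⟨T, rfl⟩ := Int.eq_ofNat_of_zero_le ht
  rw [show m + m' - (k : ℤ) = (m - k) + m' by ring, bz_natCast, bz_natCast, binom_eq_choose m,
    binom_eq_choose (m - k + m'), Ring.add_choose_eq T (Commute.all _ _), Int.cast_sum,
    Finset.mul_sum]
  symm
  refine Finset.sum_of_injOn (fun ij : ℕ × ℕ => ((k + ij.1 : ℕ) : ℤ)) ?_ ?_ ?_ ?_
  · rintro ⟨i, j⟩ h ⟨i', j'⟩ h' hij
    have h1 := Finset.HasAntidiagonal.mem_antidiagonal.1 (Finset.mem_coe.1 h)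
    have h2 := Finset.HasAntidiagonal.mem_antidiagonal.1 (Finset.mem_coe.1 h')
    simp only [Nat.cast_inj] at hij h1 h2
    ext <;> simp only <;> omega
  · rintro ⟨i, j⟩ h
    have h1 := Finset.HasAntidiagonal.mem_antidiagonal.1 (Finset.mem_coe.1 h)
    simp only [Finset.coe_Icc, Set.mem_Icc] at h1 ⊢
    omega
  · intro p hp hp'
    refine hlow p hp ?_
    by_contra hpk
    refine hp' ⟨((p - k).toNat, (T + k - p).toNat), ?_, ?_⟩
    · have := Finset.mem_Icc.1 hp
      rw [Finset.mem_coe, Finset.HasAntidiagonal.mem_antidiagonal]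
      simp only
      omega
    · simp only
      omega
  · rintro ⟨i, j⟩ h
    have h1 := Finset.HasAntidiagonal.mem_antidiagonal.1 h
    simp only at h1 ⊢
    rw [show (T : ℤ) + k - ((k + i : ℕ) : ℤ) = (j : ℤ) by omega, bz_natCast, bz_natCast, bz_natCast,
      binom_eq_choose, binom_eq_choose, binom_eq_choose, Ring.choose_natCast, ← mul_assoc]
    have := Ring.choose_smul_choose m (Nat.le_add_right k i)
    rw [Nat.add_sub_cancel_left, nsmul_eq_mul] at this
    have h2 := congrArg (Int.cast : ℤ → ℂ) this
    push_cast at h2 ⊢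
    rw [h2, mul_assoc]

section Assoc

variable {I M : Type*} [AddCommGroup M] [Module ℂ M]

/-- Exchange of the parameter exponent and the exponents, in cyclic order. -/
def ro : Module.End ℂ ((I × ℤ) × ℤ × ℤ → M) := pull fun k => ((k.1.1, k.2.1), k.2.2, k.1.2)

/-- Make the parameter exponent the last exponent. -/
def rl : ((I × ℤ) × ℤ → M) →ₗ[ℂ] (I × ℤ × ℤ → M) := pull fun k => ((k.1, k.2.2), k.2.1)

lemma ro_dRP (F : (I × ℤ) × ℤ × ℤ → M) : ro (dRP F) = dd (ro F) := rfl

lemma ro_dd (F : (I × ℤ) × ℤ × ℤ → M) : ro (dd F) = dQR (ro F) := rfl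

lemma rl_dR1 (H : (I × ℤ) × ℤ → M) : rl (dR1 H) = dd (rl H) := rfl

/-- Substitute `x₁ = x₂ + z₁`, then `x₂ = x + z₂`. -/
def substL : Module.End ℂ ((I × ℤ) × ℤ × ℤ → M) where
  toFun F k := rho k.2.2 (rl (rho k.2.1 (ro F))) k.1
  map_add' F G := by ext; simp
  map_smul' c F := by ext; simp

/-- Substitute `x₂ = x + z₂`, `x₁ = x + z₁`, then `z₁ = z₂ + z`. -/
def substR : Module.End ℂ ((I × ℤ) × ℤ × ℤ → M) where
  toFun F k := rho k.2.1 (subst3 F) (k.1, k.2.2)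
  map_add' F G := by ext; simp
  map_smul' c F := by ext; simp

lemma substL_apply (F : (I × ℤ) × ℤ × ℤ → M) (i : I) (s p q : ℤ) :
    substL F ((i, s), p, q) = rho q (rl (rho p (ro F))) (i, s) := rfl

lemma substR_apply (F : (I × ℤ) × ℤ × ℤ → M) (k : I × ℤ) (p q : ℤ) :
    substR F (k, p, q) = rho p (subst3 F) (k, q) := rfl

/-- The families for which `substL` and `substR` are defined. -/
def dom4 : Submodule ℂ ((I × ℤ) × ℤ × ℤ → M) where
  carrier := {F | F ∈ dom3 ∧ ro F ∈ dom ∧ (∀ e, rl (rho e (ro F)) ∈ dom) ∧ subst3 F ∈ dom}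
  add_mem' h h' := ⟨add_mem h.1 h'.1, by rw [map_add]; exact add_mem h.2.1 h'.2.1, fun e => by
    rw [map_add, map_add, map_add]; exact add_mem (h.2.2.1 e) (h'.2.2.1 e), by
    rw [map_add]; exact add_mem h.2.2.2 h'.2.2.2⟩
  zero_mem' := ⟨zero_mem _, by rw [map_zero]; exact zero_mem _, fun e => by
    rw [map_zero, map_zero, map_zero]; exact zero_mem _, by rw [map_zero]; exact zero_mem _⟩
  smul_mem' c _ h := ⟨Submodule.smul_mem _ c h.1, by
    rw [map_smul]; exact Submodule.smul_mem _ c h.2.1, fun e => by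
    rw [map_smul, map_smul, map_smul]; exact Submodule.smul_mem _ c (h.2.2.1 e), by
    rw [map_smul]; exact Submodule.smul_mem _ c h.2.2.2⟩

lemma dRP_mem_dom4 {F : (I × ℤ) × ℤ × ℤ → M} (hF : F ∈ dom4) : dRP F ∈ dom4 := by
  obtain ⟨h1, h2, h3, h4⟩ := hF
  refine ⟨dRP_mem_dom3 h1, dd_mem_dom h2, fun e => ?_, ?_⟩
  · rw [ro_dRP, rho_dd h2]; exact h3 _
  · rw [subst3_dRP h1]; exact dd_mem_dom h4

lemma dd_mem_dom4 {F : (I × ℤ) × ℤ × ℤ → M} (hF : F ∈ dom4) : dd F ∈ dom4 := by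
  obtain ⟨h1, h2, h3, h4⟩ := hF
  refine ⟨dd_mem_dom3 h1, dQR_mem_dom h2, fun e => ?_, ?_⟩
  · rw [ro_dd, rho_dQR h2, rl_dR1]; exact dd_mem_dom (h3 _)
  · rw [subst3_dd h1]; exact shQ_mem_dom h4

lemma substL_dRP {F : (I × ℤ) × ℤ × ℤ → M} (hF : F ∈ dom4) :
    substL (dRP F) = shP (substL F) := by
  ext ⟨⟨i, s⟩, p, q⟩
  rw [substL_apply, ro_dRP, rho_dd hF.2.1]
  rfl

lemma substL_dd {F : (I × ℤ) × ℤ × ℤ → M} (hF : F ∈ dom4) : substL (dd F) = shQ (substL F) := by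
  ext ⟨⟨i, s⟩, p, q⟩
  rw [substL_apply, ro_dd, rho_dQR hF.2.1, rl_dR1, rho_dd (hF.2.2.1 _)]
  rfl

lemma substR_dRP {F : (I × ℤ) × ℤ × ℤ → M} (hF : F ∈ dom4) :
    substR (dRP F) = shP (substR F) := by
  ext ⟨⟨i, s⟩, p, q⟩
  rw [substR_apply, subst3_dRP hF.1, rho_dd hF.2.2.2]
  rfl

lemma substR_dd {F : (I × ℤ) × ℤ × ℤ → M} (hF : F ∈ dom4) : substR (dd F) = shQ (substR F) := by
  ext ⟨⟨i, s⟩, p, q⟩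
  rw [substR_apply, subst3_dd hF.1, rho_shQ hF.2.2.2]
  rfl

lemma e1_eq' : (e1 : Module.End ℂ ((I × ℤ) × ℤ × ℤ → M)) = dRP + dd := by simp [dRP, e1, dd]

lemma e1_mem_dom4 {F : (I × ℤ) × ℤ × ℤ → M} (hF : F ∈ dom4) : e1 F ∈ dom4 := by
  rw [e1_eq']; exact add_mem (dRP_mem_dom4 hF) (dd_mem_dom4 hF)

/-- The difference of `substL` and `substR`. -/
def del : Module.End ℂ ((I × ℤ) × ℤ × ℤ → M) := substL - substR

lemma del_dRP {F : (I × ℤ) × ℤ × ℤ → M} (hF : F ∈ dom4) : del (dRP F) = shP (del F) := by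
  rw [del, LinearMap.sub_apply, substL_dRP hF, substR_dRP hF]; rfl

lemma del_dd {F : (I × ℤ) × ℤ × ℤ → M} (hF : F ∈ dom4) : del (dd F) = shQ (del F) := by
  rw [del, LinearMap.sub_apply, substL_dd hF, substR_dd hF]; rfl

lemma del_e1 {F : (I × ℤ) × ℤ × ℤ → M} (hF : F ∈ dom4) :
    del (e1 F) = shP (del F) + shQ (del F) := by
  rw [e1_eq', LinearMap.add_apply, map_add, del_dRP hF, del_dd hF]

lemma exists_del_eq_zero {F : (I × ℤ) × ℤ × ℤ → M} (hF : F ∈ dom4) :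
    ∃ E : ℤ, ∀ k : (I × ℤ) × ℤ × ℤ, k.2.1 < E → del F k = 0 := by
  obtain ⟨-, ⟨K, N, h⟩, -, K', N', h'⟩ := hF
  refine ⟨min (-K) (-K'), ?_⟩
  rintro ⟨⟨i, s⟩, p, q⟩ hp
  simp only [lt_min_iff] at hp
  rw [del, LinearMap.sub_apply, Pi.sub_apply, substL_apply, substR_apply,
    rho_eq_zero_of_lt h (by omega), rho_eq_zero_of_lt h' (by omega), map_zero, map_zero]
  simp

lemma eq_zero_of_shP_add_shQ {J : Type*} {D : J × ℤ × ℤ → M} {E : ℤ}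
    (hE : ∀ k : J × ℤ × ℤ, k.2.1 < E → D k = 0) (h : shP D + shQ D = 0) : D = 0 := by
  have key : ∀ (n : ℕ) (j : J) (p q : ℤ), p < E + n → D (j, p, q) = 0 := by
    intro n
    induction n with
    | zero => intro j p q hp; exact hE _ (by simpa using hp)
    | succ n ih =>
      intro j p q hp
      have := congrFun h (j, p, q + 1)
      simp only [Pi.add_apply, shP_apply, shQ_apply, Pi.zero_apply, add_sub_cancel_right] at this
      rwa [ih j (p - 1) (q + 1) (by push_cast at hp; omega), zero_add] at this
  ext ⟨j, p, q⟩
  exact key (p - E + 1).toNat j p q (by omega)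

lemma del_eq_zero_of_e1 {F : (I × ℤ) × ℤ × ℤ → M} (hF : F ∈ dom4) (h : del (e1 F) = 0) :
    del F = 0 := by
  obtain ⟨E, hE⟩ := exists_del_eq_zero hF
  rw [del_e1 hF] at h
  exact eq_zero_of_shP_add_shQ hE h

lemma del_eq_zero_of_pow {D : Module.End ℂ ((I × ℤ) × ℤ × ℤ → M)} (hD : ∀ F ∈ dom4, D F ∈ dom4)
    (h : ∀ F ∈ dom4, del (D F) = 0 → del F = 0) {F : (I × ℤ) × ℤ × ℤ → M} (hF : F ∈ dom4) (n : ℕ)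
    (h0 : del ((D ^ n) F) = 0) : del F = 0 := by
  induction n with
  | zero => exact h0
  | succ n ih =>
    rw [pow_succ', Module.End.mul_apply] at h0
    exact ih (h _ (pow_mem_submodule hD hF n) h0)

lemma ro_mem_bdd {N : I → ℤ} {X : (I × ℤ) × ℤ × ℤ → M} (hX : X ∈ bdd3 N) :
    ro X ∈ bdd fun k : I × ℤ => N k.1 := fun k p q h => hX k.1 p q k.2 (by tauto)

lemma rl_rho_ro_mem_bdd {N : I → ℤ} {X : (I × ℤ) × ℤ × ℤ → M} (hX : X ∈ bdd3 N) (e : ℤ) :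
    rl (rho e (ro X)) ∈ bdd fun i => min (N i) (2 * N i - e) := by
  rintro i q r h
  simp only [lt_min_iff] at h
  change rho e (ro X) ((i, r), q) = 0
  rw [rho_of_bdd (ro_mem_bdd hX)]
  refine finsum_eq_zero_of_forall_eq_zero fun m => ?_
  change bz m e • X ((i, m), q - m + e, r) = 0
  rw [hX i m _ r (by omega), smul_zero]

lemma substL_eq_wsum {N : I → ℤ} {X : (I × ℤ) × ℤ × ℤ → M} (hX : X ∈ bdd3 N) (i : I)
    (s e t : ℤ) : substL X ((i, s), e, t) =
      wsum N (fun m m' => bz m e * bz (m + m' - e) t) i (s + e + t) X := by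
  rw [substL_apply, rho_of_bdd (rl_rho_ro_mem_bdd hX e)]
  have h1 : ∀ q r, rl (rho e (ro X)) (i, q, r) = ∑ m ∈ Finset.Icc (N i) (q + r + e - 2 * N i),
      bz m e • X ((i, m), q - m + e, r) := by
    intro q r
    change rho e (ro X) ((i, r), q) = _
    rw [rho_of_bdd (ro_mem_bdd hX)]
    change ∑ᶠ m : ℤ, bz m e • X ((i, m), q - m + e, r) = _
    refine finsum_eq_finsetSum_of_support_subset _ fun m hm => ?_
    by_contra h
    rw [Finset.mem_coe, Finset.mem_Icc] at h
    refine hm ?_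
    simp only
    rw [hX i m _ r (by omega), smul_zero]
  simp only [tau, h1, Finset.smul_sum]
  have h2 : ∀ q : ℤ, q + (s - q + t) + e - 2 * N i = s + e + t - 2 * N i := fun q => by ring
  simp only [h2]
  rw [finsum_sum_comm]
  · rw [wsum]
    refine Finset.sum_congr rfl fun m _ => ?_
    rw [← finsum_bdd3 hX fun m m' => bz m e * bz (m + m' - e) t,
      ← finsum_comp_equiv (Equiv.addRight (m - e))]
    refine finsum_congr fun m' => ?_
    simp only [Equiv.coe_addRight]
    rw [smul_smul, mul_comm, show m' + (m - e) = m + m' - e by ring]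
    congr 3
    ring_nf
  · intro m _
    refine (Finset.finite_toSet (Finset.Icc (N i + m - e) (s + t - N i))).subset fun q hq => ?_
    by_contra h
    rw [Finset.mem_coe, Finset.mem_Icc] at h
    refine hq ?_
    simp only
    rw [hX i m _ _ (by omega), smul_zero, smul_zero]

lemma subst3_mem_bdd {N : I → ℤ} {X : (I × ℤ) × ℤ × ℤ → M} (hX : X ∈ bdd3 N) :
    subst3 X ∈ bdd 0 := by
  rintro ⟨i, s⟩ p q h
  rw [subst3_eq_wsum hX]
  refine Finset.sum_eq_zero fun m _ => Finset.sum_eq_zero fun m' _ => ?_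
  simp only
  rcases h with h | h
  · rw [bz_of_neg m h, zero_mul, zero_smul]
  · rw [bz_of_neg m' h, mul_zero, zero_smul]

lemma substR_eq_wsum {N : I → ℤ} {X : (I × ℤ) × ℤ × ℤ → M} (hX : X ∈ bdd3 N) (i : I)
    (s e t : ℤ) : substR X ((i, s), e, t) =
      wsum N (fun m m' => bz m e * bz (m + m' - e) t) i (s + e + t) X := by
  rw [substR_apply, rho_of_bdd (subst3_mem_bdd hX), tau_eq_tauN (subst3_mem_bdd hX), tauN_apply]
  simp only [subst3_eq_wsum hX, wsum, Pi.zero_apply, sub_zero]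
  have h1 : ∀ p : ℤ, s + p + (t - p + e) = s + e + t := fun p => by ring
  simp only [h1, Finset.smul_sum, smul_smul]
  rw [Finset.sum_comm]
  refine Finset.sum_congr rfl fun m _ => ?_
  rw [Finset.sum_comm]
  refine Finset.sum_congr rfl fun m' _ => ?_
  rw [← Finset.sum_smul, ← sum_bz_mul_bz]
  congr 1
  exact Finset.sum_congr rfl fun p _ => by rw [show t - p + e = t + e - p by ring]

lemma del_of_bdd3 {N : I → ℤ} {X : (I × ℤ) × ℤ × ℤ → M} (hX : X ∈ bdd3 N) : del X = 0 := by
  ext ⟨⟨i, s⟩, e, t⟩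
  rw [del, LinearMap.sub_apply, Pi.sub_apply, substL_eq_wsum hX, substR_eq_wsum hX, sub_self]
  rfl

lemma substL_eq_substR {F : (I × ℤ) × ℤ × ℤ → M} (hF : F ∈ dom4) {K k : ℕ} {N : I → ℤ}
    (h : ((e1 * dd : Module.End ℂ ((I × ℤ) × ℤ × ℤ → M)) ^ K) ((dRP ^ k) F) ∈ bdd3 N) :
    substL F = substR F := by
  refine sub_eq_zero.1 ?_
  change del F = 0
  refine del_eq_zero_of_pow (fun _ => dRP_mem_dom4) (fun F hF h => ?_) hF k ?_
  · rw [del_dRP hF] at h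
    exact shP_injective (h.trans (map_zero _).symm)
  refine del_eq_zero_of_pow (D := e1 * dd) (fun F hF => e1_mem_dom4 (dd_mem_dom4 hF))
    (fun F hF h => ?_) (pow_mem_submodule (fun _ => dRP_mem_dom4) hF k) K (del_of_bdd3 h)
  have h1 := del_eq_zero_of_e1 (dd_mem_dom4 hF) h
  rw [del_dd hF] at h1
  exact shQ_injective (h1.trans (map_zero _).symm)

end Assoc

section AssocAB

variable {W V : Type*} [AddCommGroup W] [Module ℂ W] [AddCommGroup V] [Module ℂ V]
variable {ι : V →ₗ[ℂ] EW W} {Y : V →ₗ[ℂ] EW V}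

lemma ro_tripL (a b c : EW W) : ro (tripL a (AB b c)) =
    lift2 (fun k : W × ℤ => mf c k.1 (-k.2 - 1)) (fun _ => LinearMap.id) (AB a b) := rfl

lemma rl_rho_ro_tripL {a b : EW W} (h : AB a b ∈ dom) (c : EW W) (e : ℤ) :
    rl (rho e (ro (tripL a (AB b c)))) = AB (YE a b (-e - 1)) c := by
  ext ⟨w, q, r⟩
  rw [ro_tripL, rho_lift _ _ h]
  change rho e (AB a b) (mf c w (-r - 1), q) = _
  rw [rho_AB h, AB_apply]

/-- The iterate formula for vertex operators. -/
lemma iterate_vertexOperators (hι : Function.Injective ι)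
    (hY : ∀ a b n, ι (mf (Y a) b n) = YE (ι a) (ι b) n)
    (hL : ∀ a b, Loc (Set.range ι) (Set.range ι) (ι a) (ι b)) (a b c : V) (e t : ℤ) :
    mf (Y (mf (Y a) b (-e - 1))) c (-t - 1) = rho e (AB (Y a) (Y b)) (c, t) := by
  have hd : ∀ a b, AB (ι a) (ι b) ∈ dom := fun a b => (hL a b).mem_dom
  have hV : AB (Y a) (Y b) ∈ dom := (loc_vertexOperators hι hY hL a b).mem_dom
  have h4 : tripL (ι a) (AB (ι b) (ι c)) ∈ dom4 := by
    refine ⟨tripL_mem_dom3 hY hd a b c, ?_, fun e => ?_, ?_⟩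
    · rw [ro_tripL]; exact lift2_mem_dom _ _ (hd a b)
    · rw [rl_rho_ro_tripL (hd a b), ← hY]; exact hd _ _
    · rw [subst3_tripL hY hd]; exact lift2_mem_dom _ _ hV
  obtain ⟨k, hk⟩ := hL a b
  obtain ⟨K, N, hK⟩ := exists_compL_mem_bdd3 (c := ι c)
    (by rintro _ ⟨v, rfl⟩; exact hd v c) (hd b c) hk
  rw [compL, LinearMap.comp_apply, sub3_dd_pow, sub3_AB] at hK
  have h := substL_eq_substR h4 hK
  refine hι (ew_ext ?_)
  intro w m
  have := congrFun h ((w, -m - 1), e, t)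
  rw [substL_apply, rl_rho_ro_tripL (hd a b), ← hY, rho_AB (hd _ _), ← hY, substR_apply,
    subst3_tripL hY hd, til, rho_lift _ _ hV] at this
  simpa using this

end AssocAB

end NVA

namespace NVA

variable {W : Type*} [AddCommGroup W] [Module ℂ W]

lemma exists_sum_psAct {ι : Type*} {Y : ι → EW W} {F : W × ℤ × ℤ → W}
    (hF : F ∈ PS dd (BASet (Set.range Y) (Set.range Y))) :
    ∃ (r : ℕ) (g : Fin r → PowerSeries ℂ) (v u : Fin r → ι),
      F = ∑ i, psAct (-dd) (g i) (BA (Y (v i)) (Y (u i))) := by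
  rw [← PS_neg] at hF
  refine PS_induction (p := fun F => ∃ (r : ℕ) (g : Fin r → PowerSeries ℂ) (v u : Fin r → ι),
      F = ∑ i, psAct (-dd) (g i) (BA (Y (v i)) (Y (u i)))) ?_ ?_ ?_ ?_ hF
  · exact ⟨0, Fin.elim0, Fin.elim0, Fin.elim0, by simp⟩
  · rintro _ _ ⟨r, g, v, u, rfl⟩ ⟨r', g', v', u', rfl⟩
    refine ⟨r + r', Fin.append g g', Fin.append v v', Fin.append u u', ?_⟩
    rw [Fin.sum_univ_add]
    simp
  · rintro c _ ⟨r, g, v, u, rfl⟩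
    refine ⟨r, fun i => c • g i, v, u, ?_⟩
    rw [Finset.smul_sum]
    refine Finset.sum_congr rfl fun i _ => ?_
    rw [psAct_smul_left (nullFam_neg (iterTrunc_BA _ _).nullFam)]
  · rintro g _ ⟨_, ⟨v, rfl⟩, _, ⟨u, rfl⟩, rfl⟩
    exact ⟨1, fun _ => g, fun _ => v, fun _ => u, by simp⟩

lemma exists_sLocPair {V : Type*} {Y : V → EW W} {a b : V}
    (h : Loc (Set.range Y) (Set.range Y) (Y a) (Y b)) :
    ∃ (k r : ℕ) (f : Fin r → LC) (v u : Fin r → V),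
      sLocPair (fun x => mf (Y x)) k a b f v u := by
  obtain ⟨k, hk⟩ := h
  obtain ⟨r, g, v, u, hF⟩ := exists_sum_psAct (Submodule.smul_mem _ ((-1 : ℂ) ^ k) hk)
  have hx : (HahnSeries.single 1 1 : LC) ≠ 0 := by simp
  have h1 : ((-1 : ℂ) ^ k • (dd ^ k : Module.End ℂ (W × ℤ × ℤ → W))) = (-dd) ^ k := by
    rw [← smul_pow, neg_one_smul]
  set f : Fin r → LC := fun i =>
    ((HahnSeries.single 1 1 : LC) ^ k)⁻¹ * HahnSeries.ofPowerSeries ℤ ℂ (g i)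
  have h2 : (dd ^ k) (AB (Y a) (Y b)) = ∑ i, (dd ^ k) (smulJ (f i) (BA (Y (v i)) (Y (u i)))) := by
    have h3 : ((-1 : ℂ) ^ k) ≠ 0 := pow_ne_zero _ (by norm_num)
    refine smul_right_injective _ h3 ?_
    simp only
    rw [hF, Finset.smul_sum]
    refine Finset.sum_congr rfl fun i _ => ?_
    rw [← LinearMap.smul_apply, h1]
    exact (neg_dd_pow_smulJ_eq (mul_inv_cancel_left₀ (pow_ne_zero k hx) _)
      (iterTrunc_BA _ _)).symm
  refine ⟨k, r, f, v, u, fun w m t => ?_⟩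
  have h4 := congr_fun h2 (w, m, t)
  rw [Finset.sum_apply] at h4
  simp only [← mulF_X_sub_X_pow] at h4
  exact h4

end NVA

namespace NVA

section WeakAssoc

variable {J M : Type*} [AddCommGroup M] [Module ℂ M]

/-- Families vanishing when the second exponent is below the bound `T`. -/
def bddR (T : J → ℤ) : Submodule ℂ (J × ℤ × ℤ → M) where
  carrier := {F | ∀ j m t, t < T j → F (j, m, t) = 0}
  add_mem' hF hG j m t h := by simp [hF j m t h, hG j m t h]
  zero_mem' _ _ _ _ := rfl
  smul_mem' c F hF j m t h := by simp [hF j m t h]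

lemma shP_mem_bddR {T : J → ℤ} {F : J × ℤ × ℤ → M} (hF : F ∈ bddR T) : shP F ∈ bddR T :=
  fun j m t h => hF j (m - 1) t h

lemma shQ_mem_bddR {T : J → ℤ} {F : J × ℤ × ℤ → M} (hF : F ∈ bddR T) : shQ F ∈ bddR T :=
  fun j m t h => hF j m (t - 1) (by omega)

lemma pow_mem_of_maps {X : Type*} [AddCommGroup X] [Module ℂ X] {D : Module.End ℂ X}
    {p : Submodule ℂ X} (h : ∀ F ∈ p, D F ∈ p) (n : ℕ) {F : X} (hF : F ∈ p) : (D ^ n) F ∈ p := by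
  induction n with
  | zero => simpa
  | succ n ih => rw [pow_succ']; exact h _ ih

/-- Multiplication by the sum of the two variables. -/
def shPQ : Module.End ℂ (J × ℤ × ℤ → M) := shP + shQ

/-- The coefficient of `x₀^a x₂^b` in `F(x₀ + x₂, x₂)`, in nonnegative powers of `x₂`. -/
def sig (F : J × ℤ × ℤ → M) : J × ℤ × ℤ → M :=
  fun k => ∑ᶠ m : ℤ, bz m (m - k.2.1) • F (k.1, m, k.2.2 - m + k.2.1)

lemma sig_finite {T : J → ℤ} {F : J × ℤ × ℤ → M} (hF : F ∈ bddR T) (j : J) (a b : ℤ) :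
    Function.HasFiniteSupport fun m : ℤ => bz m (m - a) • F (j, m, b - m + a) := by
  refine (Set.finite_Icc a (b + a - T j)).subset fun m hm => ?_
  by_contra h
  refine hm ?_
  rw [Set.mem_Icc, not_and_or, not_le, not_le] at h
  rcases h with h | h
  · simp only [bz_of_neg m (show m - a < 0 by omega), zero_smul]
  · simp only [hF j m (b - m + a) (by omega), smul_zero]

lemma sig_shQ (F : J × ℤ × ℤ → M) : sig (shQ F) = shQ (sig F) := by
  ext ⟨j, a, b⟩
  simp only [sig, shQ_apply]
  exact finsum_congr fun m => by rw [show b - m + a - 1 = b - 1 - m + a by ring]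

lemma sig_shP {T : J → ℤ} {F : J × ℤ × ℤ → M} (hF : F ∈ bddR T) :
    sig (shP F) = shP (sig F) + shQ (sig F) := by
  ext ⟨j, a, b⟩
  simp only [sig, shP_apply, shQ_apply, Pi.add_apply]
  rw [← finsum_comp_equiv (Equiv.addRight (1 : ℤ)), ← finsum_add_distrib]
  · refine finsum_congr fun m => ?_
    simp only [Equiv.coe_addRight]
    rw [show m + 1 - a = m - (a - 1) by ring, bz_succ, add_smul, add_sub_cancel_right]
    congr 3 <;> ring_nf
  · exact sig_finite hF j (a - 1) b
  · exact sig_finite hF j a (b - 1)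

lemma sig_shP_pow {T : J → ℤ} {F : J × ℤ × ℤ → M} (hF : F ∈ bddR T) (n : ℕ) :
    sig ((shP ^ n) F) = (shPQ ^ n) (sig F) := by
  induction n with
  | zero => simp
  | succ n ih =>
    rw [pow_succ', pow_succ', Module.End.mul_apply, Module.End.mul_apply, ← ih,
      sig_shP (pow_mem_of_maps (fun _ => shP_mem_bddR) n hF)]
    rfl

lemma sig_dd {T : J → ℤ} {F : J × ℤ × ℤ → M} (hF : F ∈ bddR T) :
    sig (dd F) = shP (sig F) := by
  have h1 : sig (shP F) = sig (dd F) + sig (shQ F) := by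
    ext ⟨j, a, b⟩
    simp only [sig, Pi.add_apply]
    have h2 := sig_finite (sub_mem (shP_mem_bddR hF) (shQ_mem_bddR hF)) j a b
    rw [← finsum_add_distrib (by exact h2) (sig_finite (shQ_mem_bddR hF) j a b)]
    refine finsum_congr fun m => ?_
    rw [← smul_add]
    simp
  rw [sig_shP hF, sig_shQ, add_left_inj] at h1
  exact h1.symm

lemma sig_dd_pow {T : J → ℤ} {F : J × ℤ × ℤ → M} (hF : F ∈ bddR T) (n : ℕ) :
    sig ((dd ^ n) F) = (shP ^ n) (sig F) := by
  induction n with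
  | zero => simp
  | succ n ih =>
    rw [pow_succ', pow_succ', Module.End.mul_apply, Module.End.mul_apply, ← ih, sig_dd
      (pow_mem_of_maps (fun _ h => sub_mem (shP_mem_bddR h) (shQ_mem_bddR h)) n hF)]

/-- The coefficients of the expansion `rho`, as a two-variable family. -/
def rhoFam : (J × ℤ × ℤ → M) →ₗ[ℂ] (J × ℤ × ℤ → M) where
  toFun F k := rho k.2.1 F (k.1, k.2.2)
  map_add' F G := by ext k; simp
  map_smul' c F := by ext k; simp

lemma rhoFam_apply (F : J × ℤ × ℤ → M) (k : J × ℤ × ℤ) :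
    rhoFam F k = rho k.2.1 F (k.1, k.2.2) := rfl

lemma rhoFam_dd_pow {F : J × ℤ × ℤ → M} (hF : F ∈ dom) (n : ℕ) :
    rhoFam ((dd ^ n) F) = (shP ^ n) (rhoFam F) := by
  induction n with
  | zero => simp
  | succ n ih =>
    rw [pow_succ', pow_succ', Module.End.mul_apply, Module.End.mul_apply, ← ih]
    ext k
    rw [shP_apply, rhoFam_apply, rhoFam_apply, rho_dd (dd_pow_mem_dom hF n)]

lemma rhoFam_shP_pow {F : J × ℤ × ℤ → M} (hF : F ∈ dom) (n : ℕ) :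
    rhoFam ((shP ^ n) F) = (shPQ ^ n) (rhoFam F) := by
  induction n with
  | zero => simp
  | succ n ih =>
    rw [pow_succ', pow_succ', Module.End.mul_apply, Module.End.mul_apply, ← ih]
    ext k
    rw [rhoFam_apply, rho_shP (pow_mem_of_maps (fun _ => shP_mem_dom) n hF)]
    rfl

lemma bz_symm {m : ℤ} (hm : 0 ≤ m) (e : ℤ) : bz m (m - e) = bz m e := by
  lift m to ℕ using hm
  rcases lt_or_ge e 0 with h | h
  · rw [bz_of_neg _ h]
    obtain ⟨n, hn⟩ := Int.eq_ofNat_of_zero_le (show 0 ≤ (m : ℤ) - e by omega)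
    rw [hn, bz_natCast, binom_natCast_eq, Nat.choose_eq_zero_of_lt (by omega), Nat.cast_zero]
  · lift e to ℕ using h
    rcases lt_or_ge m e with h | h
    · rw [bz_of_neg _ (by omega), bz_natCast, binom_natCast_eq, Nat.choose_eq_zero_of_lt h,
        Nat.cast_zero]
    · rw [← Nat.cast_sub h, bz_natCast, bz_natCast, binom_natCast_eq, binom_natCast_eq,
        Nat.choose_symm h]

lemma sig_eq_rhoFam_of_bdd {N : J → ℤ} {F : J × ℤ × ℤ → M} (hF : F ∈ bdd N) {j : J}
    (hj : ∀ m t, m < 0 → F (j, m, t) = 0) (a b : ℤ) : sig F (j, a, b) = rhoFam F (j, a, b) := by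
  rw [rhoFam_apply, rho_of_bdd hF]
  refine finsum_congr fun m => ?_
  rcases lt_or_ge m 0 with h | h
  · rw [hj _ _ h, smul_zero, smul_zero]
  · rw [bz_symm h]

/-- Weak associativity of the two expansions of a family that becomes Laurent after
multiplication by a power of `x₁ - x₂`. -/
lemma exists_pow_sig_eq {F : J × ℤ × ℤ → M} (hF : F ∈ dom) {T : J → ℤ} (hT : F ∈ bddR T) (j : J) :
    ∃ l : ℕ, ∀ a b : ℤ,
      (shPQ ^ l) (sig F) (j, a, b) = (shPQ ^ l) (rhoFam F) (j, a, b) := by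
  obtain ⟨K, N, hK⟩ := hF
  have hF : F ∈ dom := ⟨K, N, hK⟩
  refine ⟨(-N j).toNat, fun a b => ?_⟩
  set l := (-N j).toNat
  have hT' := pow_mem_of_maps (fun _ => shP_mem_bddR) l hT
  have hd := pow_mem_of_maps (fun _ => shP_mem_dom) l hF
  rw [← sig_shP_pow hT, ← rhoFam_shP_pow hF]
  have hc : (dd ^ K) ((shP ^ l) F) = (shP ^ l) ((dd ^ K) F) :=
    dd_pow_comm (shP ^ l) (fun G => (pow_intertwine (fun G => (dd_shP G)) l G)) K F
  have hb := pow_mem_of_maps (fun _ => shP_mem_bdd) l hK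
  have h := sig_eq_rhoFam_of_bdd hb (j := j) (fun m t hm => by
    rw [shP_pow_apply]
    exact hK j _ t (Or.inl (by simp only; omega))) (a + K) b
  rw [← hc, sig_dd_pow hT', rhoFam_dd_pow hd, shP_pow_apply, shP_pow_apply] at h
  simpa using h

lemma mulSubPoly_X_zero_pow (l : ℕ) (F : J × ℤ × ℤ → M) (j : J) (a b : ℤ) :
    mulSubPoly (MvPolynomial.X 0 ^ l) (fun a b => F (j, a, b)) a b =
      (shPQ ^ l) F (j, a, b) := by
  have hc : Commute (shQ : Module.End ℂ (J × ℤ × ℤ → M)) shP := rfl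
  rw [mulSubPoly, shPQ, add_comm shP, hc.add_pow, MvPolynomial.X_pow_eq_monomial,
    MvPolynomial.support_monomial, if_neg one_ne_zero, Finset.sum_singleton, LinearMap.sum_apply,
    Finset.sum_apply]
  simp only [Finsupp.single_eq_same, MvPolynomial.coeff_monomial, if_true, one_mul]
  refine Finset.sum_congr rfl fun i hi => ?_
  have hi : i ≤ l := by simpa [Nat.lt_succ_iff] using hi
  rw [(Nat.cast_commute (l.choose i) _).symm.eq, ← nsmul_eq_mul, LinearMap.smul_apply,
    Pi.smul_apply, Module.End.mul_apply, shQ_pow_apply, shP_pow_apply, Nat.cast_smul_eq_nsmul]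
  simp [Nat.cast_sub hi]

end WeakAssoc

end NVA

namespace NVA

variable {W : Type*} [AddCommGroup W] [Module ℂ W]
variable {V : Type*}

lemma prodCE_eq_sig (Y : V → EW W) (u v : V) (w : W) (a b : ℤ) :
    prodCE (fun x => mf (Y x)) (fun x => mf (Y x)) u v w a b = sig (AB (Y u) (Y v)) (w, a, b) := by
  refine finsum_congr fun m => ?_
  rw [AB_apply, bz]
  simp only [sub_nonneg]
  split_ifs
  · ring_nf
  · rw [zero_smul]

lemma exists_AB_bddR (a b : EW W) : ∃ T, AB a b ∈ bddR T := by
  choose T hT using fun w => AB_trunc a b w 0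
  exact ⟨T, fun w m t h => by simpa using hT w t h m⟩

/-- Weak associativity for two fields and the expansion of their product. -/
lemma exists_mulSubPoly_eq {Y : V → EW W} {Y₁ : V → V → ℤ → V} {u v : V}
    (hd : AB (Y u) (Y v) ∈ dom)
    (hY : ∀ (w : W) (e t : ℤ), mf (Y (Y₁ u v (-e - 1))) w (-t - 1) =
      rho e (AB (Y u) (Y v)) (w, t)) (w : W) :
    ∃ l : ℕ, ∀ a b : ℤ,
      mulSubPoly (MvPolynomial.X 0 ^ l)
        (prodCE (fun x => mf (Y x)) (fun x => mf (Y x)) u v w) a b =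
      mulSubPoly (MvPolynomial.X 0 ^ l) (assocCE Y₁ (fun x => mf (Y x)) u v w) a b := by
  obtain ⟨T, hT⟩ := exists_AB_bddR (Y u) (Y v)
  obtain ⟨l, hl⟩ := exists_pow_sig_eq hd hT w
  refine ⟨l, fun a b => ?_⟩
  have h1 : prodCE (fun x => mf (Y x)) (fun x => mf (Y x)) u v w =
      fun a b => sig (AB (Y u) (Y v)) (w, a, b) := by
    ext a b
    exact prodCE_eq_sig Y u v w a b
  have h2 : assocCE Y₁ (fun x => mf (Y x)) u v w =
      fun a b => rhoFam (AB (Y u) (Y v)) (w, a, b) := by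
    ext a b
    exact hY w a b
  rw [h1, h2, mulSubPoly_X_zero_pow, mulSubPoly_X_zero_pow, hl]

lemma YE_add_left {a a' b : EW W} (h : AB a b ∈ dom) (h' : AB a' b ∈ dom) (n : ℤ) :
    YE (a + a') b n = YE a b n + YE a' b n := by
  apply ew_ext
  intro w m
  have h2 : AB (a + a') b ∈ dom := by rw [AB_add_left]; exact add_mem h h'
  have h3 : mf (YE a b n + YE a' b n) w m = mf (YE a b n) w m + mf (YE a' b n) w m := rfl
  rw [h3, mf_YE h2, mf_YE h, mf_YE h', AB_add_left, map_add, Pi.add_apply]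

lemma YE_smul_left {a b : EW W} (h : AB a b ∈ dom) (c : ℂ) (n : ℤ) :
    YE (c • a) b n = c • YE a b n := by
  apply ew_ext
  intro w m
  have h2 : AB (c • a) b ∈ dom := by rw [AB_smul_left]; exact Submodule.smul_mem _ _ h
  have h3 : mf (c • YE a b n) w m = c • mf (YE a b n) w m := rfl
  rw [h3, mf_YE h2, mf_YE h, AB_smul_left, map_smul, Pi.smul_apply]

lemma YE_add_right {a b b' : EW W} (h : AB a b ∈ dom) (h' : AB a b' ∈ dom) (n : ℤ) :
    YE a (b + b') n = YE a b n + YE a b' n := by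
  apply ew_ext
  intro w m
  have h2 : AB a (b + b') ∈ dom := by rw [AB_add_right]; exact add_mem h h'
  have h3 : mf (YE a b n + YE a b' n) w m = mf (YE a b n) w m + mf (YE a b' n) w m := rfl
  rw [h3, mf_YE h2, mf_YE h, mf_YE h', AB_add_right, map_add, Pi.add_apply]

lemma YE_smul_right {a b : EW W} (h : AB a b ∈ dom) (c : ℂ) (n : ℤ) :
    YE a (c • b) n = c • YE a b n := by
  apply ew_ext
  intro w m
  have h2 : AB a (c • b) ∈ dom := by rw [AB_smul_right]; exact Submodule.smul_mem _ _ h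
  have h3 : mf (c • YE a b n) w m = c • mf (YE a b n) w m := rfl
  rw [h3, mf_YE h2, mf_YE h, AB_smul_right, map_smul, Pi.smul_apply]

lemma exists_YE_eq_zero {a b : EW W} (h : AB a b ∈ dom) : ∃ N : ℤ, ∀ n, N ≤ n → YE a b n = 0 := by
  obtain ⟨K, N, hK⟩ := h
  refine ⟨K, fun n hn => ?_⟩
  apply ew_ext
  intro w m
  rw [mf_YE ⟨K, N, hK⟩, rho_eq_zero_of_lt hK (by omega)]
  rfl

/-- The vertex operator map on a closed space of mutually local fields. -/
def vertexOp (U : Submodule ℂ (EW W)) (hd : ∀ a ∈ U, ∀ b ∈ U, AB a b ∈ dom)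
    (hc : ∀ a ∈ U, ∀ b ∈ U, ∀ n : ℤ, YE a b n ∈ U) : ↥U →ₗ[ℂ] EW ↥U where
  toFun a :=
    ⟨{ toFun := fun b n => ⟨YE a b n, hc a a.2 b b.2 n⟩
       map_add' := fun b b' => funext fun n => Subtype.ext
        (YE_add_right (hd a a.2 b b.2) (hd a a.2 b' b'.2) n)
       map_smul' := fun c b => funext fun n => Subtype.ext (YE_smul_right (hd a a.2 b b.2) c n) },
     fun b => by
      obtain ⟨N, hN⟩ := exists_YE_eq_zero (hd a a.2 b b.2)
      exact ⟨N, fun n hn => Subtype.ext (hN n hn)⟩⟩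
  map_add' a a' := ew_ext fun b n => Subtype.ext
    (YE_add_left (hd a a.2 b b.2) (hd a' a'.2 b b.2) n)
  map_smul' c a := ew_ext fun b n => Subtype.ext (YE_smul_left (hd a a.2 b b.2) c n)

end NVA

namespace NVA

/-- cf. Theorem 5.8 / `tSlocality-key`.  For any `𝒮`-local subset
`S` of `ℰ(W)`, the nonlocal vertex algebra `⟨S⟩` generated by `S` is a weak quantum
vertex algebra and `W` is a faithful `⟨S⟩`-module with `Y_W(α(x), x₀) = α(x₀)`. -/
theorem statement15 {W : Type*} [AddCommGroup W] [Module ℂ W]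
    (S : Set (EW W)) (hS : SLocal S)
    (U : Submodule ℂ (EW W)) (hU : IsGenVA S U) :
    ∃ A : NLVA ↥U, (A.one : EW W) = oneE ∧
      (∀ (a b : ↥U) (n : ℤ), ((Yf A a b n : ↥U) : EW W) = YE (a : EW W) (b : EW W) n) ∧
      IsWeakQVA A ∧
      IsModule A U.subtype ∧ Function.Injective U.subtype := by
  have hι : Function.Injective U.subtype := U.subtype_injective
  have hc := hU.2.1
  have hrange : Set.range U.subtype = (U : Set (EW W)) := Subtype.range_coe
  have hL : ∀ a b : ↥U, Loc (Set.range U.subtype) (Set.range U.subtype)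
      (U.subtype a) (U.subtype b) := fun a b => by
    rw [hrange]
    exact loc_of_isGenVA hS hU a.2 b.2
  have hd : ∀ a ∈ U, ∀ b ∈ U, AB a b ∈ dom := fun a ha b hb => (hL ⟨a, ha⟩ ⟨b, hb⟩).mem_dom
  have hY : ∀ (a b : ↥U) (n : ℤ), U.subtype (mf (vertexOp U hd hc a) b n) =
      YE (U.subtype a) (U.subtype b) n := fun _ _ _ => rfl
  have hloc := loc_vertexOperators hι hY hL
  have hw : ∀ u v w : ↥U, ∃ l : ℕ, ∀ a b : ℤ,
      mulSubPoly (MvPolynomial.X 0 ^ l) (prodCE (fun x => mf (vertexOp U hd hc x))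
        (fun x => mf (vertexOp U hd hc x)) u v w) a b =
      mulSubPoly (MvPolynomial.X 0 ^ l) (assocCE (fun x y n => mf (vertexOp U hd hc x) y n)
        (fun x => mf (vertexOp U hd hc x)) u v w) a b := fun u v w =>
    exists_mulSubPoly_eq (Y := vertexOp U hd hc)
      (Y₁ := fun x y n => mf (vertexOp U hd hc x) y n) (hloc u v).mem_dom
      (iterate_vertexOperators hι hY hL u v) w
  let A : NLVA ↥U :=
    { Y := vertexOp U hd hc
      one := ⟨oneE, hU.2.2.1⟩
      vac := fun v n => Subtype.ext <| (YE_one_left (v : EW W) n).trans (by split_ifs <;> rfl)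
      creation0 := fun v n hn => Subtype.ext (YE_one_right_of_nonneg (v : EW W) hn)
      creation1 := fun v => Subtype.ext (YE_one_right (v : EW W))
      wassoc := hw }
  refine ⟨A, rfl, fun _ _ _ => rfl, fun u v => exists_sLocPair (hloc u v),
    ⟨fun w n => rfl, fun u v w => ?_⟩, hι⟩
  exact exists_mulSubPoly_eq (Y := U.subtype) (Y₁ := Yf A) (hd u u.2 v v.2)
    (fun w e t => (rho_AB (hd u u.2 v v.2) e w t).symm) w

end NVA
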